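/- Let p ≠ 3 be a prime with p ≡ 1 (mod 3) and let r ∈ ℕ. Then H_{2,0,3}(p^r) = (p^r/2)·(p^{r+1}−1)/(p−1) − (1/2)·a(p^r), and for m ∈ {1,2}, H_{2,m,3}(p^r) = −(p^{3⌊r/2⌋+3}−1)/(p³−1) + (3p^r/4)·(p^{r+1}−1)/(p−1) − p^r·(p^{⌊(r+1)/2⌋}−1)/(p−1) + (1/4)·a(p^r). -/

import Mathlib

open scoped BigOperators

namespace HurwitzPaper

/-- Evaluation of the binary quadratic form `(a,b,c)` (i.e. `a x² + b x y + c y²`). -/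
def formEval (Q : ℤ × ℤ × ℤ) (x y : ℤ) : ℤ :=
  Q.1 * x ^ 2 + Q.2.1 * x * y + Q.2.2 * y ^ 2

/-- Discriminant `b² - 4ac` of the form `(a,b,c)`. -/
def formDisc (Q : ℤ × ℤ × ℤ) : ℤ := Q.2.1 ^ 2 - 4 * Q.1 * Q.2.2

/-- Right action of `γ ∈ SL₂(ℤ)` on a binary quadratic form: `(Q∘γ)(x,y) = Q(ax+by, cx+dy)`. -/
def formAct (γ : Matrix.SpecialLinearGroup (Fin 2) ℤ) (Q : ℤ × ℤ × ℤ) : ℤ × ℤ × ℤ :=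
  (formEval Q (γ.1 0 0) (γ.1 1 0),
   formEval Q (γ.1 0 0 + γ.1 0 1) (γ.1 1 0 + γ.1 1 1)
     - formEval Q (γ.1 0 0) (γ.1 1 0) - formEval Q (γ.1 0 1) (γ.1 1 1),
   formEval Q (γ.1 0 1) (γ.1 1 1))

/-- A form is positive definite iff its leading coefficient is positive and its
discriminant is negative. -/
def IsPosDef (Q : ℤ × ℤ × ℤ) : Prop := 0 < Q.1 ∧ formDisc Q < 0

/-- `SL₂(ℤ)`-equivalence classes of positive definite integral binary quadratic forms
of discriminant `-N`. -/
abbrev FormClasses (N : ℤ) :=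
  Quot (fun (Q Q' : {Q : ℤ × ℤ × ℤ // formDisc Q = -N ∧ IsPosDef Q}) =>
    ∃ γ : Matrix.SpecialLinearGroup (Fin 2) ℤ, formAct γ Q.1 = Q'.1)

/-- The Hurwitz class number `H(N)`: each class of positive definite forms of
discriminant `-N` is counted with weight `1/ω_Q = 2/#Γ_Q`, where `Γ_Q` is the stabilizer
of (a representative of) the class in `SL₂(ℤ)`; `H(0) = -1/12`, and `H(N) = 0` when no
such forms exist (in particular for `N < 0` and `N ≡ 1, 2 (mod 4)`). -/
noncomputable def hurwitzClassNumber (N : ℤ) : ℝ :=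
  if N = 0 then -(1 / 12)
  else ∑ᶠ c : FormClasses N,
    (2 : ℝ) / (Nat.card {γ : Matrix.SpecialLinearGroup (Fin 2) ℤ //
      formAct γ c.out.1 = c.out.1})

/-- `H_{κ,m,M}(n) = ∑_{t ≡ m (mod M)} t^κ H(4n - t²)`. -/
noncomputable def HH (κ : ℕ) (m : ℤ) (M : ℕ) (n : ℕ) : ℝ :=
  ∑ᶠ t : ℤ, if t % (M : ℤ) = m % (M : ℤ) then
    (t : ℝ) ^ κ * hurwitzClassNumber (4 * n - t ^ 2) else 0

/-- `a(n)`: the `n`-th Fourier coefficient of `η(3τ)⁸ = q ∏_{k≥1} (1-q^{3k})⁸`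
(the factors with `k > n` do not affect the coefficient of `q^n`). -/
noncomputable def etaCoeff (n : ℕ) : ℤ :=
  Polynomial.coeff (Polynomial.X * ∏ k ∈ Finset.Icc 1 n, (1 - Polynomial.X ^ (3 * k)) ^ 8 : Polynomial ℤ) n


section
open Finset

abbrev V4 := ℤ × ℤ × ℤ × ℤ
def muInv (q : V4) : V4 := (q.1, q.2.1 - q.1, q.2.2.1, q.2.2.1 + q.2.2.2)
def cbB (c0 dc a0 dbc db ca bcd b0 ac : Bool) : ℕ :=
  bif c0 || dc || (a0 && !dbc) then 0
  else bif db then (bif ca then 6 else 5)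
  else bif dbc then (bif ca then 4 else bif a0 && !bcd then 8 else 2)
  else (bif ca then (bif b0 && !ac then 9 else 3) else bif b0 then 7 else 1)
def cb (q : V4) : ℕ :=
  cbB (decide (q.2.2.1 ≤ 0)) (decide (q.2.2.2 ≤ q.2.2.1)) (decide (q.1 ≤ 0))
    (decide (q.2.2.2 ≤ q.2.1 + q.2.2.1)) (decide (q.2.2.2 ≤ q.2.1)) (decide (q.2.2.1 ≤ q.1))
    (decide (q.2.1 + q.2.2.1 ≤ q.2.2.2)) (decide (q.2.1 ≤ 0)) (decide (q.1 ≤ q.2.2.1))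
def cb2 (q : V4) : ℕ :=
  bif decide (q.1 ≤ q.2.1) then
  cbB (decide (q.2.2.1 ≤ 0)) (decide (q.2.2.2 ≤ 0)) (decide (q.1 ≤ 0))
    (decide (q.1 + q.2.2.2 ≤ q.2.1)) (decide (q.1 + q.2.2.2 + q.2.2.1 ≤ q.2.1)) (decide (q.2.2.1 ≤ q.1))
    (decide (q.2.1 ≤ q.1 + q.2.2.2)) (decide (q.2.1 ≤ q.1)) (decide (q.1 ≤ q.2.2.1)) else 0
def fbB (a0 b0 c0 d0 db dc dabc : Bool) : ℕ :=
  bif a0 || b0 || c0 || d0 then 0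
  else bif db then (bif dc then 1 else 0)
  else bif dc then 0
  else bif dabc then 3 else 2
def fb (q : V4) : ℕ :=
  fbB (decide (q.1 ≤ 0)) (decide (q.2.1 ≤ 0)) (decide (q.2.2.1 ≤ 0)) (decide (q.2.2.2 ≤ 0))
    (decide (q.2.2.2 ≤ q.2.1)) (decide (q.2.2.2 ≤ q.2.2.1)) (decide (q.2.1 + q.2.2.1 + q.1 ≤ q.2.2.2))
def ibB (b0 c0 bd cd bcd : Bool) : ℕ := bif b0 || c0 || !bd || !cd || bcd then 0 else 1
def ib (q : V4) : ℕ :=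
  ibB (decide (q.2.1 ≤ 0)) (decide (q.2.2.1 ≤ 0)) (decide (q.2.1 ≤ q.2.2.2))
    (decide (q.2.2.1 ≤ q.2.2.2)) (decide (q.2.1 + q.2.2.1 ≤ q.2.2.2))
def hbB (a0 b0 c0 d0 dbc bd db cd dc bcd : Bool) : ℕ :=
  bif !a0 || b0 || c0 || d0 || !dbc then 0
  else bif !bd then (bif !cd then 1 else bif dc then 0 else 4)
  else bif db then (bif !cd then 0 else bif dc then 2 else 3)
  else bif !cd then 4 else bif dc then 3
  else bif bcd then 6 else 5
def hb (q : V4) : ℕ :=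
  hbB (decide (q.1 ≤ 0)) (decide (q.2.1 ≤ 0)) (decide (q.2.2.1 ≤ 0)) (decide (q.2.2.2 ≤ 0))
    (decide (q.2.2.2 ≤ q.2.1 + q.2.2.1)) (decide (q.2.1 ≤ q.2.2.2)) (decide (q.2.2.2 ≤ q.2.1))
    (decide (q.2.2.1 ≤ q.2.2.2)) (decide (q.2.2.2 ≤ q.2.2.1)) (decide (q.2.1 + q.2.2.1 ≤ q.2.2.2))
def syms : List (V4 → V4) :=
  [fun q => (q.1, q.2.1, q.2.2.1, q.2.2.2), fun q => (q.1, q.2.2.1, q.2.1, q.2.2.2),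
   fun q => (q.2.2.2, q.2.1, q.2.2.1, q.1), fun q => (q.2.2.2, q.2.2.1, q.2.1, q.1),
   fun q => (q.2.1, q.1, q.2.2.2, q.2.2.1), fun q => (q.2.2.1, q.1, q.2.2.2, q.2.1),
   fun q => (q.2.1, q.2.2.2, q.1, q.2.2.1), fun q => (q.2.2.1, q.2.2.2, q.1, q.2.1)]
def bits1 (q : V4) : List ℕ := [cb q, cb2 q, fb q, ib q, hb q]
def bits (q : V4) : List (List ℕ) := syms.map fun s => bits1 (s q)


def t1 : ℕ → List (ℕ × ℤ)
  | 1 => [(0, -10), (1, 2), (2, 4), (3, -10), (5, -12)]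
  | 2 => [(0, -10), (1, -2), (3, -6), (5, -2), (6, -2), (7, 10), (8, -12), (9, 2)]
  | 3 => [(0, -4), (1, -8), (3, -6), (4, -2), (5, 2), (6, -2), (7, 2), (8, -4), (9, 2)]
  | 4 => [(0, -4), (2, 8), (3, -14), (4, -2), (6, -4), (8, -4), (9, 4)]
  | 5 => [(0, -12), (1, -2), (2, -2), (3, -2), (4, 2), (5, -2), (6, 2), (7, 10), (8, -10), (9, 2)]
  | 6 => [(0, -6), (2, 6), (3, -10), (8, -2), (9, 4)]
  | 7 => [(0, -8), (2, 4), (3, -10)]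
  | 8 => [(4, 2), (5, -2), (6, 2), (7, 10), (8, -10), (9, 2)]
  | 9 => [(7, 2), (8, -4), (9, 2)]
  | _ => []

def t3c1 : List (ℕ × ℕ × List (ℕ × ℤ)) :=
  [(13, 26, [(1, 6), (3, -6)]),
   (14, 25, [(2, 12), (3, -6)]),
   (31, 62, [(2, -6), (3, 6), (4, -4), (5, -8), (6, 8), (7, 2), (8, 2), (9, -4)]),
   (34, 59, [(0, -8), (2, 10), (3, -4), (5, 16), (7, -2), (8, -2), (9, 4)]),
   (37, 74, [(1, 6), (3, -6), (4, -2), (5, -18), (6, -2), (7, -2), (8, -2), (9, 4)]),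
   (39, 78, [(0, -8), (2, 8), (3, -14), (6, -6), (8, 6)]),
   (44, 76, [(1, 2), (3, -12), (5, -4), (6, 6), (7, 6), (8, -6)]),
   (46, 65, [(7, 4)]),
   (50, 70, [(0, 4), (2, 10), (4, -4), (5, 10)])]

def t3c2 : List (ℕ × ℕ × List (ℕ × ℤ)) :=
  [(12, 24, [(0, -4), (3, -2)]),
   (13, 26, [(1, 6), (3, -6)]),
   (14, 25, [(4, -4), (5, 4), (6, 2), (7, 8), (8, -10), (9, 2)]),
   (34, 59, [(0, 4), (2, -8), (4, -4)]),
   (37, 74, [(5, -20)]),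
   (39, 78, [(6, -8), (8, 8)]),
   (44, 76, [(0, -2), (2, -2), (3, -2), (9, -2)]),
   (46, 65, [(0, -4), (1, -6), (3, 2), (4, -2), (6, 2), (7, 4)]),
   (50, 70, [(1, -4), (4, -4)])]

def t3c3 : List (ℕ × ℕ × List (ℕ × ℤ)) :=
  [(13, 26, [(0, -4)]),
   (14, 25, [(2, 6)]),
   (31, 62, [(2, -6), (3, 6), (4, -4), (5, -8), (6, 8), (7, 2), (8, 2), (9, -4)]),
   (34, 59, [(4, -6), (5, 14), (6, -6)]),
   (37, 74, [(2, -6), (5, -12)]),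
   (39, 78, [(3, -18), (6, -6), (8, 10)]),
   (44, 76, [(1, -4), (3, -18), (4, -4), (5, 6), (7, 8)]),
   (46, 65, [(0, -2), (1, -4), (4, -2)]),
   (50, 70, [(2, 6), (3, 6), (4, 4), (5, 14), (6, 6), (7, 4)]),
   (51, 66, [(3, -2), (8, 14)])]

def t3c4 : List (ℕ × ℕ × List (ℕ × ℤ)) :=
  [(12, 24, [(3, -2), (9, 2)]),
   (13, 26, [(0, -4)]),
   (14, 25, [(1, 6)]),
   (34, 59, [(0, 4), (2, -8), (4, -4)]),
   (37, 74, [(5, -18)]),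
   (39, 78, [(3, -8), (6, -8), (8, 16)]),
   (44, 76, [(0, -2), (2, -4), (8, -6), (9, 4)]),
   (46, 65, [(0, -4), (1, -6), (3, 2), (4, -2), (6, 2), (7, 4)]),
   (50, 70, [(3, 6), (4, 4), (6, 6), (7, -4)]),
   (51, 66, [(3, -2), (8, 14)])]

def t3c5 : List (ℕ × ℕ × List (ℕ × ℤ)) :=
  [(12, 24, [(0, -6)]),
   (13, 26, [(1, 6), (3, -6)]),
   (14, 25, [(4, -4), (5, 4), (6, 2), (7, 8), (8, -10), (9, 2)]),
   (34, 59, [(7, 12)]),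
   (37, 74, [(5, -20)]),
   (39, 78, [(3, 8)]),
   (44, 76, [(0, -2), (3, -4), (7, 4), (8, -6)]),
   (46, 65, [(5, 6), (8, 6)]),
   (50, 70, [(1, -4), (4, -4)])]

def t3c6 : List (ℕ × ℕ × List (ℕ × ℤ)) :=
  [(12, 24, [(0, -2), (9, 2)]),
   (13, 26, [(0, -4)]),
   (14, 25, [(1, 6)]),
   (34, 59, [(7, 12)]),
   (37, 74, [(5, -18)]),
   (39, 78, [(8, 8)]),
   (44, 76, [(0, -2), (2, -2), (3, -2), (7, 4), (8, -12), (9, 6)]),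
   (46, 65, [(5, 6), (8, 6)]),
   (50, 70, [(3, 6), (4, 4), (6, 6), (7, -4)]),
   (51, 66, [(3, -2), (8, 14)])]

def lk (r : ℕ) : List (ℕ × ℕ × List (ℕ × ℤ)) → List (ℕ × ℤ)
  | [] => []
  | x :: l => bif Nat.beq r x.1 then x.2.2 else bif Nat.beq r x.2.1 then x.2.2 else lk r l

def t3 (c r : ℕ) : List (ℕ × ℤ) :=
  match c with
  | 1 | 7 => lk r t3c1
  | 2 | 8 => lk r t3c2
  | 3 | 9 => lk r t3c3
  | 4 => lk r t3c4
  | 5 => lk r t3c5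
  | 6 => lk r t3c6
  | _ => []

notation "U1" => ((1, 0, 0, 0) : V4)
notation "U2" => ((0, 1, 0, 0) : V4)
notation "U3" => ((0, 0, 1, 0) : V4)
notation "U4" => ((0, 0, 0, 1) : V4)

def cellData : List (V4 × V4 × V4 × V4 × V4) :=
  [((0, 1, 1, 0), (0, 0, 0, 0), U2, U3, U4),
   ((0, 1, 1, 1), (0, 0, 0, 0), U2, U2, U2),
   ((0, 1, 1, 2), (0, 0, 0, 0), U2, U3, (0, 1, 1, 0)),
   ((0, 1, 2, 1), (0, 0, 0, 0), U2, U3, U2),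
   ((0, 1, 2, 2), (0, 0, 0, 0), U2, U3, U3),
   ((0, 1, 3, 2), (0, 0, 0, 0), U2, U3, U4),
   ((0, 2, 2, 1), (0, 0, 0, 0), U2, U3, U4),
   ((0, 2, 2, 3), (0, 0, 0, 0), U2, U3, U4),
   ((0, 2, 3, 1), (0, 0, 0, 0), U2, U3, U4),
   ((0, 2, 3, 2), (0, 0, 0, 0), U2, U3, U2),
   ((0, 2, 4, 3), (0, 0, 0, 0), U2, U3, U4),
   ((1, 1, 1, 1), U1, U1, U1, U1),
   ((1, 1, 1, 2), U1, U1, U1, (2, 0, 0, 0)),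
   ((1, 1, 1, 3), U1, U1, U1, U4),
   ((1, 1, 2, 1), U1, U1, (2, 0, 0, 0), U1),
   ((1, 1, 2, 2), U1, U1, U3, U3),
   ((1, 1, 2, 3), U1, U1, U3, (1, 0, 1, 0)),
   ((1, 1, 2, 4), U1, U1, U3, U4),
   ((1, 1, 3, 1), U1, U1, U3, U1),
   ((1, 1, 3, 2), U1, U1, U3, (-1, 0, 1, 0)),
   ((1, 1, 4, 2), U1, U1, U3, U4),
   ((1, 2, 2, 1), U1, U2, U2, (-1, 1, 0, 0)),
   ((1, 2, 2, 2), U1, U2, U2, U2),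
   ((1, 2, 2, 3), U1, U2, U3, U4),
   ((1, 2, 2, 4), U1, U2, U3, (0, 1, 1, 0)),
   ((1, 2, 2, 5), U1, U2, U3, U4),
   ((1, 2, 3, 1), U1, U2, U3, (-1, 1, 0, 0)),
   ((1, 2, 3, 2), U1, U2, (1, 1, 0, 0), U2),
   ((1, 2, 3, 3), U1, U2, U3, U3),
   ((1, 2, 4, 1), U1, U2, U3, (-1, 1, 0, 0)),
   ((1, 2, 4, 2), U1, U2, U3, U2),
   ((1, 2, 4, 3), U1, U2, U3, (-1, 0, 1, 0)),
   ((1, 2, 5, 2), U1, U2, U3, U2),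
   ((1, 2, 5, 3), U1, U2, U3, U4),
   ((1, 2, 6, 3), U1, U2, U3, U4),
   ((1, 3, 3, 1), U1, U2, U3, U4),
   ((1, 3, 5, 1), U1, U2, U3, U4),
   ((2, 2, 2, 3), U1, U1, U1, U4),
   ((2, 2, 2, 5), U1, U1, U1, U4),
   ((2, 2, 3, 2), U1, U1, U3, U1),
   ((2, 2, 3, 4), U1, U1, U3, U4),
   ((2, 2, 3, 6), U1, U1, U3, U4),
   ((2, 2, 4, 3), U1, U1, U3, U4),
   ((2, 2, 5, 2), U1, U1, U3, U1),
   ((2, 2, 6, 3), U1, U1, U3, U4),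
   ((2, 3, 3, 2), U1, U2, U3, U4),
   ((2, 3, 3, 7), U1, U2, U3, U4),
   ((2, 3, 4, 2), U1, U2, U3, (-1, 0, 1, 0)),
   ((2, 3, 4, 3), U1, U2, U3, U2),
   ((2, 3, 5, 2), U1, U2, U3, U4),
   ((2, 3, 5, 4), U1, U2, U3, U4),
   ((2, 3, 7, 2), U1, U2, U3, U4)]

def mono (k : ℕ) (q : V4) : ℤ :=
  match k with
  | 0 => q.1 * q.1
  | 1 => q.1 * q.2.1
  | 2 => q.1 * q.2.2.1
  | 3 => q.1 * q.2.2.2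
  | 4 => q.2.1 * q.2.1
  | 5 => q.2.1 * q.2.2.1
  | 6 => q.2.1 * q.2.2.2
  | 7 => q.2.2.1 * q.2.2.1
  | 8 => q.2.2.1 * q.2.2.2
  | _ => q.2.2.2 * q.2.2.2

def ev (l : List (ℕ × ℤ)) (q : V4) : ℤ := (l.map fun p => p.2 * mono p.1 q).sum

def rc (q : V4) : ℕ :=
  (27 * (q.1 % 3) + 9 * (q.2.1 % 3) + 3 * (q.2.2.1 % 3) + q.2.2.2 % 3).toNat

def ps (x : ℤ) : ℤ := if x % 3 = 1 then 1 else if x % 3 = 2 then -1 else 0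

def cf : ℕ → ℤ
  | 1 => 3
  | 2 => -1
  | 3 => -3
  | _ => 0

def hv (k : ℕ) (q : V4) : ℤ :=
  match k with
  | 1 => q.2.1 * q.2.1 + q.2.2.1 * q.2.2.1
  | 2 => -10 * (q.2.1 * q.2.2.1)
  | 3 => -3 * (q.2.1 * q.2.1 + q.2.2.1 * q.2.2.1)
  | 4 => 6 * (q.2.1 * q.2.2.1)
  | 5 => -4 * (q.2.1 * q.2.1) + -4 * (q.2.2.1 * q.2.2.1) + 6 * (q.2.1 * q.2.2.1)
  | 6 => 12 * (q.2.1 * q.2.2.1)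
  | _ => 0

def s1 (q : V4) : ℤ := (q.1 + q.2.2.2) * (q.1 + q.2.2.2)
def s2 (q : V4) : ℤ := (q.2.1 + q.2.2.1 - q.2.2.2) * (q.2.1 + q.2.2.1 - q.2.2.2)

def tm1 (B : List ℕ) (_ρ q : V4) : ℤ :=
  match B with
  | [x0, x1, x2, x3, x4] => ev (t1 x0) q - ev (t1 x1) (muInv q) - cf x2 * s1 q
      - 2 * x3 * s2 q + hv x4 q
  | _ => 0

def tm3 (B : List ℕ) (ρ q : V4) : ℤ :=
  match B with
  | [x0, x1, x2, x3, _] => ev (t3 x0 (rc ρ)) q - ev (t3 x1 (rc (muInv ρ))) (muInv q)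
      - (if (ρ.1 + ρ.2.2.2) % 3 = 0 then cf x2 else 0) * s1 q
      - (if (ρ.2.1 + ρ.2.2.1 - ρ.2.2.2) % 3 = 0 then 2 * x3 else 0) * s2 q
      + (if ρ.1 % 3 = 0 then 18 * ps ρ.2.2.2 * ps ρ.2.2.1 else 0) * (q.1 * q.2.2.2)
  | _ => 0

def TT (τ : List ℕ → V4 → V4 → ℤ) (q0 ρ q : V4) : ℤ :=
  (syms.map fun s => τ (bits1 (s q0)) (s ρ) (s q)).sum

def dot (u v : V4) : ℤ := u.1 * v.1 + u.2.1 * v.2.1 + u.2.2.1 * v.2.2.1 + u.2.2.2 * v.2.2.2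

def app (m : V4 × V4 × V4 × V4) (q : V4) : V4 :=
  (dot m.1 q, dot m.2.1 q, dot m.2.2.1 q, dot m.2.2.2 q)

def red (q : V4) : V4 := (q.1 % 3, q.2.1 % 3, q.2.2.1 % 3, q.2.2.2 % 3)

def MM : ℤ := 1048576
def kron : V4 := (1, 1048576, 1152921504606846976, 1393796574908163946345982392040522594123776)

def rho : List V4 :=
  [0, 1, 2].flatMap fun a => [0, 1, 2].flatMap fun b => [0, 1, 2].flatMap fun c =>
    ([0, 1, 2].map fun d => ((a, b, c, d) : V4)).filter
      fun q => (q.1 * q.2.2.2 + q.2.1 * q.2.2.1) % 3 = 1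

def chk1 : Bool := cellData.all fun x => TT tm1 x.1 x.1 (app x.2 kron) = 0

def chk3 : Bool := cellData.all fun x => rho.all fun ρ =>
  decide (red (app x.2 ρ) ≠ ρ) || TT tm3 x.1 ρ (app x.2 kron) = 0

theorem chk1_ok : chk1 = true := by decide +kernel
theorem chk3_ok : chk3 = true := by decide +kernel

def sm (v : V4) : Bool := |v.1| ≤ 2 && |v.2.1| ≤ 2 && |v.2.2.1| ≤ 2 && |v.2.2.2| ≤ 2
theorem chkm_ok : (cellData.all fun x => sm x.2.1 && sm x.2.2.1 && sm x.2.2.2.1 && sm x.2.2.2.2) = true := by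
  decide +kernel
def smt (l : List (ℕ × ℤ)) : Bool := l.length ≤ 10 && l.all fun x => |x.2| ≤ 20
theorem chkt1_ok : ∀ k : Fin 10, smt (t1 k) = true := by decide +kernel
theorem chkt3_ok : ∀ l ∈ [t3c1, t3c2, t3c3, t3c4, t3c5, t3c6], ∀ x ∈ l, smt x.2.2 = true := by
  decide +kernel

def LB (K : ℤ) (l : V4 → ℤ) : Prop := ∃ x y z w : ℤ, |x| ≤ K ∧ |y| ≤ K ∧ |z| ≤ K ∧ |w| ≤ K ∧
  ∀ a b c d, l (a, b, c, d) = x * a + y * b + z * c + w * d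

def QB (K : ℤ) (φ : V4 → ℤ) : Prop := ∃ c : Fin 10 → ℤ, (∀ i, |c i| ≤ K) ∧
  ∀ a b c' d, φ (a, b, c', d) = c 0 * (a * a) + c 1 * (a * b) + c 2 * (a * c') + c 3 * (a * d)
    + c 4 * (b * b) + c 5 * (b * c') + c 6 * (b * d) + c 7 * (c' * c') + c 8 * (c' * d) + c 9 * (d * d)

theorem QB.nonneg {K φ} (h : QB K φ) : 0 ≤ K := by
  obtain ⟨c, hc, _⟩ := h
  exact (abs_nonneg _).trans (hc 0)

theorem QB.mono {K L φ} (h : QB K φ) (hL : K ≤ L) : QB L φ := by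
  obtain ⟨c, hc, h⟩ := h
  exact ⟨c, fun i => (hc i).trans hL, h⟩

theorem QB.zero : QB 0 (fun _ => 0) := ⟨fun _ => 0, by simp, by simp⟩

theorem QB.add {K L φ ψ} (h : QB K φ) (h' : QB L ψ) : QB (K + L) (fun q => φ q + ψ q) := by
  obtain ⟨c, hc, h⟩ := h
  obtain ⟨e, he, h'⟩ := h'
  refine ⟨fun i => c i + e i, fun i => (abs_add_le _ _).trans (add_le_add (hc i) (he i)), ?_⟩
  intro a b c' d
  simp only [h, h']; ring

theorem QB.smul {K φ} (h : QB K φ) (x X : ℤ) (hx : |x| ≤ X) : QB (X * K) (fun q => x * φ q) := by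
  have h0 := h.nonneg
  obtain ⟨c, hc, h⟩ := h
  refine ⟨fun i => x * c i, fun i => ?_, ?_⟩
  · rw [abs_mul]
    exact mul_le_mul hx (hc i) (abs_nonneg _) ((abs_nonneg _).trans hx)
  intro a b c' d
  simp only [h]; ring

theorem QB.sub {K L φ ψ} (h : QB K φ) (h' : QB L ψ) : QB (K + L) (fun q => φ q - ψ q) := by
  have := h.add (h'.smul (-1) 1 (by simp))
  rw [one_mul] at this
  simpa [sub_eq_add_neg] using this

theorem LB.add {K L l m} (h : LB K l) (h' : LB L m) : LB (K + L) (fun q => l q + m q) := by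
  obtain ⟨x, y, z, w, hx, hy, hz, hw, h⟩ := h
  obtain ⟨x', y', z', w', hx', hy', hz', hw', h'⟩ := h'
  refine ⟨x + x', y + y', z + z', w + w', (abs_add_le _ _).trans (add_le_add hx hx'), (abs_add_le _ _).trans (add_le_add hy hy'), (abs_add_le _ _).trans (add_le_add hz hz'), (abs_add_le _ _).trans (add_le_add hw hw'), ?_⟩
  intro a b c d
  simp only [h, h']; ring

theorem LB.neg {K l} (h : LB K l) : LB K (fun q => - l q) := by
  obtain ⟨x, y, z, w, hx, hy, hz, hw, h⟩ := h
  refine ⟨-x, -y, -z, -w, by simpa, by simpa, by simpa, by simpa, ?_⟩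
  intro a b c d
  simp only [h]; ring

theorem LB.sub {K L l m} (h : LB K l) (h' : LB L m) : LB (K + L) (fun q => l q - m q) := by
  simpa [sub_eq_add_neg] using h.add h'.neg

theorem LB.mono {K L l} (h : LB K l) (hL : K ≤ L) : LB L l := by
  obtain ⟨x, y, z, w, hx, hy, hz, hw, h⟩ := h
  exact ⟨x, y, z, w, hx.trans hL, hy.trans hL, hz.trans hL, hw.trans hL, h⟩

theorem LB.mul {K L l m} (h : LB K l) (h' : LB L m) : QB (2 * (K * L)) (fun q => l q * m q) := by
  obtain ⟨x, y, z, w, hx, hy, hz, hw, h⟩ := h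
  obtain ⟨x', y', z', w', hx', hy', hz', hw', h'⟩ := h'
  have key : ∀ s t : ℤ, |s| ≤ K → |t| ≤ L → |s * t| ≤ K * L := fun s t hs ht => by
    rw [abs_mul]; exact mul_le_mul hs ht (abs_nonneg _) ((abs_nonneg _).trans hs)
  have key1 : ∀ s t : ℤ, |s| ≤ K → |t| ≤ L → |s * t| ≤ 2 * (K * L) := fun s t hs ht => by
    have := key s t hs ht
    have := abs_nonneg (s * t); linarith
  have key2 : ∀ s t s' t' : ℤ, |s| ≤ K → |t| ≤ L → |s'| ≤ K → |t'| ≤ L →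
      |s * t + s' * t'| ≤ 2 * (K * L) := fun s t s' t' hs ht hs' ht' => by
    have := key s t hs ht
    have := key s' t' hs' ht'
    have := abs_add_le (s * t) (s' * t'); linarith
  refine ⟨![x * x', x * y' + y * x', x * z' + z * x', x * w' + w * x', y * y', y * z' + z * y',
    y * w' + w * y', z * z', z * w' + w * z', w * w'], ?_, ?_⟩
  · intro i
    fin_cases i
    · exact key1 _ _ hx hx'
    · exact key2 _ _ _ _ hx hy' hy hx'
    · exact key2 _ _ _ _ hx hz' hz hx'
    · exact key2 _ _ _ _ hx hw' hw hx'
    · exact key1 _ _ hy hy'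
    · exact key2 _ _ _ _ hy hz' hz hy'
    · exact key2 _ _ _ _ hy hw' hw hy'
    · exact key1 _ _ hz hz'
    · exact key2 _ _ _ _ hz hw' hw hz'
    · exact key1 _ _ hw hw'
  · intro a b c d
    simp only [h, h']
    simp [Fin.isValue, Matrix.cons_val]
    ring

theorem QB.listSum {ι : Type*} (K : ℤ) (f : ι → V4 → ℤ) (l : List ι)
    (h : ∀ i ∈ l, QB K (f i)) : QB (l.length * K) (fun q => (l.map fun i => f i q).sum) := by
  induction l with
  | nil => simpa using QB.zero
  | cons i l ih =>
    have := (h i (by simp)).add (ih fun j hj => h j (by simp [hj]))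
    simp only [List.map_cons, List.sum_cons]
    refine this.mono ?_
    simp; linarith

def LBV (K : ℤ) (s : V4 → V4) : Prop := LB K (fun q => (s q).1) ∧ LB K (fun q => (s q).2.1) ∧
  LB K (fun q => (s q).2.2.1) ∧ LB K (fun q => (s q).2.2.2)

theorem LBV.mono' {K s} (h : LBV K s) (k : ℕ) : QB (2 * (K * K)) (fun q => mono k (s q)) := by
  obtain ⟨h1, h2, h3, h4⟩ := h
  unfold mono
  split
  · exact h1.mul h1
  · exact h1.mul h2
  · exact h1.mul h3
  · exact h1.mul h4
  · exact h2.mul h2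
  · exact h2.mul h3
  · exact h2.mul h4
  · exact h3.mul h3
  · exact h3.mul h4
  · exact h4.mul h4

theorem LBV.ev {K s} (h : LBV K s) (l : List (ℕ × ℤ)) (hl : smt l = true) :
    QB (10 * (20 * (2 * (K * K)))) (fun q => ev l (s q)) := by
  simp only [smt, Bool.and_eq_true, decide_eq_true_eq, List.all_eq_true] at hl
  have := QB.listSum (20 * (2 * (K * K))) (fun (p : ℕ × ℤ) q => p.2 * HurwitzPaper.mono p.1 (s q)) l
    (fun p hp => (h.mono' p.1).smul _ _ (hl.2 p hp))
  refine this.mono ?_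
  have : (l.length : ℤ) ≤ 10 := by exact_mod_cast hl.1
  have := mul_self_nonneg K
  exact mul_le_mul_of_nonneg_right ‹_› (by linarith)

theorem step0 {K x y : ℤ} (hK : 2 * K < MM) (hx : |x| ≤ K) (h : x + MM * y = 0) : x = 0 ∧ y = 0 := by
  have hx0 : x = 0 := by
    apply Int.eq_zero_of_abs_lt_dvd (m := MM) ⟨-y, by linarith⟩
    have := abs_nonneg x; linarith
  subst hx0
  refine ⟨rfl, ?_⟩
  unfold MM at h; omega

theorem QB.eq_zero {K φ} (h : QB K φ) (hK : 2 * K < MM) (h0 : φ kron = 0) (q : V4) : φ q = 0 := by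
  have hK0 := h.nonneg
  obtain ⟨c, hc, h⟩ := h
  have e : φ kron = c 0 + MM * (c 1 + MM * (c 4 + MM * (c 2 + MM * (c 5 + MM * (0 + MM * (c 7 + MM *
     (c 3 + MM * (c 6 + MM * (0 + MM * (c 8 + MM * (0 + MM * (0 + MM * (0 + MM * c 9))))))))))))) := by
    unfold kron MM; rw [h]; ring
  rw [h0] at e
  have z : |(0 : ℤ)| ≤ K := by simpa using hK0
  obtain ⟨e0, e⟩ := step0 hK (hc _) e.symm
  obtain ⟨e1, e⟩ := step0 hK (hc _) e
  obtain ⟨e2, e⟩ := step0 hK (hc _) e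
  obtain ⟨e3, e⟩ := step0 hK (hc _) e
  obtain ⟨e4, e⟩ := step0 hK (hc _) e
  obtain ⟨-, e⟩ := step0 hK z e
  obtain ⟨e5, e⟩ := step0 hK (hc _) e
  obtain ⟨e6, e⟩ := step0 hK (hc _) e
  obtain ⟨e7, e⟩ := step0 hK (hc _) e
  obtain ⟨-, e⟩ := step0 hK z e
  obtain ⟨e8, e⟩ := step0 hK (hc _) e
  obtain ⟨-, e⟩ := step0 hK z e
  obtain ⟨-, e⟩ := step0 hK z e
  obtain ⟨-, e⟩ := step0 hK z e
  obtain ⟨a, b, c', d⟩ := q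
  rw [h, e0, e1, e2, e3, e4, e5, e6, e7, e8, e]; ring

theorem LB.dot (m : V4) (hm : sm m = true) : LB 2 (fun q => dot m q) := by
  simp only [sm, Bool.and_eq_true, decide_eq_true_eq] at hm
  exact ⟨m.1, m.2.1, m.2.2.1, m.2.2.2, hm.1.1.1, hm.1.1.2, hm.1.2, hm.2, fun a b c d => rfl⟩

theorem cellLB {x} (hx : x ∈ cellData) (s : V4 → V4) (hs : s ∈ syms) :
    LBV 2 (fun q => s (app x.2 q)) := by
  have := chkm_ok
  simp only [List.all_eq_true, Bool.and_eq_true] at this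
  obtain ⟨⟨⟨h1, h2⟩, h3⟩, h4⟩ := this x hx
  have g1 := LB.dot _ h1
  have g2 := LB.dot _ h2
  have g3 := LB.dot _ h3
  have g4 := LB.dot _ h4
  simp only [syms, List.mem_cons, List.not_mem_nil, or_false] at hs
  rcases hs with rfl | rfl | rfl | rfl | rfl | rfl | rfl | rfl <;>
    exact ⟨by assumption, by assumption, by assumption, by assumption⟩

theorem muLB {s} (h : LBV 2 s) : LBV 4 (fun q => muInv (s q)) := by
  obtain ⟨h1, h2, h3, h4⟩ := h
  exact ⟨h1.mono (by norm_num), h2.sub h1, h3.mono (by norm_num), h3.add h4⟩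

theorem smt_t1 (k : ℕ) : smt (t1 k) = true := by
  by_cases h : k < 10
  · exact chkt1_ok ⟨k, h⟩
  · have : t1 k = [] := by
      unfold t1; split <;> first | omega | rfl
    rw [this]; decide

theorem smt_lk (r : ℕ) (l : List (ℕ × ℕ × List (ℕ × ℤ))) (h : ∀ x ∈ l, smt x.2.2 = true) :
    smt (lk r l) = true := by
  induction l with
  | nil => rfl
  | cons x l ih =>
    have h1 := h x (by simp)
    have h2 := ih fun y hy => h y (by simp [hy])
    unfold lk
    rcases Nat.beq r x.1 <;> rcases Nat.beq r x.2.1 <;> assumption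

theorem smt_t3 (k r : ℕ) : smt (t3 k r) = true := by
  have := chkt3_ok
  unfold t3
  split <;> first | exact smt_lk _ _ (this _ (by simp)) | decide

theorem cf_le (k : ℕ) : |cf k| ≤ 3 := by
  unfold cf; split <;> decide

theorem ib_le (q : V4) : |(ib q : ℤ)| ≤ 1 := by
  unfold ib ibB; cases (_ || _ || _ || _ || _ : Bool) <;> decide

theorem QBs1 {s} (h : LBV 2 s) : QB 72 (fun q => s1 (s q)) := by
  obtain ⟨h1, h2, h3, h4⟩ := h
  exact ((h1.add h4).mul (h1.add h4)).mono (by norm_num)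

theorem QBs2 {s} (h : LBV 2 s) : QB 72 (fun q => s2 (s q)) := by
  obtain ⟨h1, h2, h3, h4⟩ := h
  exact (((h2.add h3).sub h4).mul ((h2.add h3).sub h4)).mono (by norm_num)

theorem QBhv {s} (h : LBV 2 s) (k : ℕ) : QB 1000 (fun q => hv k (s q)) := by
  obtain ⟨h1, h2, h3, h4⟩ := h
  have a1 := h2.mul h2
  have a2 := h3.mul h3
  have a3 := h2.mul h3
  unfold hv
  split
  · exact (a1.add a2).mono (by norm_num)
  · exact (a3.smul (-10) 10 (by norm_num)).mono (by norm_num)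
  · exact ((a1.add a2).smul (-3) 3 (by norm_num)).mono (by norm_num)
  · exact (a3.smul 6 6 (by norm_num)).mono (by norm_num)
  · exact (((a1.smul (-4) 4 (by norm_num)).add (a2.smul (-4) 4 (by norm_num))).add (a3.smul 6 6 (by norm_num))).mono (by norm_num)
  · exact (a3.smul 12 12 (by norm_num)).mono (by norm_num)
  · exact QB.zero.mono (by norm_num)

theorem tm1QB {s} (h : LBV 2 s) (q0 ρ : V4) : QB 20000 (fun q => tm1 (bits1 q0) ρ (s q)) := by
  have h4 := muLB h
  refine QB.mono (((((h.ev _ (smt_t1 _)).sub (h4.ev _ (smt_t1 _))).sub ((QBs1 h).smul _ 3 (cf_le _))).sub ((QBs2 h).smul _ 2 ?_)).add (QBhv h _)) (by norm_num)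
  have := ib_le q0
  rw [abs_mul, abs_two]; linarith

theorem tm3QB {s} (h : LBV 2 s) (q0 ρ : V4) : QB 20000 (fun q => tm3 (bits1 q0) ρ (s q)) := by
  have h4 := muLB h
  refine QB.mono (((((h.ev _ (smt_t3 _ _)).sub (h4.ev _ (smt_t3 _ _))).sub ((QBs1 h).smul _ 3 ?_)).sub ((QBs2 h).smul _ 2 ?_)).add ((h.1.mul h.2.2.2).smul _ 18 ?_)) (by norm_num)
  · split
    · exact cf_le _
    · norm_num
  · have := ib_le q0
    split
    · push_cast; rw [abs_mul, abs_two]; linarith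
    · norm_num
  · unfold ps
    split_ifs <;> norm_num

theorem TTQB (τ : List ℕ → V4 → V4 → ℤ)
    (hτ : ∀ (s : V4 → V4), LBV 2 s → ∀ q0 ρ, QB 20000 (fun q => τ (bits1 q0) ρ (s q)))
    {x} (hx : x ∈ cellData) (ρ : V4) (h0 : TT τ x.1 ρ (app x.2 kron) = 0) (q : V4) :
    TT τ x.1 ρ (app x.2 q) = 0 := by
  have := QB.listSum 20000 (fun s q => τ (bits1 (s x.1)) (s ρ) (s (app x.2 q))) syms
    (fun s hs => hτ _ (cellLB hx s hs) _ _)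
  refine this.eq_zero (by simp [syms, MM]) h0 q

theorem TT1_cell {x} (hx : x ∈ cellData) (ρ q : V4) : TT tm1 x.1 ρ (app x.2 q) = 0 := by
  have := chk1_ok
  simp only [chk1, List.all_eq_true, decide_eq_true_eq] at this
  exact TTQB tm1 (fun s h => tm1QB h) hx ρ (this x hx) q

theorem TT3_cell {x} (hx : x ∈ cellData) (ρ q : V4) (hρ : ρ ∈ rho) (h : red (app x.2 ρ) = ρ) :
    TT tm3 x.1 ρ (app x.2 q) = 0 := by
  have := chk3_ok
  simp only [chk3, List.all_eq_true, decide_eq_true_eq, Bool.or_eq_true] at this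
  exact TTQB tm3 (fun s h => tm3QB h) hx ρ ((this x hx ρ hρ).resolve_left (by simpa using h)) q

def Good (q : V4) : Prop := ∃ x ∈ cellData, (∀ s ∈ syms, bits1 (s q) = bits1 (s x.1)) ∧ app x.2 q = q

theorem leaf {q : V4} (q0 : V4) (m : V4 × V4 × V4 × V4) (hm : (q0, m) ∈ cellData)
    (h : bits q = bits q0 ∧ app m q = q) : Good q :=
  ⟨(q0, m), hm, List.map_inj_left.1 h.1, h.2⟩

theorem lm (i : ℕ) {x} (h : cellData[i]? = some x) : x ∈ cellData := List.mem_of_getElem? h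

set_option maxHeartbeats 20000000 in
theorem good_fd (a b c d : ℤ) (h0 : 0 ≤ a) (h1 : a ≤ b) (h2 : b ≤ c) (h3 : a ≤ d) (h4 : 0 < b) :
    Good (a, b, c, d) := by
  refine
    (lt_trichotomy d b).elim (fun h =>
      (lt_trichotomy b (a + d)).elim (fun h =>
        (lt_trichotomy c (a + d)).elim (fun h =>
          leaf _ _ (lm 45 rfl) ?_) (fun h => h.elim (fun h =>
          leaf _ _ (lm 47 rfl) ?_) (fun h =>
          (lt_or_ge c (a + b + d)).elim (fun h =>
            leaf _ _ (lm 49 rfl) ?_) (fun h =>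
            leaf _ _ (lm 51 rfl) ?_)))) (fun h => h.elim (fun h =>
        (eq_or_lt_of_le (show b ≤ c by omega)).elim (fun h =>
          leaf _ _ (lm 21 rfl) ?_) (fun h =>
          (lt_or_ge c (a + b + d)).elim (fun h =>
            leaf _ _ (lm 26 rfl) ?_) (fun h =>
            leaf _ _ (lm 29 rfl) ?_))) (fun h =>
        (eq_or_lt_of_le (show 0 ≤ a by omega)).elim (fun h =>
          (eq_or_lt_of_le (show a ≤ d by omega)).elim (fun h =>
            leaf _ _ (lm 0 rfl) ?_) (fun h =>
            (lt_or_ge c (a + b + d)).elim (fun h =>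
              leaf _ _ (lm 6 rfl) ?_) (fun h =>
              leaf _ _ (lm 8 rfl) ?_))) (fun h =>
          (lt_or_ge c (a + b + d)).elim (fun h =>
            leaf _ _ (lm 35 rfl) ?_) (fun h =>
            leaf _ _ (lm 36 rfl) ?_))))) (fun h => h.elim (fun h =>
      (lt_trichotomy c (a + d)).elim (fun h =>
        (eq_or_lt_of_le (show a ≤ b by omega)).elim (fun h =>
          (eq_or_lt_of_le (show b ≤ c by omega)).elim (fun h =>
            leaf _ _ (lm 11 rfl) ?_) (fun h =>
            leaf _ _ (lm 39 rfl) ?_)) (fun h =>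
          (eq_or_lt_of_le (show b ≤ c by omega)).elim (fun h =>
            leaf _ _ (lm 22 rfl) ?_) (fun h =>
            leaf _ _ (lm 48 rfl) ?_))) (fun h => h.elim (fun h =>
        (eq_or_lt_of_le (show 0 ≤ a by omega)).elim (fun h =>
          leaf _ _ (lm 1 rfl) ?_) (fun h =>
          (eq_or_lt_of_le (show a ≤ b by omega)).elim (fun h =>
            leaf _ _ (lm 14 rfl) ?_) (fun h =>
            leaf _ _ (lm 27 rfl) ?_))) (fun h =>
        (eq_or_lt_of_le (show 0 ≤ a by omega)).elim (fun h =>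
          (lt_or_ge c (a + b + d)).elim (fun h =>
            leaf _ _ (lm 9 rfl) ?_) (fun h =>
            leaf _ _ (lm 3 rfl) ?_)) (fun h =>
          (eq_or_lt_of_le (show a ≤ b by omega)).elim (fun h =>
            (lt_or_ge c (a + b + d)).elim (fun h =>
              leaf _ _ (lm 43 rfl) ?_) (fun h =>
              leaf _ _ (lm 18 rfl) ?_)) (fun h =>
            (lt_or_ge c (a + b + d)).elim (fun h =>
              leaf _ _ (lm 30 rfl) ?_) (fun h =>
              leaf _ _ (lm 32 rfl) ?_)))))) (fun h =>
      (lt_trichotomy d c).elim (fun h =>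
        (lt_trichotomy c (a + d)).elim (fun h =>
          (eq_or_lt_of_le (show a ≤ b by omega)).elim (fun h =>
            leaf _ _ (lm 42 rfl) ?_) (fun h =>
            leaf _ _ (lm 50 rfl) ?_)) (fun h => h.elim (fun h =>
          (eq_or_lt_of_le (show a ≤ b by omega)).elim (fun h =>
            leaf _ _ (lm 19 rfl) ?_) (fun h =>
            leaf _ _ (lm 31 rfl) ?_)) (fun h =>
          (eq_or_lt_of_le (show 0 ≤ a by omega)).elim (fun h =>
            (lt_or_ge c (a + b + d)).elim (fun h =>
              leaf _ _ (lm 10 rfl) ?_) (fun h =>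
              leaf _ _ (lm 5 rfl) ?_)) (fun h =>
            (eq_or_lt_of_le (show a ≤ b by omega)).elim (fun h =>
              (lt_or_ge c (a + b + d)).elim (fun h =>
                leaf _ _ (lm 44 rfl) ?_) (fun h =>
                leaf _ _ (lm 20 rfl) ?_)) (fun h =>
              (lt_or_ge c (a + b + d)).elim (fun h =>
                leaf _ _ (lm 33 rfl) ?_) (fun h =>
                leaf _ _ (lm 34 rfl) ?_)))))) (fun h => h.elim (fun h =>
        (eq_or_lt_of_le (show 0 ≤ a by omega)).elim (fun h =>
          leaf _ _ (lm 4 rfl) ?_) (fun h =>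
          (eq_or_lt_of_le (show a ≤ b by omega)).elim (fun h =>
            leaf _ _ (lm 15 rfl) ?_) (fun h =>
            leaf _ _ (lm 28 rfl) ?_))) (fun h =>
        (lt_trichotomy d (b + c)).elim (fun h =>
          (eq_or_lt_of_le (show a ≤ b by omega)).elim (fun h =>
            (eq_or_lt_of_le (show b ≤ c by omega)).elim (fun h =>
              leaf _ _ (lm 37 rfl) ?_) (fun h =>
              leaf _ _ (lm 40 rfl) ?_)) (fun h =>
            (eq_or_lt_of_le (show 0 ≤ a by omega)).elim (fun h =>
              leaf _ _ (lm 7 rfl) ?_) (fun h =>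
              leaf _ _ (lm 23 rfl) ?_))) (fun h => h.elim (fun h =>
          (eq_or_lt_of_le (show a ≤ b by omega)).elim (fun h =>
            (eq_or_lt_of_le (show b ≤ c by omega)).elim (fun h =>
              leaf _ _ (lm 12 rfl) ?_) (fun h =>
              leaf _ _ (lm 16 rfl) ?_)) (fun h =>
            (eq_or_lt_of_le (show 0 ≤ a by omega)).elim (fun h =>
              leaf _ _ (lm 2 rfl) ?_) (fun h =>
              leaf _ _ (lm 24 rfl) ?_))) (fun h =>
          (eq_or_lt_of_le (show a ≤ b by omega)).elim (fun h =>
            (eq_or_lt_of_le (show b ≤ c by omega)).elim (fun h =>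
              (lt_or_ge d (a + b + c)).elim (fun h =>
                leaf _ _ (lm 38 rfl) ?_) (fun h =>
                leaf _ _ (lm 13 rfl) ?_)) (fun h =>
              (lt_or_ge d (a + b + c)).elim (fun h =>
                leaf _ _ (lm 41 rfl) ?_) (fun h =>
                leaf _ _ (lm 17 rfl) ?_))) (fun h =>
            (eq_or_lt_of_le (show 0 ≤ a by omega)).elim (fun h =>
              leaf _ _ (lm 0 rfl) ?_) (fun h =>
              (lt_or_ge d (a + b + c)).elim (fun h =>
                leaf _ _ (lm 46 rfl) ?_) (fun h =>
                leaf _ _ (lm 25 rfl) ?_)))))))))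
  all_goals
    constructor
    · conv_lhs =>
        simp only [bits, syms, List.map_cons, List.map_nil, bits1, cb2, cb, fb, ib, hb]
        simp (disch := omega) only [decide_eq_true, decide_eq_false]
      rfl
    · simp only [app, dot, Prod.mk.injEq]
      refine ⟨?_, ?_, ?_, ?_⟩ <;> omega

theorem TT_congr (τ : List ℕ → V4 → V4 → ℤ) {q q0 : V4} (ρ x : V4)
    (h : ∀ s ∈ syms, bits1 (s q) = bits1 (s q0)) : TT τ q ρ x = TT τ q0 ρ x := by
  unfold TT
  congr 1
  apply List.map_congr_left
  intro s hs
  rw [h s hs]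

theorem good1 {q : V4} (h : Good q) : TT tm1 q q q = 0 := by
  obtain ⟨x, hx, hb, hq⟩ := h
  rw [TT_congr tm1 q q hb]
  have := TT1_cell hx q q
  rwa [hq] at this

theorem red_app (m q) : red (app m (red q)) = red (app m q) := by
  have key : ∀ u : V4, dot u (red q) % 3 = dot u q % 3 := by
    intro u
    simp [dot, red, Int.add_emod, Int.mul_emod]
  exact Prod.ext (key _) (Prod.ext (key _) (Prod.ext (key _) (key _)))

theorem rc_red (q) : rc (red q) = rc q := by simp [rc, red]

theorem muInv_red (q) : red (muInv (red q)) = red (muInv q) := by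
  simp [red, muInv]

theorem ps_mod (x : ℤ) : ps (x % 3) = ps x := by simp [ps]

theorem tm3_red (B : List ℕ) (ρ q : V4) : tm3 B (red ρ) q = tm3 B ρ q := by
  unfold tm3
  split
  · rw [rc_red, ← rc_red (muInv (red ρ)), muInv_red, rc_red]
    simp only [red, ps_mod, Int.emod_emod_of_dvd, dvd_refl]
    simp [Int.add_emod, Int.sub_emod]
  · rfl

theorem good3 {q : V4} (h : Good q) (hn : (q.1 * q.2.2.2 + q.2.1 * q.2.2.1) % 3 = 1) :
    TT tm3 q q q = 0 := by
  obtain ⟨x, hx, hb, hq⟩ := h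
  rw [TT_congr tm3 q q hb]
  have h1 : red q ∈ rho := by
    have e1 := Int.emod_nonneg q.1 (by norm_num : (3 : ℤ) ≠ 0)
    have e2 := Int.emod_nonneg q.2.1 (by norm_num : (3 : ℤ) ≠ 0)
    have e3 := Int.emod_nonneg q.2.2.1 (by norm_num : (3 : ℤ) ≠ 0)
    have e4 := Int.emod_nonneg q.2.2.2 (by norm_num : (3 : ℤ) ≠ 0)
    have f1 := Int.emod_lt_of_pos q.1 (by norm_num : (0 : ℤ) < 3)
    have f2 := Int.emod_lt_of_pos q.2.1 (by norm_num : (0 : ℤ) < 3)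
    have f3 := Int.emod_lt_of_pos q.2.2.1 (by norm_num : (0 : ℤ) < 3)
    have f4 := Int.emod_lt_of_pos q.2.2.2 (by norm_num : (0 : ℤ) < 3)
    have key : ∀ t : ℤ, 0 ≤ t → t < 3 → t ∈ [(0 : ℤ), 1, 2] := by
      intro t h0 h3; simp; omega
    simp only [rho, List.mem_flatMap, List.mem_filter, List.mem_map, decide_eq_true_eq]
    refine ⟨_, key _ e1 f1, _, key _ e2 f2, _, key _ e3 f3, ⟨_, key _ e4 f4, rfl⟩, ?_⟩
    rw [← hn]
    simp [red, Int.add_emod, Int.mul_emod]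
  have := TT3_cell hx (red q) q h1 (by rw [red_app, hq])
  rw [hq] at this
  rw [← this]
  unfold TT
  congr 1
  apply List.map_congr_left
  intro s hs
  rw [← tm3_red]
  congr 1
  simp only [syms, List.mem_cons, List.not_mem_nil, or_false] at hs
  rcases hs with rfl | rfl | rfl | rfl | rfl | rfl | rfl | rfl <;> simp [red]

theorem TT_syms (τ : List ℕ → V4 → V4 → ℤ) (q : V4) (s : V4 → V4) (hs : s ∈ syms) :
    TT τ (s q) (s q) (s q) = TT τ q q q := by
  simp only [syms, List.mem_cons, List.not_mem_nil, or_false] at hs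
  rcases hs with rfl | rfl | rfl | rfl | rfl | rfl | rfl | rfl <;>
    simp only [TT, syms, List.map_cons, List.map_nil, List.sum_cons, List.sum_nil] <;> ring

theorem exists_fd (q : V4) (h : 0 ≤ q.1 ∧ 0 ≤ q.2.1 ∧ 0 ≤ q.2.2.1 ∧ 0 ≤ q.2.2.2)
    (hn : 0 < q.1 * q.2.2.2 + q.2.1 * q.2.2.1) :
    ∃ s ∈ syms, 0 ≤ (s q).1 ∧ (s q).1 ≤ (s q).2.1 ∧ (s q).2.1 ≤ (s q).2.2.1 ∧ (s q).1 ≤ (s q).2.2.2 ∧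
      0 < (s q).2.1 := by
  obtain ⟨a, b, c, d⟩ := q
  simp only at h hn
  obtain ⟨ha, hb, hc, hd⟩ := h
  have key : ¬ (a = 0 ∧ b = 0) ∧ ¬ (a = 0 ∧ c = 0) ∧ ¬ (d = 0 ∧ b = 0) ∧ ¬ (d = 0 ∧ c = 0) := by
    refine ⟨?_, ?_, ?_, ?_⟩ <;> rintro ⟨rfl, rfl⟩ <;> simp at hn
  simp only [syms, List.mem_cons, List.not_mem_nil, or_false, exists_eq_or_imp, exists_eq_left]
  omega

theorem T1_zero (q : V4) (h : 0 ≤ q.1 ∧ 0 ≤ q.2.1 ∧ 0 ≤ q.2.2.1 ∧ 0 ≤ q.2.2.2)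
    (hn : 0 < q.1 * q.2.2.2 + q.2.1 * q.2.2.1) : TT tm1 q q q = 0 := by
  obtain ⟨s, hs, h1, h2, h3, h4, h5⟩ := exists_fd q h hn
  rw [← TT_syms _ q s hs]
  exact good1 (good_fd _ _ _ _ h1 h2 h3 h4 h5)

theorem T3_zero (q : V4) (h : 0 ≤ q.1 ∧ 0 ≤ q.2.1 ∧ 0 ≤ q.2.2.1 ∧ 0 ≤ q.2.2.2)
    (hn : 0 < q.1 * q.2.2.2 + q.2.1 * q.2.2.1)
    (hm : (q.1 * q.2.2.2 + q.2.1 * q.2.2.1) % 3 = 1) : TT tm3 q q q = 0 := by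
  obtain ⟨s, hs, h1, h2, h3, h4, h5⟩ := exists_fd q h hn
  rw [← TT_syms _ q s hs]
  refine good3 (good_fd _ _ _ _ h1 h2 h3 h4 h5) ?_
  rw [← hm]
  congr 1
  simp only [syms, List.mem_cons, List.not_mem_nil, or_false] at hs
  rcases hs with rfl | rfl | rfl | rfl | rfl | rfl | rfl | rfl <;> ring

/-- Nonnegative quadruples with `ad+bc=n`, in a box. -/
noncomputable def SQ (n : ℤ) : Finset V4 :=
  (Icc 0 (2 * n) ×ˢ Icc 0 (2 * n) ×ˢ Icc 0 (2 * n) ×ˢ Icc 0 (2 * n)).filter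
    fun q => q.1 * q.2.2.2 + q.2.1 * q.2.2.1 = n

theorem mem_SQ {n : ℤ} {q : V4} : q ∈ SQ n ↔ (((0 ≤ q.1 ∧ q.1 ≤ 2 * n) ∧ (0 ≤ q.2.1 ∧ q.2.1 ≤ 2 * n) ∧
    (0 ≤ q.2.2.1 ∧ q.2.2.1 ≤ 2 * n) ∧ (0 ≤ q.2.2.2 ∧ q.2.2.2 ≤ 2 * n)) ∧
    q.1 * q.2.2.2 + q.2.1 * q.2.2.1 = n) := by
  simp [SQ]

theorem sum_syms (n : ℤ) (F : V4 → ℤ) :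
    ∑ q ∈ SQ n, (syms.map fun s => F (s q)).sum = 8 * ∑ q ∈ SQ n, F q := by
  have key : ∀ s t : V4 → V4, (∀ q, t (s q) = q) → (∀ q, s (t q) = q) → (∀ q ∈ SQ n, s q ∈ SQ n) →
      (∀ q ∈ SQ n, t q ∈ SQ n) → ∑ q ∈ SQ n, F (s q) = ∑ q ∈ SQ n, F q := by
    intro s t h1 h2 h3 h4
    exact sum_nbij' s t h3 h4 (fun q _ => h1 q) (fun q _ => h2 q) (fun q _ => rfl)
  have m : ∀ s ∈ syms, ∀ q ∈ SQ n, s q ∈ SQ n := by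
    intro s hs q hq
    rw [mem_SQ] at hq ⊢
    obtain ⟨⟨h1, h2, h3, h4⟩, h5⟩ := hq
    simp only [syms, List.mem_cons, List.not_mem_nil, or_false] at hs
    rcases hs with rfl | rfl | rfl | rfl | rfl | rfl | rfl | rfl <;>
      refine ⟨⟨by assumption, by assumption, by assumption, by assumption⟩, by rw [← h5] <;> ring⟩
  have inv : ∀ s ∈ syms, ∃ t ∈ syms, (∀ q, t (s q) = q) ∧ (∀ q, s (t q) = q) := by
    intro s hs
    simp only [syms, List.mem_cons, List.not_mem_nil, or_false] at hs
    rcases hs with rfl | rfl | rfl | rfl | rfl | rfl | rfl | rfl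
    · exact ⟨syms[0], by simp [syms], fun _ => rfl, fun _ => rfl⟩
    · exact ⟨syms[1], by simp [syms], fun _ => rfl, fun _ => rfl⟩
    · exact ⟨syms[2], by simp [syms], fun _ => rfl, fun _ => rfl⟩
    · exact ⟨syms[3], by simp [syms], fun _ => rfl, fun _ => rfl⟩
    · exact ⟨syms[4], by simp [syms], fun _ => rfl, fun _ => rfl⟩
    · exact ⟨syms[6], by simp [syms], fun _ => rfl, fun _ => rfl⟩
    · exact ⟨syms[5], by simp [syms], fun _ => rfl, fun _ => rfl⟩
    · exact ⟨syms[7], by simp [syms], fun _ => rfl, fun _ => rfl⟩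
  have all : ∀ s ∈ syms, ∑ q ∈ SQ n, F (s q) = ∑ q ∈ SQ n, F q := by
    intro s hs
    obtain ⟨t, ht, h1, h2⟩ := inv s hs
    exact key s t h1 h2 (m s hs) (m t ht)
  have gen : ∀ l : List (V4 → V4), (∀ s ∈ l, s ∈ syms) →
      ∑ q ∈ SQ n, (l.map fun s => F (s q)).sum = l.length * ∑ q ∈ SQ n, F q := by
    intro l hl
    induction l with
    | nil => simp
    | cons s l ih =>
      simp only [List.map_cons, List.sum_cons, sum_add_distrib]
      rw [all s (hl s (by simp)), ih fun s hs => hl s (by simp [hs])]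
      simp; ring
  have := gen syms (fun _ h => h)
  rw [this]; simp [syms]

theorem cb_dom {q : V4} (h : cb q ≠ 0) : 0 < q.2.2.1 ∧ q.2.2.1 < q.2.2.2 ∧
    (q.1 ≤ 0 → q.2.2.2 ≤ q.2.1 + q.2.2.1) := by
  by_contra hc
  apply h
  unfold cb cbB
  simp only [cond_eq_ite]
  rw [if_pos]
  simp
  omega

theorem cb2_dom {q : V4} (h : cb2 q ≠ 0) : q.1 ≤ q.2.1 ∧ 0 < q.2.2.1 ∧ 0 < q.2.2.2 ∧
    (q.1 ≤ 0 → q.1 + q.2.2.2 ≤ q.2.1) := by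
  by_contra hc
  apply h
  unfold cb2 cbB
  by_cases h1 : q.1 ≤ q.2.1
  · simp only [h1, cond_eq_ite, decide_true, if_true]
    rw [if_pos]
    simp
    omega
  · simp [h1]

theorem cb_mu {q : V4} (h : q.1 ≤ q.2.1) : cb (muInv q) = cb2 q := by
  unfold cb2 cb muInv
  simp only [h, decide_true, cond_true]
  congr 1 <;> (apply decide_eq_decide.2; omega)

theorem sum_mu {n : ℤ} (G : ℕ → V4 → ℤ) (hG : ∀ q, G 0 q = 0) :
    ∑ q ∈ SQ n, G (cb q) q = ∑ q ∈ SQ n, G (cb2 q) (muInv q) := by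
  have e1 : ∑ q ∈ SQ n, G (cb q) q = ∑ q ∈ (SQ n).filter (fun q => cb q ≠ 0), G (cb q) q := by
    rw [Finset.sum_filter_of_ne]
    intro q _ h h0
    exact h (by rw [h0, hG])
  have e2 : ∑ q ∈ SQ n, G (cb2 q) (muInv q) =
      ∑ q ∈ (SQ n).filter (fun q => cb2 q ≠ 0), G (cb2 q) (muInv q) := by
    rw [Finset.sum_filter_of_ne]
    intro q _ h h0
    exact h (by rw [h0, hG])
  rw [e1, e2]
  symm
  refine sum_nbij' muInv (fun q => (q.1, q.1 + q.2.1, q.2.2.1, q.2.2.2 - q.2.2.1)) ?_ ?_ ?_ ?_ ?_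
  · rintro ⟨a, b, c, d⟩ hq
    rw [mem_filter, mem_SQ] at hq ⊢
    obtain ⟨⟨⟨h1, h2, h3, h4⟩, h5⟩, h6⟩ := hq
    obtain ⟨g1, g2, g3, g4⟩ := cb2_dom h6
    simp only [muInv] at *
    refine ⟨⟨⟨h1, ⟨by omega, by omega⟩, h3, ⟨by omega, ?_⟩⟩, ?_⟩, ?_⟩
    · have hb : 0 < b ∨ (a = 0 ∧ b = 0) := by omega
      rcases hb with hb | ⟨rfl, rfl⟩
      · have : c ≤ n := by nlinarith
        rcases h1.1.eq_or_lt with h0 | h0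
        · subst h0
          have : b ≤ n := by nlinarith
          have := g4 le_rfl
          omega
        · have : d ≤ n := by nlinarith
          omega
      · have := g4 le_rfl
        omega
    · rw [← h5]; ring
    · have := cb_mu (q := (a, b, c, d)) g1
      simp only [muInv] at this
      rw [this]; exact h6
  · rintro ⟨a, b, c, d⟩ hq
    rw [mem_filter, mem_SQ] at hq ⊢
    obtain ⟨⟨⟨h1, h2, h3, h4⟩, h5⟩, h6⟩ := hq
    obtain ⟨g1, g2, g3⟩ := cb_dom h6
    have := cb_mu (q := (a, a + b, c, d - c)) (by simp only at *; omega)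
    simp only [muInv] at *
    refine ⟨⟨⟨h1, ⟨by omega, ?_⟩, h3, ⟨by omega, by omega⟩⟩, ?_⟩, ?_⟩
    · have : a ≤ n := by nlinarith
      have : b ≤ n := by nlinarith
      omega
    · rw [← h5]; ring
    · rw [← this]
      simpa using h6
  · rintro ⟨a, b, c, d⟩ _; simp [muInv]
  · rintro ⟨a, b, c, d⟩ _; simp [muInv]
  · rintro ⟨a, b, c, d⟩ hq
    rw [mem_filter] at hq
    rw [cb_mu (cb2_dom hq.2).1]

theorem sum_tm {n : ℤ} (τ : List ℕ → V4 → V4 → ℤ) (h : ∀ q ∈ SQ n, TT τ q q q = 0) :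
    ∑ q ∈ SQ n, τ (bits1 q) q q = 0 := by
  have := sum_syms n (fun q => τ (bits1 q) q q)
  have h2 : ∑ q ∈ SQ n, (syms.map fun s => τ (bits1 (s q)) (s q) (s q)).sum = 0 :=
    sum_eq_zero h
  rw [h2] at this
  omega

theorem level1 {n : ℤ} (hn : 0 < n) :
    ∑ q ∈ SQ n, (cf (fb q) * s1 q + 2 * ib q * s2 q) = ∑ q ∈ SQ n, hv (hb q) q := by
  have h := sum_tm (n := n) tm1 (fun q hq => by
    rw [mem_SQ] at hq
    exact T1_zero q ⟨hq.1.1.1, hq.1.2.1.1, hq.1.2.2.1.1, hq.1.2.2.2.1⟩ (by omega))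
  have h2 := sum_mu (n := n) (fun k q => ev (t1 k) q) (fun q => by simp [t1, ev])
  simp only [tm1, bits1, sum_add_distrib, sum_sub_distrib] at h
  rw [sum_add_distrib]
  linarith

theorem level3 {n : ℤ} (hn : 0 < n) (hn3 : n % 3 = 1) :
    ∑ q ∈ SQ n, ((if (q.1 + q.2.2.2) % 3 = 0 then cf (fb q) else 0) * s1 q +
      ((if (q.2.1 + q.2.2.1 - q.2.2.2) % 3 = 0 then 2 * ib q else 0 : ℕ) : ℤ) * s2 q) =
    ∑ q ∈ SQ n, (if q.1 % 3 = 0 then 18 * ps q.2.2.2 * ps q.2.2.1 else 0) * (q.1 * q.2.2.2) := by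
  have h := sum_tm (n := n) tm3 (fun q hq => by
    rw [mem_SQ] at hq
    exact T3_zero q ⟨hq.1.1.1, hq.1.2.1.1, hq.1.2.2.1.1, hq.1.2.2.2.1⟩ (by omega) (by omega))
  have h2 := sum_mu (n := n) (fun k q => ev (t3 k (rc q)) q) (fun q => by simp [t3, ev])
  simp only [tm3, bits1, sum_add_distrib, sum_sub_distrib] at h
  rw [sum_add_distrib]
  linarith

def WW (l h d : ℤ) : ℤ :=
  if d < l then l * l + h * h else if d = l then (if l = h then -10 * (l * h) else 0)
  else if d < h then 6 * (l * h) else if d = h then -3 * (l * l + h * h)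
  else if d < l + h then -4 * (l * l) + -4 * (h * h) + 6 * (l * h) else 12 * (l * h)

theorem hv_eval_le (b c d : ℤ) (hb0 : 0 < b) (hbc : b ≤ c) (hd : 0 < d) (hd2 : d ≤ b + c) :
    hv (hb (0, b, c, d)) (0, b, c, d) = WW b c d ∧ hv (hb (0, c, b, d)) (0, c, b, d) = WW b c d := by
  have hd3 : d ≤ c + b := by omega
  unfold WW
  rcases lt_trichotomy d b with h1 | h1 | h1 <;> rcases lt_trichotomy d c with h2 | h2 | h2 <;>
  rcases lt_or_ge d (b + c) with h3 | h3 <;> first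
  | omega
  | (constructor <;>
     · simp only [hb]
       simp (disch := omega) only [decide_eq_true, decide_eq_false, if_pos, if_neg]
       simp only [hbB, hv, cond_true, cond_false, Bool.not_true, Bool.not_false, Bool.or_false]
       try ring)

theorem WW_lt (l e : ℕ) : ∑ d ∈ Ico 1 (2 * (l + 1) + e + 2), WW (l + 1) (l + e + 2) (d : ℕ) =
    3 * ((l + 1) * (l + e + 2)) * (l + e + 2) - 3 * (l + 1 : ℤ) ^ 3 := by
  rw [← sum_Ico_consecutive _ (show 1 ≤ l + 1 by omega) (show l + 1 ≤ _ by omega),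
    ← sum_Ico_consecutive _ (show l + 1 ≤ l + 2 by omega) (show l + 2 ≤ _ by omega),
    ← sum_Ico_consecutive _ (show l + 2 ≤ l + e + 2 by omega) (show l + e + 2 ≤ _ by omega),
    ← sum_Ico_consecutive _ (show l + e + 2 ≤ l + e + 3 by omega) (show l + e + 3 ≤ _ by omega),
    ← sum_Ico_consecutive _ (show l + e + 3 ≤ 2 * (l + 1) + e + 1 by omega) (show 2 * (l + 1) + e + 1 ≤ _ by omega)]
  have c : ∀ (x y : ℕ) (v : ℤ), (∀ d ∈ Ico x y, WW (l + 1) (l + e + 2) (d : ℕ) = v) →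
      ∑ d ∈ Ico x y, WW (l + 1) (l + e + 2) (d : ℕ) = (y - x : ℕ) * v := by
    intro x y v h
    rw [sum_congr rfl h]; simp
  set A : ℤ := l + 1 with hA
  set B : ℤ := l + e + 2 with hB
  rw [c 1 (l + 1) (A * A + B * B), c (l + 1) (l + 2) 0, c (l + 2) (l + e + 2) (6 * (A * B)),
    c (l + e + 2) (l + e + 3) (-3 * (A * A + B * B)),
    c (l + e + 3) (2 * (l + 1) + e + 1) (-4 * (A * A) + -4 * (B * B) + 6 * (A * B)),
    c (2 * (l + 1) + e + 1) (2 * (l + 1) + e + 2) (12 * (A * B))]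
  · rw [show l + 1 - 1 = l by omega, show l + 2 - (l + 1) = 1 by omega, show l + e + 2 - (l + 2) = e by omega,
      show l + e + 3 - (l + e + 2) = 1 by omega, show 2 * (l + 1) + e + 1 - (l + e + 3) = l by omega,
      show 2 * (l + 1) + e + 2 - (2 * (l + 1) + e + 1) = 1 by omega]
    have h1 : (l : ℤ) = A - 1 := by omega
    have h2 : (e : ℤ) = B - A - 1 := by omega
    rw [h1, h2]; push_cast; ring
  all_goals
    intro d hd
    rw [mem_Ico] at hd
    unfold WW
    simp (disch := omega) only [if_pos, if_neg]

theorem WW_eq (l : ℕ) : ∑ d ∈ Ico 1 (2 * (l + 1) + 1), WW (l + 1) (l + 1) (d : ℕ) =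
    2 * ((l + 1) * (l + 1)) := by
  rw [← sum_Ico_consecutive _ (show 1 ≤ l + 1 by omega) (show l + 1 ≤ _ by omega),
    ← sum_Ico_consecutive _ (show l + 1 ≤ l + 2 by omega) (show l + 2 ≤ _ by omega),
    ← sum_Ico_consecutive _ (show l + 2 ≤ 2 * (l + 1) by omega) (show 2 * (l + 1) ≤ _ by omega)]
  have c : ∀ (x y : ℕ) (v : ℤ), (∀ d ∈ Ico x y, WW (l + 1) (l + 1) (d : ℕ) = v) →
      ∑ d ∈ Ico x y, WW (l + 1) (l + 1) (d : ℕ) = (y - x : ℕ) * v := by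
    intro x y v h
    rw [sum_congr rfl h]; simp
  set A : ℤ := l + 1 with hA
  rw [c 1 (l + 1) (A * A + A * A), c (l + 1) (l + 2) (-10 * (A * A)),
    c (l + 2) (2 * (l + 1)) (-4 * (A * A) + -4 * (A * A) + 6 * (A * A)),
    c (2 * (l + 1)) (2 * (l + 1) + 1) (12 * (A * A))]
  · rw [show l + 1 - 1 = l by omega, show l + 2 - (l + 1) = 1 by omega, show 2 * (l + 1) - (l + 2) = l by omega,
      show 2 * (l + 1) + 1 - 2 * (l + 1) = 1 by omega]
    have h1 : (l : ℤ) = A - 1 := by omega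
    rw [h1]; push_cast; ring
  all_goals
    intro d hd
    rw [mem_Ico] at hd
    unfold WW
    simp (disch := omega) only [if_pos, if_neg, if_true]

theorem hv_sum (b c : ℕ) (hb0 : 0 < b) (hc0 : 0 < c) :
    ∑ d ∈ Ico 1 (b + c + 1), hv (hb (0, b, c, (d : ℕ))) (0, b, c, (d : ℕ)) =
    3 * (b * c) * max b c - 3 * (min b c : ℤ) ^ 3 + if b = c then 2 * (b * c : ℤ) else 0 := by
  rcases lt_trichotomy b c with h | h | h
  · obtain ⟨l, rfl⟩ : ∃ l, b = l + 1 := ⟨b - 1, by omega⟩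
    obtain ⟨e, rfl⟩ : ∃ e, c = l + e + 2 := ⟨c - l - 2, by omega⟩
    rw [if_neg (by omega), max_eq_right (by exact_mod_cast h.le), min_eq_left (by exact_mod_cast h.le)]
    have := WW_lt l e
    push_cast at this ⊢
    rw [add_zero, ← this, show l + 1 + (l + e + 2) + 1 = 2 * (l + 1) + e + 2 by ring]
    refine sum_congr rfl fun d hd => ?_
    rw [mem_Ico] at hd
    exact (hv_eval_le _ _ _ (by omega) (by omega) (by omega) (by omega)).1
  · subst h
    obtain ⟨l, rfl⟩ : ∃ l, b = l + 1 := ⟨b - 1, by omega⟩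
    have := WW_eq l
    simp only [if_true, max_self, min_self]
    push_cast at this ⊢
    rw [show l + 1 + (l + 1) + 1 = 2 * (l + 1) + 1 by ring]
    rw [show 3 * (((l : ℤ) + 1) * (l + 1)) * (l + 1) - 3 * (l + 1) ^ 3 + 2 * ((l + 1) * (l + 1)) =
       2 * ((l + 1) * (l + 1)) by ring, ← this]
    refine sum_congr rfl fun d hd => ?_
    rw [mem_Ico] at hd
    exact (hv_eval_le _ _ _ (by omega) (by omega) (by omega) (by omega)).1
  · obtain ⟨l, rfl⟩ : ∃ l, c = l + 1 := ⟨c - 1, by omega⟩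
    obtain ⟨e, rfl⟩ : ∃ e, b = l + e + 2 := ⟨b - l - 2, by omega⟩
    rw [if_neg (by omega), max_eq_left (by exact_mod_cast h.le), min_eq_right (by exact_mod_cast h.le)]
    have := WW_lt l e
    push_cast at this ⊢
    rw [add_zero, mul_comm ((l : ℤ) + e + 2) (l + 1), ← this, show l + e + 2 + (l + 1) + 1 = 2 * (l + 1) + e + 2 by ring]
    refine sum_congr rfl fun d hd => ?_
    rw [mem_Ico] at hd
    exact (hv_eval_le _ _ _ (by omega) (by omega) (by omega) (by omega)).2

theorem hb_dom {q : V4} (h : hb q ≠ 0) : q.1 ≤ 0 ∧ 0 < q.2.1 ∧ 0 < q.2.2.1 ∧ 0 < q.2.2.2 ∧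
    q.2.2.2 ≤ q.2.1 + q.2.2.1 := by
  by_contra hc
  apply h
  unfold hb hbB
  simp only [cond_eq_ite]
  rw [if_pos]
  simp
  omega

theorem sum_hv (n : ℕ) (hn : 0 < n) : ∑ q ∈ SQ n, hv (hb q) q =
    ∑ x ∈ n.divisorsAntidiagonal, (3 * n * max x.1 x.2 - 3 * (min x.1 x.2 : ℤ) ^ 3 +
      if x.1 = x.2 then 2 * (n : ℤ) else 0) := by
  have e : ∀ x ∈ n.divisorsAntidiagonal, (3 * n * max x.1 x.2 - 3 * (min x.1 x.2 : ℤ) ^ 3 +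
      if x.1 = x.2 then 2 * (n : ℤ) else 0) =
      ∑ d ∈ Ico 1 (x.1 + x.2 + 1), hv (hb (0, x.1, x.2, (d : ℕ))) (0, x.1, x.2, (d : ℕ)) := by
    intro x hx
    rw [Nat.mem_divisorsAntidiagonal] at hx
    have h1 : 0 < x.1 := Nat.pos_of_ne_zero fun h => hx.2 (by rw [← hx.1, h, zero_mul])
    have h2 : 0 < x.2 := Nat.pos_of_ne_zero fun h => hx.2 (by rw [← hx.1, h, mul_zero])
    rw [hv_sum _ _ h1 h2, ← hx.1]; push_cast; rfl
  rw [sum_congr rfl e, Finset.sum_sigma']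
  have e1 : ∑ q ∈ SQ n, hv (hb q) q = ∑ q ∈ (SQ n).filter (fun q => hb q ≠ 0), hv (hb q) q := by
    rw [Finset.sum_filter_of_ne]
    intro q _ h h0
    exact h (by rw [h0]; rfl)
  rw [e1]
  symm
  refine Finset.sum_bij_ne_zero (fun (y : Σ _ : ℕ × ℕ, ℕ) _ _ => ((0, y.1.1, y.1.2, (y.2 : ℕ)) : V4)) ?_ ?_ ?_ ?_
  · rintro ⟨⟨b, c⟩, d⟩ hy h0
    simp only [mem_sigma, Nat.mem_divisorsAntidiagonal, mem_Ico] at hy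
    rw [mem_filter, mem_SQ]
    obtain ⟨⟨h1, h2⟩, h3⟩ := hy
    have hb1 : b ≤ n := by
      rw [← h1]; exact Nat.le_mul_of_pos_right _ (Nat.pos_of_ne_zero fun h => h2 (by rw [← h1, h, mul_zero]))
    have hc1 : c ≤ n := by
      rw [← h1]; exact Nat.le_mul_of_pos_left _ (Nat.pos_of_ne_zero fun h => h2 (by rw [← h1, h, zero_mul]))
    have h1' : (b : ℤ) * c = n := by exact_mod_cast h1
    simp only
    refine ⟨⟨⟨by omega, by omega, by omega, by omega⟩, by rw [h1']; simp⟩, ?_⟩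
    intro h; apply h0; simp only; rw [h]; rfl
  · rintro ⟨⟨b, c⟩, d⟩ hy h0 ⟨⟨b', c'⟩, d'⟩ hy' h0' h
    simp only [Prod.mk.injEq, Nat.cast_inj] at h
    obtain ⟨-, rfl, rfl, rfl⟩ := h
    rfl
  · rintro ⟨a, b, c, d⟩ hq h0
    rw [mem_filter, mem_SQ] at hq
    obtain ⟨⟨⟨h1, h2, h3, h4⟩, h5⟩, h6⟩ := hq
    obtain ⟨g1, g2, g3, g4, g5⟩ := hb_dom h6
    simp only at *
    obtain rfl : a = 0 := by omega
    lift b to ℕ using g2.le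
    lift c to ℕ using g3.le
    lift d to ℕ using g4.le
    refine ⟨⟨(b, c), d⟩, ?_, ?_, rfl⟩
    · simp only [mem_sigma, Nat.mem_divisorsAntidiagonal, mem_Ico]
      rw [zero_mul, zero_add] at h5
      refine ⟨⟨by exact_mod_cast h5, by omega⟩, by omega, by omega⟩
    · exact h0
  · rintro ⟨⟨b, c⟩, d⟩ hy h0
    rfl

def sg (x : ℤ) : ℤ := if 0 < x then 1 else if x < 0 then -1 else 0

/-- admissible `(t,x,y,z)` -/
def okk (n : ℤ) (v : V4) : Prop :=
  v.1 ^ 2 + v.2.1 * v.2.2.1 + v.2.2.1 * v.2.2.2 + v.2.2.2 * v.2.1 = 4 * n ∧ 0 < v.1 ∧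
  v.2.1 % 2 = v.1 % 2 ∧ v.2.2.1 % 2 = v.1 % 2 ∧ v.2.2.2 % 2 = v.1 % 2 ∧
  0 < v.2.1 + v.2.2.1 ∧ 0 < v.2.1 + v.2.2.2 ∧
  ((-v.1 < v.2.1 ∧ v.2.1 < v.1) ∨ (0 ≤ v.2.1 ∧ 0 ≤ v.2.2.1 ∧ 0 ≤ v.2.2.2 ∧ 0 < v.2.2.1 + v.2.2.2))

open Classical in
noncomputable def GG (n : ℤ) : Finset V4 :=
  (Icc (-(4 * n)) (4 * n) ×ˢ Icc (-(4 * n)) (4 * n) ×ˢ Icc (-(4 * n)) (4 * n) ×ˢ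
    Icc (-(4 * n)) (4 * n)).filter (okk n)

open Classical in
theorem mem_GG {n : ℤ} {v : V4} : v ∈ GG n ↔ okk n v := by
  unfold GG
  rw [mem_filter, and_iff_right_iff_imp]
  obtain ⟨t, x, y, z⟩ := v
  rintro ⟨h1, h2, h3, h4, h5, h6, h7, h8⟩
  simp only [mem_product, mem_Icc] at *
  rcases h8 with h8 | h8
  · obtain ⟨a, ha⟩ : ∃ a, t - x = 2 * a := ⟨(t - x) / 2, by omega⟩
    obtain ⟨d, hd⟩ : ∃ d, t + x = 2 * d := ⟨(t + x) / 2, by omega⟩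
    obtain ⟨b, hb⟩ : ∃ b, x + y = 2 * b := ⟨(x + y) / 2, by omega⟩
    obtain ⟨c, hc⟩ : ∃ c, x + z = 2 * c := ⟨(x + z) / 2, by omega⟩
    obtain rfl : t = a + d := by omega
    obtain rfl : x = d - a := by omega
    obtain rfl : y = 2 * b - (d - a) := by omega
    obtain rfl : z = 2 * c - (d - a) := by omega
    have e : a * d + b * c = n := by linarith
    have ha : 0 < a := by omega
    have hb : 0 < b := by omega
    have hc : 0 < c := by omega
    have hd : 0 < d := by omega
    have : a ≤ n := by nlinarith
    have : b ≤ n := by nlinarith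
    have : c ≤ n := by nlinarith
    have : d ≤ n := by nlinarith
    omega
  · obtain ⟨g1, g2, g3, g4⟩ := h8
    have : 0 ≤ x * y := by positivity
    have : 0 ≤ y * z := by positivity
    have : 0 ≤ z * x := by positivity
    have : t ≤ 4 * n := by nlinarith
    have : x ≤ 4 * n := by nlinarith
    have : y ≤ 4 * n := by nlinarith
    have : z ≤ 4 * n := by nlinarith
    omega

open Classical in
theorem tr {n : ℤ} (φ ψ : V4 → V4) (P Q : V4 → Prop) (f g : V4 → ℤ)
    (h1 : ∀ v, okk n v → P v → okk n (φ v) ∧ Q (φ v))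
    (h2 : ∀ v, okk n v → Q v → okk n (ψ v) ∧ P (ψ v))
    (h3 : ∀ v, ψ (φ v) = v) (h4 : ∀ v, φ (ψ v) = v) (h5 : ∀ v, P v → f v = g (φ v)) :
    ∑ v ∈ GG n, (if P v then f v else 0) = ∑ v ∈ GG n, (if Q v then g v else 0) := by
  rw [← sum_filter, ← sum_filter]
  refine sum_nbij' φ ψ ?_ ?_ ?_ ?_ ?_
  · intro v hv
    rw [mem_filter, mem_GG] at *
    exact h1 v hv.1 hv.2
  · intro v hv
    rw [mem_filter, mem_GG] at *
    exact h2 v hv.1 hv.2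
  · intro v _; exact h3 v
  · intro v _; exact h4 v
  · intro v hv
    rw [mem_filter] at hv
    exact h5 v hv.2

def CC (v : V4) : Prop := 0 ≤ v.2.1 ∧ 0 ≤ v.2.2.1 ∧ 0 ≤ v.2.2.2 ∧ 0 < v.2.2.1 + v.2.2.2
instance : DecidablePred CC := fun v => by unfold CC; infer_instance
def EE (v : V4) : Prop := -v.1 < v.2.1 ∧ v.2.1 < v.1
instance : DecidablePred EE := fun v => by unfold EE; infer_instance
/-- label `x < t` -/
def lx (v : V4) : Prop := v.2.1 < v.1
def ly (v : V4) : Prop := v.2.2.1 < v.1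
def lz (v : V4) : Prop := v.2.2.2 < v.1
instance : DecidablePred lx := fun v => by unfold lx; infer_instance
instance : DecidablePred ly := fun v => by unfold ly; infer_instance
instance : DecidablePred lz := fun v => by unfold lz; infer_instance
def vv (v : V4) : Prop := 0 < v.2.2.1 + v.2.2.2
instance : DecidablePred vv := fun v => by unfold vv; infer_instance
def w2 (v : V4) : ℤ := sg v.2.1 + sg v.2.2.1 + sg v.2.2.2 - 1
def rot (v : V4) : V4 := (v.1, v.2.2.1, v.2.2.2, v.2.1)
def rot2 (v : V4) : V4 := (v.1, v.2.2.2, v.2.1, v.2.2.1)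
def sxy (v : V4) : V4 := (v.1, v.2.2.1, v.2.1, v.2.2.2)
def syz (v : V4) : V4 := (v.1, v.2.1, v.2.2.2, v.2.2.1)
def sxz (v : V4) : V4 := (v.1, v.2.2.2, v.2.2.1, v.2.1)
def iot (v : V4) : V4 := (v.1, -v.2.1, v.2.2.1 + 2 * v.2.1, v.2.2.2 + 2 * v.2.1)

theorem tr' {n : ℤ} (φ ψ : V4 → V4) (P Q : V4 → Prop) [DecidablePred P] [DecidablePred Q] (f g : V4 → ℤ)
    (h1 : ∀ v, okk n v → P v → okk n (φ v) ∧ Q (φ v))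
    (h2 : ∀ v, okk n v → Q v → okk n (ψ v) ∧ P (ψ v))
    (h3 : ∀ v, ψ (φ v) = v) (h4 : ∀ v, φ (ψ v) = v) (h5 : ∀ v, P v → f v = g (φ v)) :
    ∑ v ∈ GG n, (if P v then f v else 0) = ∑ v ∈ GG n, (if Q v then g v else 0) := by
  convert tr φ ψ P Q f g h1 h2 h3 h4 h5

theorem trC {n : ℤ} (φ ψ : V4 → V4) (P Q : V4 → Prop) [DecidablePred P] [DecidablePred Q] (f g : V4 → ℤ)
    (hφ : (φ = rot ∧ ψ = rot2) ∨ (φ = rot2 ∧ ψ = rot))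
    (h1 : ∀ v, P v ↔ Q (φ v)) (h5 : ∀ v, f v = g (φ v)) :
    ∑ v ∈ GG n, (if CC v ∧ P v then f v else 0) = ∑ v ∈ GG n, (if CC v ∧ Q v then g v else 0) := by
  have hh : ∀ φ, φ = rot ∨ φ = rot2 → ∀ v, okk n v → CC v → okk n (φ v) ∧ CC (φ v) := by
    rintro φ h ⟨t, x, y, z⟩ h1 h2
    unfold okk at h1
    unfold okk
    unfold CC at h2
    rcases h with rfl | rfl <;> simp only [rot, rot2, CC] at * <;>
    exact ⟨⟨by rw [← h1.1]; ring, by omega⟩, by omega⟩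
  have i1 : ∀ v, ψ (φ v) = v := by rcases hφ with ⟨rfl, rfl⟩ | ⟨rfl, rfl⟩ <;> exact fun v => rfl
  have i2 : ∀ v, φ (ψ v) = v := by rcases hφ with ⟨rfl, rfl⟩ | ⟨rfl, rfl⟩ <;> exact fun v => rfl
  apply tr' φ ψ
  · intro v a b
    obtain ⟨c, d⟩ := hh φ (by rcases hφ with h | h <;> simp [h.1]) v a b.1
    exact ⟨c, d, (h1 v).1 b.2⟩
  · intro v a b
    obtain ⟨c, d⟩ := hh ψ (by rcases hφ with h | h <;> simp [h.2]) v a b.1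
    exact ⟨c, d, (h1 _).2 (by rw [i2]; exact b.2)⟩
  · exact i1
  · exact i2
  · intro v _; exact h5 v

theorem P2a {n : ℤ} (F : ℤ → ℤ) :
    ∑ v ∈ GG n, (if CC v then w2 v * F v.1 else 0) =
    ∑ v ∈ GG n, (if CC v ∧ (¬ lx v ∧ ¬ ly v ∧ ¬ lz v) then 2 * F v.1 else 0) +
    3 * ∑ v ∈ GG n, (if CC v ∧ (lx v ∧ ¬ ly v ∧ ¬ lz v) then (1 + sg v.2.1) * F v.1 else 0) +
    3 * ∑ v ∈ GG n, (if CC v ∧ (lx v ∧ ly v ∧ ¬ lz v) then (sg v.2.1 + sg v.2.2.1) * F v.1 else 0) +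
    ∑ v ∈ GG n, (if CC v ∧ (lx v ∧ ly v ∧ lz v) then w2 v * F v.1 else 0) := by
  have a1 := trC (n := n) rot rot2 (fun v => ¬ lx v ∧ ly v ∧ ¬ lz v) (fun v => lx v ∧ ¬ ly v ∧ ¬ lz v)
    (fun v => (1 + sg v.2.2.1) * F v.1) (fun v => (1 + sg v.2.1) * F v.1) (Or.inl ⟨rfl, rfl⟩)
    (fun v => by simp only [lx, ly, lz, rot]; tauto) (fun v => rfl)
  have a2 := trC (n := n) rot2 rot (fun v => ¬ lx v ∧ ¬ ly v ∧ lz v) (fun v => lx v ∧ ¬ ly v ∧ ¬ lz v)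
    (fun v => (1 + sg v.2.2.2) * F v.1) (fun v => (1 + sg v.2.1) * F v.1) (Or.inr ⟨rfl, rfl⟩)
    (fun v => by simp only [lx, ly, lz, rot2]; tauto) (fun v => rfl)
  have b1 := trC (n := n) rot rot2 (fun v => ¬ lx v ∧ ly v ∧ lz v) (fun v => lx v ∧ ly v ∧ ¬ lz v)
    (fun v => (sg v.2.2.1 + sg v.2.2.2) * F v.1) (fun v => (sg v.2.1 + sg v.2.2.1) * F v.1) (Or.inl ⟨rfl, rfl⟩)
    (fun v => by simp only [lx, ly, lz, rot]; tauto) (fun v => rfl)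
  have b2 := trC (n := n) rot2 rot (fun v => lx v ∧ ¬ ly v ∧ lz v) (fun v => lx v ∧ ly v ∧ ¬ lz v)
    (fun v => (sg v.2.2.2 + sg v.2.1) * F v.1) (fun v => (sg v.2.1 + sg v.2.2.1) * F v.1) (Or.inr ⟨rfl, rfl⟩)
    (fun v => by simp only [lx, ly, lz, rot2]; tauto) (fun v => rfl)
  have key : ∑ v ∈ GG n, (if CC v then w2 v * F v.1 else 0) =
    ∑ v ∈ GG n, (if CC v ∧ (¬ lx v ∧ ¬ ly v ∧ ¬ lz v) then 2 * F v.1 else 0) +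
    (∑ v ∈ GG n, (if CC v ∧ (lx v ∧ ¬ ly v ∧ ¬ lz v) then (1 + sg v.2.1) * F v.1 else 0) +
     ∑ v ∈ GG n, (if CC v ∧ (¬ lx v ∧ ly v ∧ ¬ lz v) then (1 + sg v.2.2.1) * F v.1 else 0) +
     ∑ v ∈ GG n, (if CC v ∧ (¬ lx v ∧ ¬ ly v ∧ lz v) then (1 + sg v.2.2.2) * F v.1 else 0)) +
    (∑ v ∈ GG n, (if CC v ∧ (lx v ∧ ly v ∧ ¬ lz v) then (sg v.2.1 + sg v.2.2.1) * F v.1 else 0) +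
     ∑ v ∈ GG n, (if CC v ∧ (¬ lx v ∧ ly v ∧ lz v) then (sg v.2.2.1 + sg v.2.2.2) * F v.1 else 0) +
     ∑ v ∈ GG n, (if CC v ∧ (lx v ∧ ¬ ly v ∧ lz v) then (sg v.2.2.2 + sg v.2.1) * F v.1 else 0)) +
    ∑ v ∈ GG n, (if CC v ∧ (lx v ∧ ly v ∧ lz v) then w2 v * F v.1 else 0) := by
    simp only [← sum_add_distrib]
    refine sum_congr rfl fun v hv => ?_
    rw [mem_GG] at hv
    have hs : ∀ s : ℤ, ¬ s < v.1 → sg s = 1 := fun s hs => by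
      unfold sg; rw [if_pos]; have := hv.2.1; omega
    by_cases hC : CC v <;> by_cases h1 : lx v <;> by_cases h2 : ly v <;> by_cases h3 : lz v <;>
      simp only [hC, h1, h2, h3, true_and, false_and, and_true, and_false, and_self, not_true, not_false_iff,
        if_true, if_false, add_zero, zero_add, w2] <;>
      (try rw [hs _ h1]) <;> (try rw [hs _ h2]) <;> (try rw [hs _ h3]) <;> ring
  rw [key, a1, a2, b1, b2]; ring

theorem sg_pos {x : ℤ} (h : 0 < x) : sg x = 1 := by unfold sg; rw [if_pos h]
theorem sg_neg {x : ℤ} (h : x < 0) : sg x = -1 := by unfold sg; rw [if_neg (by omega), if_pos h]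
theorem sg_zero : sg 0 = 0 := rfl

theorem P2b {n : ℤ} (F : ℤ → ℤ) :
    ∑ v ∈ GG n, (if CC v ∧ (lx v ∧ ¬ ly v ∧ ¬ lz v) then (1 + sg v.2.1) * F v.1 else 0) =
    ∑ v ∈ GG n, (if EE v ∧ ¬ ly v ∧ ¬ lz v then (1 + sg v.2.1) * F v.1 else 0) := by
  refine sum_congr rfl fun v hv => ?_
  rw [mem_GG] at hv
  obtain ⟨t, x, y, z⟩ := v
  simp only [okk, CC, EE, lx, ly, lz] at *
  by_cases hx : x < 0
  · rw [sg_neg hx]; simp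
  · congr 1; apply propext; omega

theorem P2c {n : ℤ} (F : ℤ → ℤ) :
    ∑ v ∈ GG n, (if CC v ∧ (lx v ∧ ly v ∧ ¬ lz v) then (sg v.2.1 + sg v.2.2.1) * F v.1 else 0) =
    ∑ v ∈ GG n, (if EE v ∧ ly v ∧ ¬ lz v then sg v.2.1 * F v.1 else 0) +
    ∑ v ∈ GG n, (if EE v ∧ ¬ ly v ∧ lz v then sg v.2.1 * F v.1 else 0) := by
  have e1 : ∑ v ∈ GG n, (if CC v ∧ (lx v ∧ ly v ∧ ¬ lz v) then (sg v.2.1 + sg v.2.2.1) * F v.1 else 0) =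
     ∑ v ∈ GG n, (if EE v ∧ ly v ∧ ¬ lz v then sg v.2.1 * F v.1 else 0) +
     ∑ v ∈ GG n, (if EE v ∧ ly v ∧ ¬ lz v then sg v.2.2.1 * F v.1 else 0) := by
    rw [← sum_add_distrib]
    refine sum_congr rfl fun v hv => ?_
    rw [mem_GG] at hv
    obtain ⟨t, x, y, z⟩ := v
    simp only [okk] at hv
    dsimp only
    by_cases hx : x < 0
    · have : 0 < y := by omega
      rw [sg_neg hx, sg_pos this]; split_ifs <;> ring
    by_cases hy : y < 0
    · have : 0 < x := by omega
      rw [sg_neg hy, sg_pos this]; split_ifs <;> ring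
    have : (CC (t, x, y, z) ∧ lx (t, x, y, z) ∧ ly (t, x, y, z) ∧ ¬ lz (t, x, y, z)) ↔
      (EE (t, x, y, z) ∧ ly (t, x, y, z) ∧ ¬ lz (t, x, y, z)) := by
      simp only [CC, EE, lx, ly, lz]; omega
    simp only [this]
    split_ifs <;> ring
  have e2 := tr' (n := n) sxy sxy (fun v => EE v ∧ ly v ∧ ¬ lz v) (fun v => EE v ∧ ly v ∧ ¬ lz v)
    (fun v => sg v.2.2.1 * F v.1) (fun v => sg v.2.1 * F v.1) ?_ ?_ (fun _ => rfl) (fun _ => rfl) (fun _ _ => rfl)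
  have e3 := tr' (n := n) syz syz (fun v => EE v ∧ ly v ∧ ¬ lz v) (fun v => EE v ∧ ¬ ly v ∧ lz v)
    (fun v => sg v.2.1 * F v.1) (fun v => sg v.2.1 * F v.1) ?_ ?_ (fun _ => rfl) (fun _ => rfl) (fun _ _ => rfl)
  · rw [e1, e2, ← e3]
  all_goals
    rintro ⟨t, x, y, z⟩ h1 h2
    simp only [okk, EE, ly, lz, sxy, syz] at *
    exact ⟨⟨by rw [← h1.1]; ring, by omega⟩, by omega⟩

theorem P2d {n : ℤ} (F : ℤ → ℤ) :
    ∑ v ∈ GG n, (if CC v ∧ (lx v ∧ ly v ∧ lz v) then w2 v * F v.1 else 0) =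
    ∑ v ∈ GG n, (if EE v ∧ ly v ∧ lz v ∧ vv v then (3 * sg v.2.1 - 1) * F v.1 else 0) := by
  have e1 : ∑ v ∈ GG n, (if CC v ∧ (lx v ∧ ly v ∧ lz v) then w2 v * F v.1 else 0) =
     ∑ v ∈ GG n, (if EE v ∧ ly v ∧ lz v ∧ vv v then (sg v.2.1 - 1) * F v.1 else 0) +
     ∑ v ∈ GG n, (if EE v ∧ ly v ∧ lz v ∧ vv v then sg v.2.2.1 * F v.1 else 0) +
     ∑ v ∈ GG n, (if EE v ∧ ly v ∧ lz v ∧ vv v then sg v.2.2.2 * F v.1 else 0) := by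
    rw [← sum_add_distrib, ← sum_add_distrib]
    refine sum_congr rfl fun v hv => ?_
    rw [mem_GG] at hv
    obtain ⟨t, x, y, z⟩ := v
    simp only [okk] at hv
    dsimp only [w2]
    by_cases hv' : 0 < y + z
    swap
    · have e1 : ¬ vv (t, x, y, z) := hv'
      have e2 : ¬ CC (t, x, y, z) := fun h => hv' h.2.2.2
      simp only [e1, e2, false_and, and_false, if_false, add_zero]
    by_cases hx : x < 0
    · have h1 : 0 < y := by omega
      have h2 : 0 < z := by omega
      rw [sg_neg hx, sg_pos h1, sg_pos h2]; split_ifs <;> ring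
    by_cases hy : y < 0
    · have h1 : 0 < x := by omega
      have h2 : 0 < z := by omega
      rw [sg_neg hy, sg_pos h1, sg_pos h2]; split_ifs <;> ring
    by_cases hz : z < 0
    · have h1 : 0 < x := by omega
      have h2 : 0 < y := by omega
      rw [sg_neg hz, sg_pos h1, sg_pos h2]; split_ifs <;> ring
    have : (CC (t, x, y, z) ∧ lx (t, x, y, z) ∧ ly (t, x, y, z) ∧ lz (t, x, y, z)) ↔
      (EE (t, x, y, z) ∧ ly (t, x, y, z) ∧ lz (t, x, y, z) ∧ vv (t, x, y, z)) := by
      simp only [CC, EE, lx, ly, lz, vv]; omega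
    simp only [this]
    split_ifs <;> ring
  have e2 := tr' (n := n) sxy sxy (fun v => EE v ∧ ly v ∧ lz v ∧ vv v) (fun v => EE v ∧ ly v ∧ lz v ∧ vv v)
    (fun v => sg v.2.2.1 * F v.1) (fun v => sg v.2.1 * F v.1) ?_ ?_ (fun _ => rfl) (fun _ => rfl) (fun _ _ => rfl)
  have e3 := tr' (n := n) sxz sxz (fun v => EE v ∧ ly v ∧ lz v ∧ vv v) (fun v => EE v ∧ ly v ∧ lz v ∧ vv v)
    (fun v => sg v.2.2.2 * F v.1) (fun v => sg v.2.1 * F v.1) ?_ ?_ (fun _ => rfl) (fun _ => rfl) (fun _ _ => rfl)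
  · rw [e1, e2, e3, ← sum_add_distrib, ← sum_add_distrib]
    refine sum_congr rfl fun v hv => ?_
    split_ifs <;> ring
  all_goals
    rintro ⟨t, x, y, z⟩ h1 h2
    simp only [okk, EE, ly, lz, vv, sxy, sxz] at *
    exact ⟨⟨by rw [← h1.1]; ring, by omega⟩, by omega⟩

theorem P2e {n : ℤ} (F : ℤ → ℤ) :
    ∑ v ∈ GG n, (if EE v then sg v.2.1 * F v.1 else 0) = 0 := by
  have e2 := tr' (n := n) iot iot EE EE
    (fun v => sg v.2.1 * F v.1) (fun v => -(sg v.2.1 * F v.1)) ?_ ?_ ?_ ?_ ?_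
  · have : ∑ v ∈ GG n, (if EE v then -(sg v.2.1 * F v.1) else 0) =
      - ∑ v ∈ GG n, (if EE v then sg v.2.1 * F v.1 else 0) := by
      rw [← Finset.sum_neg_distrib]
      refine sum_congr rfl fun v hv => ?_
      split_ifs <;> ring
    linarith
  all_goals try
    rintro ⟨t, x, y, z⟩ h1 h2
    simp only [okk, EE, iot] at *
    exact ⟨⟨by rw [← h1.1]; ring, by omega⟩, by omega⟩
  · rintro ⟨t, x, y, z⟩; simp [iot]
  · rintro ⟨t, x, y, z⟩; simp [iot]
  · rintro ⟨t, x, y, z⟩ _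
    simp only [iot]
    rcases lt_trichotomy x 0 with h | rfl | h
    · rw [sg_neg h, sg_pos (by omega)]; ring
    · simp [sg_zero]
    · rw [sg_pos h, sg_neg (by omega)]; ring

theorem P2f {n : ℤ} (F : ℤ → ℤ) :
    ∑ v ∈ GG n, (if CC v then w2 v * F v.1 else 0) =
    ∑ v ∈ GG n, (if CC v ∧ (¬ lx v ∧ ¬ ly v ∧ ¬ lz v) then 2 * F v.1 else 0) +
    ∑ v ∈ GG n, (if EE v then (if ¬ ly v ∧ ¬ lz v then 3 else if ly v ∧ lz v then
      (if vv v then -1 else -3) else 0) * F v.1 else 0) := by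
  have h0 := P2e (n := n) F
  rw [P2a, P2b, P2c, P2d, ← sub_zero (∑ v ∈ GG n, ite (EE v) _ _)]
  have : ∑ v ∈ GG n, (if EE v then (if ¬ ly v ∧ ¬ lz v then 3 else if ly v ∧ lz v then
      (if vv v then -1 else -3) else 0) * F v.1 else 0) + 3 * ∑ v ∈ GG n, (if EE v then sg v.2.1 * F v.1 else 0) =
      3 * ∑ v ∈ GG n, (if EE v ∧ ¬ ly v ∧ ¬ lz v then (1 + sg v.2.1) * F v.1 else 0) +
      3 * (∑ v ∈ GG n, (if EE v ∧ ly v ∧ ¬ lz v then sg v.2.1 * F v.1 else 0) +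
    ∑ v ∈ GG n, (if EE v ∧ ¬ ly v ∧ lz v then sg v.2.1 * F v.1 else 0)) +
    ∑ v ∈ GG n, (if EE v ∧ ly v ∧ lz v ∧ vv v then (3 * sg v.2.1 - 1) * F v.1 else 0) := by
    simp only [← sum_add_distrib, mul_sum]
    refine sum_congr rfl fun v hv => ?_
    rw [mem_GG] at hv
    by_cases h : ly v ∧ lz v ∧ ¬ vv v
    · have : 0 < v.2.1 := by
        simp only [vv] at h
        have := hv.2.2.2.2.2; omega
      rw [sg_pos this]
      simp only [h, true_and, false_and, and_true, and_false, and_self, not_true, not_false_iff,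
        if_true, if_false, add_zero, zero_add]
      split_ifs <;> ring
    · by_cases h0 : EE v <;> by_cases h1 : ly v <;> by_cases h2 : lz v <;> by_cases h3 : vv v <;>
      simp only [h0, h1, h2, h3, true_and, false_and, and_true, and_false, and_self, not_true, not_false_iff,
        if_true, if_false, add_zero, zero_add] at h ⊢ <;> first | ring | exact absurd trivial h
  linarith

theorem fb_val (a b c d : ℤ) : fb (a, b, c, d) = if a ≤ 0 ∨ b ≤ 0 ∨ c ≤ 0 ∨ d ≤ 0 then 0 else
    if d ≤ b then (if d ≤ c then 1 else 0) else if d ≤ c then 0 else if b + c + a ≤ d then 3 else 2 := by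
  unfold fb fbB
  dsimp only
  by_cases h1 : a ≤ 0 <;> by_cases h2 : b ≤ 0 <;> by_cases h3 : c ≤ 0 <;> by_cases h4 : d ≤ 0 <;>
  by_cases h5 : d ≤ b <;> by_cases h6 : d ≤ c <;> by_cases h7 : b + c + a ≤ d <;> simp [h1, h2, h3, h4, h5, h6, h7]

theorem ib_val (a b c d : ℤ) : ib (a, b, c, d) = if 0 < b ∧ 0 < c ∧ b ≤ d ∧ c ≤ d ∧ d < b + c then 1 else 0 := by
  unfold ib ibB
  dsimp only
  simp only [← not_le]
  by_cases h2 : b ≤ 0 <;> by_cases h3 : c ≤ 0 <;>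
  by_cases h5 : b ≤ d <;> by_cases h6 : c ≤ d <;> by_cases h7 : b + c ≤ d <;> simp [h2, h3, h5, h6, h7]

theorem P2g {n : ℤ} (F : ℤ → ℤ) :
    ∑ v ∈ GG n, (if EE v then (if ¬ ly v ∧ ¬ lz v then 3 else if ly v ∧ lz v then
      (if vv v then -1 else -3) else 0) * F v.1 else 0) =
    ∑ q ∈ SQ n, cf (fb q) * F (q.1 + q.2.2.2) := by
  have : ∑ q ∈ SQ n, cf (fb q) * F (q.1 + q.2.2.2) =
    ∑ q ∈ SQ n with (0 < q.1 ∧ 0 < q.2.1 ∧ 0 < q.2.2.1 ∧ 0 < q.2.2.2), cf (fb q) * F (q.1 + q.2.2.2) := by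
    rw [sum_filter]
    refine sum_congr rfl fun q hq => ?_
    split_ifs with h
    · rfl
    · obtain ⟨a, b, c, d⟩ := q
      rw [fb_val, if_pos (by dsimp only at h; omega)]; simp [cf]
  rw [this, ← sum_filter]
  refine sum_nbij' (fun v => ((v.1 - v.2.1) / 2, (v.2.1 + v.2.2.1) / 2, (v.2.1 + v.2.2.2) / 2, (v.1 + v.2.1) / 2))
    (fun q => (q.1 + q.2.2.2, q.2.2.2 - q.1, 2 * q.2.1 - (q.2.2.2 - q.1), 2 * q.2.2.1 - (q.2.2.2 - q.1))) ?_ ?_ ?_ ?_ ?_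
  · rintro ⟨t, x, y, z⟩ hv
    simp only [mem_filter, mem_GG, mem_SQ] at *
    simp only [okk, EE] at *
    obtain ⟨⟨h1, h2, h3, h4, h5, h6, h7, -⟩, h8⟩ := hv
    obtain ⟨a, ha⟩ : ∃ a, (t - x) / 2 = a := ⟨_, rfl⟩
    obtain ⟨d, hd⟩ : ∃ d, (t + x) / 2 = d := ⟨_, rfl⟩
    obtain ⟨b, hb⟩ : ∃ b, (x + y) / 2 = b := ⟨_, rfl⟩
    obtain ⟨c, hc⟩ : ∃ c, (x + z) / 2 = c := ⟨_, rfl⟩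
    rw [ha, hb, hc, hd]
    obtain rfl : t = a + d := by omega
    obtain rfl : x = d - a := by omega
    obtain rfl : y = 2 * b - (d - a) := by omega
    obtain rfl : z = 2 * c - (d - a) := by omega
    have e : a * d + b * c = n := by linarith
    have ha : 0 < a := by omega
    have hb : 0 < b := by omega
    have hc : 0 < c := by omega
    have hd : 0 < d := by omega
    have : a ≤ n := by nlinarith
    have : b ≤ n := by nlinarith
    have : c ≤ n := by nlinarith
    have : d ≤ n := by nlinarith
    omega
  · rintro ⟨a, b, c, d⟩ hq
    simp only [mem_filter, mem_GG, mem_SQ] at *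
    simp only [okk, EE] at *
    obtain ⟨⟨h1, h2⟩, h3⟩ := hq
    refine ⟨⟨by rw [← h2]; ring, ?_⟩, ?_⟩ <;> omega
  · rintro ⟨t, x, y, z⟩ hv
    simp only [mem_filter, mem_GG, okk, Prod.mk.injEq] at *
    omega
  · rintro ⟨a, b, c, d⟩ hq
    simp only [Prod.mk.injEq]
    omega
  · rintro ⟨t, x, y, z⟩ hv
    simp only [mem_filter, mem_GG] at hv
    simp only [okk, EE] at hv
    obtain ⟨⟨h1, h2, h3, h4, h5, h6, h7, -⟩, h8⟩ := hv
    dsimp only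
    rw [show (t - x) / 2 + (t + x) / 2 = t by omega, fb_val]
    have h0 : ¬ ((t - x) / 2 ≤ 0 ∨ (x + y) / 2 ≤ 0 ∨ (x + z) / 2 ≤ 0 ∨ (t + x) / 2 ≤ 0) := by omega
    rw [if_neg h0]
    congr 1
    have e1 : ly (t, x, y, z) ↔ ¬ ((t + x) / 2 ≤ (x + y) / 2) := by simp only [ly]; omega
    have e2 : lz (t, x, y, z) ↔ ¬ ((t + x) / 2 ≤ (x + z) / 2) := by simp only [lz]; omega
    have e3 : vv (t, x, y, z) ↔ ¬ ((x + y) / 2 + (x + z) / 2 + (t - x) / 2 ≤ (t + x) / 2) := by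
      simp only [vv]; omega
    simp only [e1, e2, e3]
    by_cases g1 : (t + x) / 2 ≤ (x + y) / 2 <;> by_cases g2 : (t + x) / 2 ≤ (x + z) / 2 <;>
    by_cases g3 : (x + y) / 2 + (x + z) / 2 + (t - x) / 2 ≤ (t + x) / 2 <;> simp [g1, g2, g3, cf]

theorem P2h {n : ℤ} (F : ℤ → ℤ) :
    ∑ v ∈ GG n, (if CC v ∧ (¬ lx v ∧ ¬ ly v ∧ ¬ lz v) then 2 * F v.1 else 0) =
    ∑ q ∈ SQ n, 2 * (ib q : ℤ) * F (q.2.1 + q.2.2.1 - q.2.2.2) := by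
  have : ∑ q ∈ SQ n, 2 * (ib q : ℤ) * F (q.2.1 + q.2.2.1 - q.2.2.2) =
    ∑ q ∈ SQ n with (0 < q.2.1 ∧ 0 < q.2.2.1 ∧ q.2.1 ≤ q.2.2.2 ∧ q.2.2.1 ≤ q.2.2.2 ∧ q.2.2.2 < q.2.1 + q.2.2.1),
       2 * F (q.2.1 + q.2.2.1 - q.2.2.2) := by
    rw [sum_filter]
    refine sum_congr rfl fun q hq => ?_
    obtain ⟨a, b, c, d⟩ := q
    rw [ib_val]
    dsimp only
    split_ifs with h
    · simp
    · simp
  rw [this, ← sum_filter]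
  refine sum_nbij' (fun v => ((v.2.2.1 - v.1) / 2, (v.1 + v.2.1) / 2, (v.1 + v.2.2.2) / 2, (v.2.1 + v.2.2.2) / 2))
    (fun q => (q.2.1 + q.2.2.1 - q.2.2.2, q.2.2.2 + q.2.1 - q.2.2.1, 2 * q.1 + (q.2.1 + q.2.2.1 - q.2.2.2),
      q.2.2.2 - q.2.1 + q.2.2.1)) ?_ ?_ ?_ ?_ ?_
  · rintro ⟨t, x, y, z⟩ hv
    simp only [mem_filter, mem_GG, mem_SQ] at *
    simp only [okk, CC, lx, ly, lz] at *
    obtain ⟨⟨h1, h2, h3, h4, h5, h6, h7, -⟩, h8, h9⟩ := hv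
    obtain ⟨a, ha⟩ : ∃ a, (y - t) / 2 = a := ⟨_, rfl⟩
    obtain ⟨d, hd⟩ : ∃ d, (x + z) / 2 = d := ⟨_, rfl⟩
    obtain ⟨b, hb⟩ : ∃ b, (t + x) / 2 = b := ⟨_, rfl⟩
    obtain ⟨c, hc⟩ : ∃ c, (t + z) / 2 = c := ⟨_, rfl⟩
    rw [ha, hb, hc, hd]
    obtain rfl : t = b + c - d := by omega
    obtain rfl : x = d + b - c := by omega
    obtain rfl : y = 2 * a + (b + c - d) := by omega
    obtain rfl : z = d - b + c := by omega
    have e : a * d + b * c = n := by linarith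
    have ha : 0 ≤ a := by omega
    have hb : 0 < b := by omega
    have hc : 0 < c := by omega
    have hd : 0 < d := by omega
    have : a ≤ n := by nlinarith
    have : b ≤ n := by nlinarith
    have : c ≤ n := by nlinarith
    have : d ≤ 2 * n := by omega
    omega
  · rintro ⟨a, b, c, d⟩ hq
    simp only [mem_filter, mem_GG, mem_SQ] at *
    simp only [okk, CC, lx, ly, lz] at *
    obtain ⟨⟨h1, h2⟩, h3⟩ := hq
    refine ⟨⟨by rw [← h2]; ring, ?_⟩, ?_⟩ <;> omega
  · rintro ⟨t, x, y, z⟩ hv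
    simp only [mem_filter, mem_GG, okk, Prod.mk.injEq] at *
    omega
  · rintro ⟨a, b, c, d⟩ hq
    simp only [Prod.mk.injEq]
    omega
  · rintro ⟨t, x, y, z⟩ hv
    simp only [mem_filter, mem_GG, okk] at hv
    dsimp only
    congr 2; omega

theorem P2 {n : ℤ} (F : ℤ → ℤ) :
    ∑ v ∈ GG n, (if CC v then w2 v * F v.1 else 0) =
    ∑ q ∈ SQ n, (cf (fb q) * F (q.1 + q.2.2.2) + 2 * (ib q : ℤ) * F (q.2.1 + q.2.2.1 - q.2.2.2)) := by
  rw [P2f, P2g, P2h, sum_add_distrib, add_comm]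

abbrev SL2 := Matrix.SpecialLinearGroup (Fin 2) ℤ

/-- action of an integer quadruple `(α,β,γ,δ)` (rows) -/
def qact (g : ℤ × ℤ × ℤ × ℤ) (Q : ℤ × ℤ × ℤ) : ℤ × ℤ × ℤ :=
  (formEval Q g.1 g.2.2.1, formEval Q (g.1 + g.2.1) (g.2.2.1 + g.2.2.2) - formEval Q g.1 g.2.2.1
    - formEval Q g.2.1 g.2.2.2, formEval Q g.2.1 g.2.2.2)

def ent (g : SL2) : ℤ × ℤ × ℤ × ℤ := (g.1 0 0, g.1 0 1, g.1 1 0, g.1 1 1)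

theorem qact_ent (g : SL2) (Q) : qact (ent g) Q = formAct g Q := rfl

def dt (g : ℤ × ℤ × ℤ × ℤ) : ℤ := g.1 * g.2.2.2 - g.2.1 * g.2.2.1

def ofE (q : ℤ × ℤ × ℤ × ℤ) (h : dt q = 1) : SL2 :=
  ⟨!![q.1, q.2.1; q.2.2.1, q.2.2.2], by rw [Matrix.det_fin_two_of]; exact h⟩

theorem ent_ofE (q h) : ent (ofE q h) = q := by
  simp [ent, ofE]

theorem det_ent (g : SL2) : dt (ent g) = 1 := by
  have := g.2
  rw [Matrix.det_fin_two] at this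
  exact this

theorem ent_inj {g h : SL2} (e : ent g = ent h) : g = h := by
  simp only [ent, Prod.mk.injEq] at e
  apply Subtype.ext
  ext i j
  fin_cases i <;> fin_cases j <;> simp [e]

theorem act_act (g h : SL2) (Q) : formAct g (formAct h Q) = formAct (h * g) Q := by
  obtain ⟨a, b, c⟩ := Q
  simp only [formAct, formEval, Matrix.SpecialLinearGroup.coe_mul, Matrix.mul_apply, Fin.sum_univ_two, Prod.mk.injEq]
  refine ⟨?_, ?_, ?_⟩ <;> ring

theorem act_one (Q) : formAct 1 Q = Q := by
  obtain ⟨a, b, c⟩ := Q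
  simp only [formAct, formEval, Matrix.SpecialLinearGroup.coe_one, Matrix.one_apply_eq, Matrix.one_apply_ne, ne_eq, one_ne_zero, zero_ne_one, not_false_iff, Prod.mk.injEq]
  refine ⟨?_, ?_, ?_⟩ <;> ring

theorem act_inv {g : SL2} {Q R} (h : formAct g Q = R) : formAct g⁻¹ R = Q := by
  rw [← h, act_act, mul_inv_cancel, act_one]

theorem disc_qact (g Q) (h : dt g = 1) : formDisc (qact g Q) = formDisc Q := by
  obtain ⟨a, b, c⟩ := Q
  obtain ⟨p, q, r, s⟩ := g
  dsimp only [dt] at h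
  have : formDisc (qact (p, q, r, s) (a, b, c)) = (p * s - q * r) ^ 2 * formDisc (a, b, c) := by
    simp only [formDisc, qact, formEval]; ring
  rw [this, h]; ring

theorem disc_act (g Q) : formDisc (formAct g Q) = formDisc Q := disc_qact (ent g) Q (det_ent g)

theorem eval_pos {Q} (h : IsPosDef Q) {x y : ℤ} (hxy : x ≠ 0 ∨ y ≠ 0) : 0 < formEval Q x y := by
  obtain ⟨a, b, c⟩ := Q
  obtain ⟨h1, h2⟩ := h
  simp only [formDisc, formEval] at *
  have e : 4 * a * (a * x ^ 2 + b * x * y + c * y ^ 2) = (2 * a * x + b * y) ^ 2 + -(b ^ 2 - 4 * a * c) * y ^ 2 := by ring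
  have : 0 < 4 * a * (a * x ^ 2 + b * x * y + c * y ^ 2) := by
    rw [e]
    by_cases hy : y = 0
    · subst hy
      have hx : x ≠ 0 := by tauto
      have : 0 < (2 * a * x) ^ 2 := by positivity
      simpa using this
    · have : 0 < y ^ 2 := by positivity
      nlinarith [sq_nonneg (2 * a * x + b * y)]
  exact pos_of_mul_pos_right this (by omega)

theorem pd_act {Q} (h : IsPosDef Q) (g) : IsPosDef (formAct g Q) := by
  refine ⟨eval_pos h ?_, by rw [disc_act]; exact h.2⟩
  by_contra! hh
  have := det_ent g
  simp only [dt, ent, hh.1, hh.2] at this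
  simp at this

def TF (Q : ℤ × ℤ × ℤ) : ℤ := 2 * Q.1 + Q.2.1 + 2 * Q.2.2

theorem TF_pos {Q} (h : IsPosDef Q) : 0 < TF Q := by
  have h1 := eval_pos h (x := 1) (y := 0) (by simp)
  have h2 := eval_pos h (x := 0) (y := 1) (by simp)
  have h3 := eval_pos h (x := 1) (y := 1) (by simp)
  simp only [formEval, TF] at *
  linarith

def WC (Q : ℤ × ℤ × ℤ) : Prop := Q.2.1 ≤ 0 ∧ 0 ≤ 2 * Q.1 + Q.2.1 ∧ 0 ≤ 2 * Q.2.2 + Q.2.1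
instance : DecidablePred WC := fun Q => by unfold WC; infer_instance

theorem exists_WC (k : ℕ) : ∀ Q, IsPosDef Q → TF Q ≤ k → ∃ g, WC (formAct g Q) := by
  induction k with
  | zero => intro Q h1 h2; have := TF_pos h1; simp at h2; omega
  | succ k ih =>
    intro Q hQ hT
    by_cases hW : WC Q
    · exact ⟨1, by rwa [act_one]⟩
    have step : ∀ g : SL2, TF (formAct g Q) < TF Q → ∃ g, WC (formAct g Q) := by
      intro g hg
      obtain ⟨g', h'⟩ := ih (formAct g Q) (pd_act hQ g) (by push_cast at hT; omega)
      exact ⟨g * g', by rwa [← act_act]⟩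
    obtain ⟨a, b, c⟩ := Q
    simp only [WC] at hW
    by_cases h1 : 0 < b
    · apply step (ofE (0, -1, 1, 0) (by norm_num [dt]))
      rw [← qact_ent, ent_ofE]
      simp only [TF, qact, formEval]; nlinarith
    by_cases h2 : 2 * a + b < 0
    · apply step (ofE (1, 1, 0, 1) (by norm_num [dt]))
      rw [← qact_ent, ent_ofE]
      simp only [TF, qact, formEval]; nlinarith
    · have h3 : 2 * c + b < 0 := by omega
      apply step (ofE (1, 0, 1, 1) (by norm_num [dt]))
      rw [← qact_ent, ent_ofE]
      simp only [TF, qact, formEval]; nlinarith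

def nrm (p q : ℤ) : ℤ := p ^ 2 + p * q + q ^ 2

theorem TF_qact (g Q) : TF (qact g Q) = -Q.2.1 * nrm (g.1 - g.2.2.1) (g.2.1 - g.2.2.2) +
   (2 * Q.1 + Q.2.1) * nrm g.1 g.2.1 + (2 * Q.2.2 + Q.2.1) * nrm g.2.2.1 g.2.2.2 := by
  obtain ⟨a, b, c⟩ := Q
  obtain ⟨p, q, r, s⟩ := g
  simp only [TF, qact, formEval, nrm]; ring

theorem nrm_pos {p q : ℤ} (h : p ≠ 0 ∨ q ≠ 0) : 1 ≤ nrm p q := by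
  unfold nrm
  have : 0 < 4 * (p ^ 2 + p * q + q ^ 2) := by
    have e : 4 * (p ^ 2 + p * q + q ^ 2) = (2 * p + q) ^ 2 + 3 * q ^ 2 := by ring
    rw [e]
    by_cases hq : q = 0
    · subst hq
      have : p ≠ 0 := by tauto
      have : 0 < p ^ 2 := by positivity
      nlinarith
    · have : 0 < q ^ 2 := by positivity
      nlinarith [sq_nonneg (2 * p + q)]
  omega

theorem nrm_one {p q : ℤ} (h : nrm p q = 1) : -1 ≤ p ∧ p ≤ 1 ∧ -1 ≤ q ∧ q ≤ 1 := by
  unfold nrm at h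
  refine ⟨?_, ?_, ?_, ?_⟩ <;> nlinarith [sq_nonneg (2 * p + q), sq_nonneg (2 * q + p)]


theorem three_nrm {g} (h : dt g = 1) : 1 ≤ nrm (g.1 - g.2.2.1) (g.2.1 - g.2.2.2) ∧ 1 ≤ nrm g.1 g.2.1 ∧
    1 ≤ nrm g.2.2.1 g.2.2.2 := by
  obtain ⟨p, q, r, s⟩ := g
  simp only [dt] at *
  refine ⟨nrm_pos ?_, nrm_pos ?_, nrm_pos ?_⟩ <;> by_contra! hh <;> obtain ⟨h1, h2⟩ := hh
  · obtain rfl : p = r := by omega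
    obtain rfl : q = s := by omega
    apply absurd h; ring_nf; omega
  · subst h1 h2; omega
  · subst h1 h2; omega

theorem TF_le {Q} (hW : WC Q) {g} (h : dt g = 1) : TF Q ≤ TF (qact g Q) := by
  obtain ⟨h1, h2, h3⟩ := three_nrm h
  obtain ⟨g1, g2, g3⟩ := hW
  rw [TF_qact]
  unfold TF
  nlinarith

theorem TF_eq {Q} (hW : WC Q) {g} (h : dt g = 1) (hW' : WC (qact g Q)) : TF (qact g Q) = TF Q := by
  apply le_antisymm _ (TF_le hW h)
  have e : ent (ofE g h) = g := ent_ofE g h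
  have h2 : formAct (ofE g h)⁻¹ (qact g Q) = Q := act_inv (by rw [← qact_ent, e])
  have := TF_le (Q := qact g Q) hW' (g := ent (ofE g h)⁻¹) (det_ent _)
  rwa [qact_ent, h2] at this

/-- norm condition -/
def NC (Q : ℤ × ℤ × ℤ) (g : ℤ × ℤ × ℤ × ℤ) : Prop :=
  (Q.2.1 < 0 → nrm (g.1 - g.2.2.1) (g.2.1 - g.2.2.2) = 1) ∧ (0 < 2 * Q.1 + Q.2.1 → nrm g.1 g.2.1 = 1) ∧
   (0 < 2 * Q.2.2 + Q.2.1 → nrm g.2.2.1 g.2.2.2 = 1)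

theorem NC_of {Q} (hW : WC Q) {g} (h : dt g = 1) (hW' : WC (qact g Q)) : NC Q g := by
  have e := TF_eq hW h hW'
  rw [TF_qact] at e
  unfold TF at e
  obtain ⟨h1, h2, h3⟩ := three_nrm h
  obtain ⟨g1, g2, g3⟩ := hW
  refine ⟨fun hh => ?_, fun hh => ?_, fun hh => ?_⟩ <;> apply le_antisymm _ (by assumption) <;> nlinarith

def K0 : Finset V4 := {(-1, 0, 0, -1), (-1, 1, -1, 0), (0, -1, 1, -1), (0, 1, -1, 1), (1, -1, 1, 0), (1, 0, 0, 1)}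
def K1 : Finset V4 := {(-1, 0, 0, -1), (-1, 0, 1, -1), (-1, 1, -1, 0), (-1, 1, 0, -1), (0, -1, 1, -1), (0, -1, 1, 0), (0, 1, -1, 0), (0, 1, -1, 1), (1, -1, 0, 1), (1, -1, 1, 0), (1, 0, -1, 1), (1, 0, 0, 1)}
def K2 : Finset V4 := {(-2, 1, -1, 0), (-1, -1, 0, -1), (-1, 0, 0, -1), (-1, 1, -1, 0), (-1, 2, -1, 1), (0, -1, 1, -1), (0, 1, -1, 1), (1, -2, 1, -1), (1, -1, 1, 0), (1, 0, 0, 1), (1, 1, 0, 1), (2, -1, 1, 0)}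
def K3 : Finset V4 := {(-1, 0, -1, -1), (-1, 0, 0, -1), (-1, 1, -2, 1), (-1, 1, -1, 0), (0, -1, 1, -2), (0, -1, 1, -1), (0, 1, -1, 1), (0, 1, -1, 2), (1, -1, 1, 0), (1, -1, 2, -1), (1, 0, 0, 1), (1, 0, 1, 1)}
noncomputable def BX : Finset V4 := (Icc (-2) 2 ×ˢ Icc (-2) 2 ×ˢ Icc (-2) 2 ×ˢ Icc (-2) 2).filter
  fun g => dt g = 1
instance (g : V4) (k : ℤ) : Decidable (dt g = k) := inferInstance
def nn1 (g : V4) : Prop := nrm (g.1 - g.2.2.1) (g.2.1 - g.2.2.2) = 1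
def nn2 (g : V4) : Prop := nrm g.1 g.2.1 = 1
def nn3 (g : V4) : Prop := nrm g.2.2.1 g.2.2.2 = 1
instance : DecidablePred nn1 := fun g => by unfold nn1; infer_instance
instance : DecidablePred nn2 := fun g => by unfold nn2; infer_instance
instance : DecidablePred nn3 := fun g => by unfold nn3; infer_instance
theorem BK0 : BX.filter (fun g => nn1 g ∧ nn2 g ∧ nn3 g) = K0 := by decide +kernel
theorem BK1 : BX.filter (fun g => nn2 g ∧ nn3 g) = K1 := by decide +kernel
theorem BK2 : BX.filter (fun g => nn1 g ∧ nn3 g) = K2 := by decide +kernel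
theorem BK3 : BX.filter (fun g => nn1 g ∧ nn2 g) = K3 := by decide +kernel

def wQ (Q : ℤ × ℤ × ℤ) : ℤ := sg (-Q.2.1) + sg (2 * Q.1 + Q.2.1) + sg (2 * Q.2.2 + Q.2.1) - 1
def uQ (Q : ℤ × ℤ × ℤ) : ℤ := if WC Q then wQ Q else 0

theorem mem_BX {g : V4} : g ∈ BX ↔ (((-2 ≤ g.1 ∧ g.1 ≤ 2) ∧ (-2 ≤ g.2.1 ∧ g.2.1 ≤ 2) ∧
    (-2 ≤ g.2.2.1 ∧ g.2.2.1 ≤ 2) ∧ (-2 ≤ g.2.2.2 ∧ g.2.2.2 ≤ 2)) ∧ dt g = 1) := by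
  simp [BX]

theorem in_BX {Q} (hp : IsPosDef Q) (hW : WC Q) {g} (h : dt g = 1) (hW' : WC (qact g Q)) : g ∈ BX := by
  obtain ⟨h1, h2, h3⟩ := NC_of hW h hW'
  have a1 := eval_pos hp (x := 1) (y := 0) (by simp)
  have a2 := eval_pos hp (x := 0) (y := 1) (by simp)
  have a3 := eval_pos hp (x := 1) (y := 1) (by simp)
  simp only [formEval] at a1 a2 a3
  rw [mem_BX]
  refine ⟨?_, h⟩
  obtain ⟨g1, g2, g3⟩ := hW
  by_cases c2 : 0 < 2 * Q.1 + Q.2.1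
  · have := nrm_one (h2 c2)
    by_cases c3 : 0 < 2 * Q.2.2 + Q.2.1
    · have := nrm_one (h3 c3); omega
    · have := nrm_one (h1 (by linarith)); omega
  · have := nrm_one (h1 (by linarith))
    have := nrm_one (h3 (by linarith))
    omega

theorem uQ_two {a b c : ℤ} (h1 : b < 0) (h2 : 0 < 2 * a + b) (h3 : 0 < 2 * c + b) : uQ (a, b, c) = 2 := by
  unfold uQ
  rw [if_pos ⟨by dsimp only; omega, by dsimp only; omega, by dsimp only; omega⟩]
  simp only [wQ]
  rw [sg_pos (by omega), sg_pos h2, sg_pos h3]; norm_num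

theorem uQ_one {a b c : ℤ} (h : (b = 0 ∧ 0 < a ∧ 0 < c) ∨ (b < 0 ∧ 2 * a + b = 0 ∧ 0 < 2 * c + b) ∨
    (b < 0 ∧ 2 * c + b = 0 ∧ 0 < 2 * a + b)) : uQ (a, b, c) = 1 := by
  unfold uQ
  rw [if_pos ⟨by dsimp only; omega, by dsimp only; omega, by dsimp only; omega⟩]
  simp only [wQ]
  rcases h with ⟨h1, h2, h3⟩ | ⟨h1, h2, h3⟩ | ⟨h1, h2, h3⟩
  · rw [h1, sg_pos (by omega : 0 < 2 * a + 0), sg_pos (by omega : 0 < 2 * c + 0), neg_zero, sg_zero]; norm_num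
  · rw [sg_pos (by omega), h2, sg_zero, sg_pos h3]; norm_num
  · rw [sg_pos (by omega), h2, sg_zero, sg_pos h3]; norm_num

theorem twelve {Q} (hp : IsPosDef Q) (hW : WC Q) : ∑ g ∈ BX, uQ (qact g Q) = 12 := by
  have a1 := eval_pos hp (x := 1) (y := 0) (by simp)
  have a2 := eval_pos hp (x := 0) (y := 1) (by simp)
  have a3 := eval_pos hp (x := 1) (y := 1) (by simp)
  have red : ∀ (P : V4 → Prop) [DecidablePred P], (∀ g, NC Q g → P g) →
      ∑ g ∈ BX, uQ (qact g Q) = ∑ g ∈ BX with P g, uQ (qact g Q) := by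
    intro P _ hP
    rw [sum_filter]
    refine sum_congr rfl fun g hg => ?_
    split_ifs with h
    · rfl
    · unfold uQ
      rw [if_neg]
      intro hW'
      exact h (hP g (NC_of hW (mem_BX.1 hg).2 hW'))
  obtain ⟨a, b, c⟩ := Q
  simp only [formEval] at a1 a2 a3
  obtain ⟨g1, g2, g3⟩ := hW
  dsimp only at g1 g2 g3
  by_cases c1 : b < 0
  · by_cases c2 : 0 < 2 * a + b
    · by_cases c3 : 0 < 2 * c + b
      · rw [red (fun g => nn1 g ∧ nn2 g ∧ nn3 g) (fun g h => ⟨h.1 c1, h.2.1 c2, h.2.2 c3⟩), BK0]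
        have : ∀ g ∈ K0, uQ (qact g (a, b, c)) = 2 := by
          intro g hg
          simp only [K0, Finset.mem_insert, mem_singleton] at hg
          rcases hg with rfl | rfl | rfl | rfl | rfl | rfl <;> simp only [qact, formEval] <;>
            apply uQ_two <;> linarith
        rw [sum_congr rfl this]; rfl
      · rw [red (fun g => nn1 g ∧ nn2 g) (fun g h => ⟨h.1 c1, h.2.1 c2⟩), BK3]
        have : ∀ g ∈ K3, uQ (qact g (a, b, c)) = 1 := by
          intro g hg
          simp only [K3, Finset.mem_insert, mem_singleton] at hg
          obtain rfl : b = - 2 * c := by linarith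
          rcases hg with rfl | rfl | rfl | rfl | rfl | rfl | rfl | rfl | rfl | rfl | rfl | rfl <;>
           simp only [qact, formEval] <;> apply uQ_one <;> first | exact Or.inl ⟨by linarith, by linarith, by linarith⟩ | exact Or.inr (Or.inl ⟨by linarith, by linarith, by linarith⟩) | exact Or.inr (Or.inr ⟨by linarith, by linarith, by linarith⟩)
        rw [sum_congr rfl this]; rfl
    · rw [red (fun g => nn1 g ∧ nn3 g) (fun g h => ⟨h.1 c1, h.2.2 (by dsimp only; linarith)⟩), BK2]
      have : ∀ g ∈ K2, uQ (qact g (a, b, c)) = 1 := by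
        intro g hg
        simp only [K2, Finset.mem_insert, mem_singleton] at hg
        obtain rfl : b = - 2 * a := by linarith
        rcases hg with rfl | rfl | rfl | rfl | rfl | rfl | rfl | rfl | rfl | rfl | rfl | rfl <;>
          simp only [qact, formEval] <;> apply uQ_one <;> first | exact Or.inl ⟨by linarith, by linarith, by linarith⟩ | exact Or.inr (Or.inl ⟨by linarith, by linarith, by linarith⟩) | exact Or.inr (Or.inr ⟨by linarith, by linarith, by linarith⟩)
      rw [sum_congr rfl this]; rfl
  · obtain rfl : b = 0 := by omega
    rw [red (fun g => nn2 g ∧ nn3 g) (fun g h => ⟨h.2.1 (by dsimp only; linarith), h.2.2 (by dsimp only; linarith)⟩), BK1]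
    have : ∀ g ∈ K1, uQ (qact g (a, 0, c)) = 1 := by
      intro g hg
      simp only [K1, Finset.mem_insert, mem_singleton] at hg
      rcases hg with rfl | rfl | rfl | rfl | rfl | rfl | rfl | rfl | rfl | rfl | rfl | rfl <;>
        simp only [qact, formEval] <;> apply uQ_one <;> first | exact Or.inl ⟨by linarith, by linarith, by linarith⟩ | exact Or.inr (Or.inl ⟨by linarith, by linarith, by linarith⟩) | exact Or.inr (Or.inr ⟨by linarith, by linarith, by linarith⟩)
    rw [sum_congr rfl this]; rfl

open Classical in
noncomputable def WF (N : ℤ) : Finset (ℤ × ℤ × ℤ) :=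
  (Icc (-N) N ×ˢ Icc (-N) N ×ˢ Icc (-N) N).filter
    fun Q => formDisc Q = -N ∧ IsPosDef Q ∧ WC Q

open Classical in
theorem mem_WF {N : ℤ} {Q} : Q ∈ WF N ↔ (formDisc Q = -N ∧ IsPosDef Q ∧ WC Q) := by
  unfold WF
  rw [mem_filter, and_iff_right_iff_imp]
  rintro ⟨h1, h2, h3⟩
  have a1 := eval_pos h2 (x := 1) (y := 0) (by simp)
  have a2 := eval_pos h2 (x := 0) (y := 1) (by simp)
  have a3 := eval_pos h2 (x := 1) (y := 1) (by simp)
  obtain ⟨a, b, c⟩ := Q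
  simp only [formEval, formDisc] at a1 a2 a3 h1
  obtain ⟨g1, g2, g3⟩ := h3
  dsimp only at g1 g2 g3
  simp only [mem_product, mem_Icc]
  have e : (-b) * (2 * a + b) + (2 * a + b) * (2 * c + b) + (2 * c + b) * (-b) = N := by linarith
  obtain ⟨x, hx⟩ : ∃ x, -b = x := ⟨_, rfl⟩
  obtain ⟨y, hy⟩ : ∃ y, 2 * a + b = y := ⟨_, rfl⟩
  obtain ⟨z, hz⟩ : ∃ z, 2 * c + b = z := ⟨_, rfl⟩
  rw [hx, hy, hz] at e
  have : 0 ≤ x := by omega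
  have : 0 ≤ y := by omega
  have : 0 ≤ z := by omega
  have : 0 ≤ x * y := by positivity
  have : 0 ≤ y * z := by positivity
  have : 0 ≤ z * x := by positivity
  have : x ≤ N := by nlinarith
  have : y ≤ N := by nlinarith
  have : z ≤ N := by nlinarith
  omega

abbrev XF (N : ℤ) := {Q : ℤ × ℤ × ℤ // formDisc Q = -N ∧ IsPosDef Q}

def cl {N : ℤ} (Q : XF N) : FormClasses N := Quot.mk _ Q

theorem cl_eq {N : ℤ} {Q R : XF N} : cl Q = cl R ↔ ∃ g, formAct g Q.1 = R.1 := by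
  unfold cl
  constructor
  · intro h
    have h' := Quot.eqvGen_exact h
    have heq : Equivalence (fun (Q Q' : XF N) => ∃ γ : Matrix.SpecialLinearGroup (Fin 2) ℤ, formAct γ Q.1 = Q'.1) :=
      ⟨fun Q => ⟨1, act_one _⟩, fun ⟨g, h⟩ => ⟨g⁻¹, act_inv h⟩, fun ⟨g, h⟩ ⟨g', h'⟩ => ⟨g * g', by rw [← act_act, h, h']⟩⟩
    exact heq.eqvGen_iff.1 h'
  · intro h; exact Quot.sound h

theorem cl_out {N : ℤ} (c : FormClasses N) : cl c.out = c := Quot.out_eq c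

theorem card_trans {P Q R : ℤ × ℤ × ℤ} (h k : SL2) (hh : formAct h P = Q) (hk : formAct k P = R) :
    Nat.card {g : SL2 // formAct g Q = R} = Nat.card {g : SL2 // formAct g P = P} := by
  refine Nat.card_congr ⟨fun g => ⟨h * g.1 * k⁻¹, ?_⟩, fun g => ⟨h⁻¹ * g.1 * k, ?_⟩, ?_, ?_⟩
  · rw [← act_act, ← act_act, hh, g.2, act_inv hk]
  · rw [← act_act, ← act_act, act_inv hh, g.2, hk]
  · intro g; apply Subtype.ext; dsimp only; group
  · intro g; apply Subtype.ext; dsimp only; group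

theorem card_BX {Q R : ℤ × ℤ × ℤ} (hp : IsPosDef Q) (hW : WC Q) (hR : WC R) :
    (BX.filter (fun g => qact g Q = R)).card = Nat.card {g : SL2 // formAct g Q = R} := by
  rw [← Fintype.card_coe, ← Nat.card_eq_fintype_card]
  refine Nat.card_congr ⟨fun g => ⟨ofE g.1 (mem_BX.1 (mem_filter.1 g.2).1).2, ?_⟩, fun g => ⟨ent g.1, ?_⟩, ?_, ?_⟩
  · rw [← qact_ent, ent_ofE]; exact (mem_filter.1 g.2).2
  · rw [mem_filter]
    have : qact (ent g.1) Q = R := by rw [qact_ent]; exact g.2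
    exact ⟨in_BX hp hW (det_ent _) (by rwa [this]), this⟩
  · intro g; apply Subtype.ext; exact ent_ofE g.1 (mem_BX.1 (mem_filter.1 g.2).1).2
  · intro g; apply Subtype.ext; apply ent_inj; exact ent_ofE (ent g.1) (det_ent g.1)

noncomputable def st {N : ℤ} (c : FormClasses N) : ℕ :=
  Nat.card {γ : Matrix.SpecialLinearGroup (Fin 2) ℤ // formAct γ c.out.1 = c.out.1}

open Classical in
theorem class_sum {N : ℤ} (c : FormClasses N) :
    (st c : ℤ) * ∑ R ∈ WF N, (if ∃ g, formAct g c.out.1 = R then wQ R else 0) = 12 := by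
  obtain ⟨h, hh⟩ := exists_WC (TF c.out.1).toNat c.out.1 c.out.2.2 (by omega)
  have hp := pd_act c.out.2.2 h
  have hd : formDisc (formAct h c.out.1) = -N := by rw [disc_act]; exact c.out.2.1
  rw [← twelve hp hh, mul_sum]
  generalize hQ : formAct h c.out.1 = Q at *
  have e1 : ∀ g ∈ BX, uQ (qact g Q) = ∑ R ∈ WF N, if qact g Q = R then wQ R else 0 := by
    intro g hg
    rw [Finset.sum_ite_eq]
    unfold uQ
    congr 1
    rw [mem_WF, disc_qact _ _ (mem_BX.1 hg).2, ← ent_ofE g (mem_BX.1 hg).2, qact_ent]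
    simp [hd, pd_act hp]
  rw [sum_congr rfl e1, Finset.sum_comm]
  refine sum_congr rfl fun R hR => ?_
  rw [mem_WF] at hR
  rw [← sum_filter, Finset.sum_const, card_BX hp hh hR.2.2, nsmul_eq_mul]
  split_ifs with hk
  · obtain ⟨k, hk⟩ := hk
    rw [card_trans h k hQ hk]; rfl
  · have : IsEmpty {g : SL2 // formAct g Q = R} := ⟨fun g => hk ⟨h * g.1, by rw [← act_act, hQ, g.2]⟩⟩
    simp

open Classical in
theorem H_eq {N : ℤ} (hN : 0 < N) : 6 * hurwitzClassNumber N = ((∑ R ∈ WF N, wQ R : ℤ) : ℝ) := by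
  have hfin : Finite (FormClasses N) := by
    have : Function.Surjective (fun R : WF N => cl (N := N) ⟨R.1, (mem_WF.1 R.2).1, (mem_WF.1 R.2).2.1⟩) := by
      intro c
      obtain ⟨h, hh⟩ := exists_WC (TF c.out.1).toNat c.out.1 c.out.2.2 (by omega)
      refine ⟨⟨formAct h c.out.1, mem_WF.2 ⟨by rw [disc_act]; exact c.out.2.1, pd_act c.out.2.2 h, hh⟩⟩, ?_⟩
      conv_rhs => rw [← cl_out c]
      exact cl_eq.2 ⟨h⁻¹, act_inv rfl⟩
    exact Finite.of_surjective _ this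
  have := Fintype.ofFinite (FormClasses N)
  unfold hurwitzClassNumber
  rw [if_neg hN.ne', finsum_eq_sum_of_fintype, mul_sum]
  have e1 : ∀ c : FormClasses N, 6 * ((2 : ℝ) / (Nat.card {γ : Matrix.SpecialLinearGroup (Fin 2) ℤ //
      formAct γ c.out.1 = c.out.1})) =
      ((∑ R ∈ WF N, (if ∃ g, formAct g c.out.1 = R then wQ R else 0) : ℤ) : ℝ) := by
    intro c
    have h := class_sum c
    change 6 * ((2 : ℝ) / (st c : ℝ)) = _
    have h' : ((st c : ℝ)) * ((∑ R ∈ WF N, (if ∃ g, formAct g c.out.1 = R then wQ R else 0) : ℤ) : ℝ) = 12 := by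
      exact_mod_cast h
    have : (st c : ℝ) ≠ 0 := by rintro h0; rw [h0] at h'; norm_num at h'
    field_simp
    linarith
  rw [sum_congr rfl fun c _ => e1 c]
  rw [← Int.cast_sum, Finset.sum_comm]
  congr 1
  refine sum_congr rfl fun R hR => ?_
  rw [Finset.sum_eq_single (cl (N := N) ⟨R, (mem_WF.1 hR).1, (mem_WF.1 hR).2.1⟩)]
  · rw [if_pos]
    exact cl_eq.1 (cl_out _)
  · intro c _ hc
    rw [if_neg]
    rintro ⟨g, hg⟩
    apply hc
    rw [← cl_out c]
    exact cl_eq.2 ⟨g, hg⟩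
  · simp

theorem cone_sum {n : ℤ} (hn : 0 < n) (F : ℤ → ℤ) :
    ∑ v ∈ GG n, (if CC v then w2 v * F v.1 else 0) =
    ∑ t ∈ Icc 1 (2 * n), if t ^ 2 < 4 * n then F t * ∑ R ∈ WF (4 * n - t ^ 2), wQ R else 0 := by
  rw [← sum_filter, ← sum_filter]
  simp_rw [mul_sum]
  rw [Finset.sum_sigma']
  refine sum_nbij' (fun v => ⟨v.1, ((v.2.1 + v.2.2.1) / 2, -v.2.1, (v.2.1 + v.2.2.2) / 2)⟩)
    (fun s => (s.1, -s.2.2.1, 2 * s.2.1 + s.2.2.1, 2 * s.2.2.2 + s.2.2.1)) ?_ ?_ ?_ ?_ ?_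
  · rintro ⟨t, x, y, z⟩ hv
    rw [mem_filter, mem_GG] at hv
    simp only [okk, CC] at hv
    obtain ⟨⟨h1, h2, h3, h4, h5, h6, h7, -⟩, h8⟩ := hv
    rw [mem_sigma, mem_filter, mem_Icc, mem_WF]
    dsimp only [formDisc, IsPosDef, WC]
    obtain ⟨a, ha⟩ : ∃ a, (x + y) / 2 = a := ⟨_, rfl⟩
    obtain ⟨c, hc⟩ : ∃ c, (x + z) / 2 = c := ⟨_, rfl⟩
    rw [ha, hc]
    obtain rfl : y = 2 * a - x := by omega
    obtain rfl : z = 2 * c - x := by omega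
    have ht : t ^ 2 < 4 * n := by
      have : 0 < x * (2 * a - x) + (2 * a - x) * (2 * c - x) + (2 * c - x) * x := by
        obtain ⟨g1, g2, g3, g4⟩ := h8
        have i1 := mul_nonneg g1 g2
        have i2 := mul_nonneg g2 g3
        have i3 := mul_nonneg g3 g1
        by_contra! hc
        have j1 : x * (2 * a - x) = 0 := by linarith
        have j2 : (2 * a - x) * (2 * c - x) = 0 := by linarith
        have j3 : (2 * c - x) * x = 0 := by linarith
        rcases mul_eq_zero.1 j1 with j | j <;> rcases mul_eq_zero.1 j2 with k | k <;>
          rcases mul_eq_zero.1 j3 with l | l <;> omega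
      linarith
    have ht2 : t ≤ 2 * n := by nlinarith
    refine ⟨⟨⟨by omega, ht2⟩, ht⟩, by linarith, ⟨by omega, by linarith⟩, by omega, by omega, by omega⟩
  · rintro ⟨t, a, b, c⟩ hs
    rw [mem_sigma, mem_filter, mem_Icc, mem_WF] at hs
    dsimp only at hs
    obtain ⟨⟨⟨h1, h1'⟩, h2⟩, h3, h4, h5⟩ := hs
    have a1 := eval_pos h4 (x := 1) (y := 0) (by simp)
    have a2 := eval_pos h4 (x := 0) (y := 1) (by simp)
    have a3 := eval_pos h4 (x := 1) (y := 1) (by simp)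
    simp only [formEval, formDisc, WC] at *
    rw [mem_filter, mem_GG]
    simp only [okk, CC]
    have hb : b % 2 = t % 2 := by
      have e : b * b - t * t = 4 * (a * c - n) := by linarith
      rcases Int.emod_two_eq_zero_or_one b with hb | hb <;> rcases Int.emod_two_eq_zero_or_one t with ht | ht <;>
        rw [hb, ht] <;> exfalso
      · obtain ⟨k, rfl⟩ : ∃ k, b = 2 * k := ⟨b / 2, by omega⟩
        obtain ⟨l, rfl⟩ : ∃ l, t = 2 * l + 1 := ⟨t / 2, by omega⟩
        ring_nf at e; omega
      · obtain ⟨k, rfl⟩ : ∃ k, b = 2 * k + 1 := ⟨b / 2, by omega⟩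
        obtain ⟨l, rfl⟩ : ∃ l, t = 2 * l := ⟨t / 2, by omega⟩
        ring_nf at e; omega
    refine ⟨⟨by linarith, by omega, by omega, by omega, by omega, by omega, by omega, Or.inr ?_⟩, ?_⟩ <;> omega
  · rintro ⟨t, x, y, z⟩ hv
    rw [mem_filter, mem_GG] at hv
    simp only [okk, CC] at hv
    simp only [Prod.mk.injEq]
    refine ⟨trivial, ?_, ?_, ?_⟩ <;> omega
  · rintro ⟨t, a, b, c⟩ hs
    simp only [Sigma.mk.injEq, true_and, heq_eq_eq, Prod.mk.injEq]
    omega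
  · rintro ⟨t, x, y, z⟩ hv
    rw [mem_filter, mem_GG] at hv
    simp only [okk, CC] at hv
    simp only [w2, wQ]
    rw [show 2 * ((x + y) / 2) + -x = y by omega, show 2 * ((x + z) / 2) + -x = z by omega, neg_neg]
    ring

theorem P12 {n : ℤ} (hn : 0 < n) (F : ℤ → ℤ) :
    6 * ∑ t ∈ Icc 1 (2 * n), (if t ^ 2 < 4 * n then (F t : ℝ) * hurwitzClassNumber (4 * n - t ^ 2) else 0) =
    ((∑ q ∈ SQ n, (cf (fb q) * F (q.1 + q.2.2.2) + 2 * (ib q : ℤ) * F (q.2.1 + q.2.2.1 - q.2.2.2)) : ℤ) : ℝ) := by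
  rw [← P2, cone_sum hn, mul_sum]
  push_cast
  refine sum_congr rfl fun t _ => ?_
  split_ifs with h
  · have := H_eq (N := 4 * n - t ^ 2) (by linarith)
    push_cast at this
    rw [← this]; ring
  · simp

def F3 (x : ℤ) : ℤ := if x % 3 = 0 then 1 else 0

noncomputable def PQ (n : ℤ) : Finset V4 :=
  (SQ n).filter fun q => 0 < q.1 ∧ 0 < q.2.1 ∧ 0 < q.2.2.1 ∧ 0 < q.2.2.2

theorem mem_PQ {n : ℤ} {q : V4} : q ∈ PQ n ↔
    (0 < q.1 ∧ 0 < q.2.1 ∧ 0 < q.2.2.1 ∧ 0 < q.2.2.2 ∧ q.1 * q.2.2.2 + q.2.1 * q.2.2.1 = n) := by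
  unfold PQ
  rw [mem_filter, mem_SQ]
  obtain ⟨a, b, c, d⟩ := q
  dsimp only
  constructor
  · rintro ⟨⟨h1, h2⟩, h3⟩; exact ⟨h3.1, h3.2.1, h3.2.2.1, h3.2.2.2, h2⟩
  · rintro ⟨ha, hb, hc, hd, e⟩
    have : a ≤ n := by nlinarith
    have : b ≤ n := by nlinarith
    have : c ≤ n := by nlinarith
    have : d ≤ n := by nlinarith
    refine ⟨⟨?_, e⟩, ?_⟩ <;> omega

theorem trP {n : ℤ} (φ ψ : V4 → V4) (P Q : V4 → Prop) [DecidablePred P] [DecidablePred Q] (f g : V4 → ℤ)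
    (h1 : ∀ v ∈ PQ n, P v → φ v ∈ PQ n ∧ Q (φ v))
    (h2 : ∀ v ∈ PQ n, Q v → ψ v ∈ PQ n ∧ P (ψ v))
    (h3 : ∀ v, ψ (φ v) = v) (h4 : ∀ v, φ (ψ v) = v) (h5 : ∀ v, f v = g (φ v)) :
    ∑ v ∈ PQ n with P v, f v = ∑ v ∈ PQ n with Q v, g v := by
  refine sum_nbij' φ ψ ?_ ?_ ?_ ?_ ?_
  · intro v hv
    rw [mem_filter] at *
    exact h1 v hv.1 hv.2
  · intro v hv
    rw [mem_filter] at *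
    exact h2 v hv.1 hv.2
  · intro v _; exact h3 v
  · intro v _; exact h4 v
  · intro v hv; exact h5 v

theorem tri {n : ℤ} (u v : V4 → ℤ) (f : V4 → ℤ) :
    ∑ q ∈ PQ n, f q = ∑ q ∈ PQ n with u q < v q, f q + ∑ q ∈ PQ n with v q < u q, f q +
      ∑ q ∈ PQ n with u q = v q, f q := by
  simp only [sum_filter, ← sum_add_distrib]
  refine sum_congr rfl fun q _ => ?_
  rcases lt_trichotomy (u q) (v q) with h | h | h
  · rw [if_pos h, if_neg h.not_gt, if_neg h.ne]; ring
  · rw [if_neg (by omega), if_neg (by omega), if_pos h]; ring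
  · rw [if_neg h.not_gt, if_pos h, if_neg h.ne']; ring

theorem ps_mul (c d : ℤ) : ps d * ps c = F3 (d - c) - F3 (d + c) := by
  unfold ps F3
  have h1 : d % 3 = 0 ∨ d % 3 = 1 ∨ d % 3 = 2 := by omega
  have h2 : c % 3 = 0 ∨ c % 3 = 1 ∨ c % 3 = 2 := by omega
  rcases h1 with h1 | h1 | h1 <;> rcases h2 with h2 | h2 | h2 <;> simp [h1, h2, Int.sub_emod, Int.add_emod]

theorem liou1 {n : ℤ} (hn : n % 3 ≠ 0) :
    ∑ q ∈ PQ n, ps q.2.2.2 * ps q.2.2.1 = ∑ q ∈ PQ n with q.1 = q.2.1, (1 - 2 * F3 q.2.2.2) := by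
  have F0 : ∀ x y : ℤ, x * y = n → F3 x = 0 := by
    intro x y h
    unfold F3
    rw [if_neg]
    intro hx
    apply hn
    rw [← h, Int.mul_emod, hx]; simp
  have Fn : ∀ x : ℤ, F3 (-x) = F3 x := by intro x; simp only [F3]; congr 1; apply propext; omega
  simp only [ps_mul]
  rw [sum_sub_distrib]
  -- S1
  have s1 := tri (n := n) (fun q => q.2.2.1) (fun q => q.2.2.2) (fun q => F3 (q.2.2.2 - q.2.2.1))
  have s2 := tri (n := n) (fun q => q.1) (fun q => q.2.1) (fun q => F3 (q.2.2.2 + q.2.2.1))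
  have s3 := tri (n := n) (fun q => q.2.2.1) (fun q => q.2.2.2) (fun q => F3 (q.2.2.2))
  have s4 := tri (n := n) (fun q => q.1) (fun q => q.2.1) (fun q => F3 (q.2.2.2))
  have t1 := trP (n := n) (fun q => (q.1, q.1 + q.2.1, q.2.2.1, q.2.2.2 - q.2.2.1))
    (fun q => (q.1, q.2.1 - q.1, q.2.2.1, q.2.2.2 + q.2.2.1)) (fun q => q.2.2.1 < q.2.2.2) (fun q => q.1 < q.2.1)
    (fun q => F3 (q.2.2.2 - q.2.2.1)) (fun q => F3 q.2.2.2) ?_ ?_ ?_ ?_ ?_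
  have t2 := trP (n := n) (fun q => (q.2.1, q.1, q.2.2.2, q.2.2.1)) (fun q => (q.2.1, q.1, q.2.2.2, q.2.2.1))
    (fun q => q.2.2.2 < q.2.2.1) (fun q => q.2.2.1 < q.2.2.2)
    (fun q => F3 (q.2.2.2 - q.2.2.1)) (fun q => F3 (q.2.2.2 - q.2.2.1)) ?_ ?_ ?_ ?_ ?_
  have t3 := trP (n := n) (fun q => (q.1, q.2.1 - q.1, q.2.2.1, q.2.2.2 + q.2.2.1))
    (fun q => (q.1, q.1 + q.2.1, q.2.2.1, q.2.2.2 - q.2.2.1)) (fun q => q.1 < q.2.1) (fun q => q.2.2.1 < q.2.2.2)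
    (fun q => F3 (q.2.2.2 + q.2.2.1)) (fun q => F3 q.2.2.2) ?_ ?_ ?_ ?_ ?_
  have t4 := trP (n := n) (fun q => (q.2.1, q.1, q.2.2.2, q.2.2.1)) (fun q => (q.2.1, q.1, q.2.2.2, q.2.2.1))
    (fun q => q.2.1 < q.1) (fun q => q.1 < q.2.1)
    (fun q => F3 (q.2.2.2 + q.2.2.1)) (fun q => F3 (q.2.2.2 + q.2.2.1)) ?_ ?_ ?_ ?_ ?_
  have t5 := trP (n := n) (fun q => (q.1 + q.2.1, q.2.1, q.2.2.1 - q.2.2.2, q.2.2.2))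
    (fun q => (q.1 - q.2.1, q.2.1, q.2.2.1 + q.2.2.2, q.2.2.2)) (fun q => q.2.2.2 < q.2.2.1) (fun q => q.2.1 < q.1)
    (fun q => F3 q.2.2.2) (fun q => F3 q.2.2.2) ?_ ?_ ?_ ?_ ?_
  have t6 := trP (n := n) (fun q => (q.2.2.1, q.2.2.2, q.1, q.2.1)) (fun q => (q.2.2.1, q.2.2.2, q.1, q.2.1))
    (fun q => q.2.2.1 = q.2.2.2) (fun q => q.1 = q.2.1) (fun q => 1) (fun q => 1) ?_ ?_ ?_ ?_ ?_
  · have z1 : ∑ q ∈ PQ n with q.2.2.1 = q.2.2.2, F3 (q.2.2.2 - q.2.2.1) = ∑ q ∈ PQ n with q.2.2.1 = q.2.2.2, 1 := by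
      refine sum_congr rfl fun q hq => ?_
      rw [mem_filter] at hq
      rw [hq.2]; simp [F3]
    have z2 : ∑ q ∈ PQ n with q.1 = q.2.1, F3 (q.2.2.2 + q.2.2.1) = 0 := by
      refine sum_eq_zero fun q hq => ?_
      rw [mem_filter, mem_PQ] at hq
      refine F0 _ q.1 ?_
      rw [← hq.1.2.2.2.2, ← hq.2]; ring
    have z3 : ∑ q ∈ PQ n with q.2.2.1 = q.2.2.2, F3 q.2.2.2 = 0 := by
      refine sum_eq_zero fun q hq => ?_
      rw [mem_filter, mem_PQ] at hq
      refine F0 _ (q.1 + q.2.1) ?_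
      rw [← hq.1.2.2.2.2, hq.2]; ring
    rw [sum_sub_distrib, ← mul_sum]
    linarith
  all_goals first
    | (intro q; rfl)
    | (rintro ⟨a, b, c, d⟩ h1 h2
       rw [mem_PQ] at h1
       rw [mem_PQ]
       dsimp only at *
       obtain ⟨k1, k2, k3, k4, k5⟩ := h1
       refine ⟨⟨by omega, by omega, by omega, by omega, by rw [← k5]; ring1⟩, by omega⟩)
    | (rintro ⟨a, b, c, d⟩
       simp only [Prod.mk.injEq, true_and, and_true]
       omega)
    | (rintro ⟨a, b, c, d⟩
       dsimp only
       rw [← Fn]; congr 1; ring1)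
    | (rintro ⟨a, b, c, d⟩
       dsimp only
       congr 1; ring1)

theorem ps_mult (x y : ℤ) : ps (x * y) = ps x * ps y := by
  unfold ps
  have h1 : x % 3 = 0 ∨ x % 3 = 1 ∨ x % 3 = 2 := by omega
  have h2 : y % 3 = 0 ∨ y % 3 = 1 ∨ y % 3 = 2 := by omega
  rcases h1 with h1 | h1 | h1 <;> rcases h2 with h2 | h2 | h2 <;> simp [h1, h2, Int.mul_emod]

theorem ps_zero {x : ℤ} (h : x % 3 = 0) : ps x = 0 := by simp [ps, h]

def rh (m : ℕ) : ℤ := ∑ x ∈ m.divisorsAntidiagonal, ps (x.2 : ℤ)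

theorem rh_def (m : ℕ) : rh m = ∑ x ∈ m.divisorsAntidiagonal, ps (x.2 : ℤ) := rfl

theorem rh_div (m : ℕ) : rh m = ∑ d ∈ m.divisors, ps (d : ℤ) := by
  unfold rh
  rw [Nat.sum_divisorsAntidiagonal' (f := fun _ y => ps (y : ℤ))]

theorem rh_swap (m : ℕ) : rh m = ∑ x ∈ m.divisorsAntidiagonal, ps (x.1 : ℤ) := by
  rw [rh_div, Nat.sum_divisorsAntidiagonal (f := fun y _ => ps (y : ℤ))]

theorem rh_zero : rh 0 = 0 := by simp [rh]
theorem rh_one : rh 1 = 1 := by simp [rh, ps]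

theorem rh_two {m : ℕ} (hm : m % 3 = 2) : rh m = 0 := by
  have h : rh m = - rh m := by
    conv_rhs => rw [rh_swap]
    rw [← Finset.sum_neg_distrib]
    unfold rh
    refine sum_congr rfl fun x hx => ?_
    have h1 := (Nat.mem_divisorsAntidiagonal.1 hx).1
    have h2 : ((x.1 : ℤ) * x.2) % 3 = 2 := by
      have : ((x.1 : ℤ) * x.2) = (m : ℤ) := by exact_mod_cast h1
      omega
    have h3 : (x.1 : ℤ) % 3 = 0 ∨ (x.1 : ℤ) % 3 = 1 ∨ (x.1 : ℤ) % 3 = 2 := by omega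
    have h4 : (x.2 : ℤ) % 3 = 0 ∨ (x.2 : ℤ) % 3 = 1 ∨ (x.2 : ℤ) % 3 = 2 := by omega
    unfold ps
    rcases h3 with h3 | h3 | h3 <;> rcases h4 with h4 | h4 | h4 <;> simp [h3, h4, Int.mul_emod] at h2 ⊢
  omega

theorem dp {p m : ℕ} (hp : p.Prime) :
    ∑ d ∈ (p * m).divisors with p ∣ d, ps (d : ℤ) = ps p * rh m := by
  rw [rh_div, mul_sum]
  symm
  refine sum_nbij' (fun d => p * d) (fun d => d / p) ?_ ?_ ?_ ?_ ?_
  · intro d hd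
    rw [Nat.mem_divisors] at hd
    rw [mem_filter, Nat.mem_divisors]
    exact ⟨⟨Nat.mul_dvd_mul_left p hd.1, Nat.mul_ne_zero hp.ne_zero hd.2⟩, Dvd.intro _ rfl⟩
  · intro d hd
    rw [mem_filter, Nat.mem_divisors] at hd
    obtain ⟨⟨h1, h2⟩, e, rfl⟩ := hd
    rw [Nat.mem_divisors, Nat.mul_div_cancel_left _ hp.pos]
    exact ⟨Nat.dvd_of_mul_dvd_mul_left hp.pos h1, by rintro rfl; simp at h2⟩
  · intro d _; exact Nat.mul_div_cancel_left _ hp.pos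
  · intro d hd
    rw [mem_filter] at hd
    exact Nat.mul_div_cancel' hd.2
  · intro d _
    push_cast
    rw [ps_mult]

theorem rh_rec {p m : ℕ} (hp : p.Prime) :
    rh (p * m) = (1 + ps p) * rh m - (if p ∣ m then ps p * rh (m / p) else 0) := by
  rcases Nat.eq_zero_or_pos m with rfl | hm
  · simp [rh_zero]
  have h1 : rh (p * m) = ∑ d ∈ (p * m).divisors with p ∣ d, ps (d : ℤ) +
      ∑ d ∈ (p * m).divisors with ¬ p ∣ d, ps (d : ℤ) := by
    rw [rh_div, Finset.sum_filter_add_sum_filter_not]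
  have h2 : rh m = ∑ d ∈ m.divisors with p ∣ d, ps (d : ℤ) + ∑ d ∈ m.divisors with ¬ p ∣ d, ps (d : ℤ) := by
    rw [rh_div, Finset.sum_filter_add_sum_filter_not]
  have h3 : ∑ d ∈ (p * m).divisors with ¬ p ∣ d, ps (d : ℤ) = ∑ d ∈ m.divisors with ¬ p ∣ d, ps (d : ℤ) := by
    refine sum_congr ?_ fun _ _ => rfl
    ext d
    rw [mem_filter, mem_filter, Nat.mem_divisors, Nat.mem_divisors]
    constructor
    · rintro ⟨⟨a, b⟩, c⟩
      refine ⟨⟨?_, hm.ne'⟩, c⟩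
      exact Nat.Coprime.dvd_of_dvd_mul_left (((Nat.Prime.coprime_iff_not_dvd hp).2 c).symm) a
    · rintro ⟨⟨a, b⟩, c⟩
      exact ⟨⟨Dvd.dvd.mul_left a p, Nat.mul_ne_zero hp.ne_zero hm.ne'⟩, c⟩
  rw [dp hp] at h1
  have h4 : ∑ d ∈ m.divisors with p ∣ d, ps (d : ℤ) = (if p ∣ m then ps p * rh (m / p) else 0) := by
    split_ifs with h
    · obtain ⟨k, rfl⟩ := h
      rw [dp hp, Nat.mul_div_cancel_left _ hp.pos]
    · refine sum_eq_zero fun d hd => ?_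
      rw [mem_filter, Nat.mem_divisors] at hd
      exact absurd (hd.2.trans hd.1.1) h
  linarith

theorem rh_three (m : ℕ) : rh (3 * m) = rh m := by
  rw [rh_rec Nat.prime_three]; simp [ps]

theorem conv (n : ℕ) (A B : ℤ → ℤ → ℤ) :
    ∑ q ∈ PQ (n : ℤ), A q.1 q.2.2.2 * B q.2.1 q.2.2.1 =
    ∑ u ∈ Finset.HasAntidiagonal.antidiagonal n, (∑ x ∈ u.1.divisorsAntidiagonal, A x.1 x.2) *
      (∑ y ∈ u.2.divisorsAntidiagonal, B y.1 y.2) := by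
  simp_rw [Finset.sum_mul_sum, ← Finset.sum_product']
  rw [Finset.sum_sigma']
  symm
  refine Finset.sum_bij' (fun z _ => ((z.2.1.1 : ℤ), (z.2.2.1 : ℤ), (z.2.2.2 : ℤ), (z.2.1.2 : ℤ)))
    (fun q _ => ⟨(q.1.toNat * q.2.2.2.toNat, q.2.1.toNat * q.2.2.1.toNat),
      ((q.1.toNat, q.2.2.2.toNat), (q.2.1.toNat, q.2.2.1.toNat))⟩) ?_ ?_ ?_ ?_ ?_
  · rintro ⟨⟨u, v⟩, ⟨⟨a, d⟩, ⟨b, c⟩⟩⟩ h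
    simp only [mem_sigma, Finset.HasAntidiagonal.mem_antidiagonal, mem_product, Nat.mem_divisorsAntidiagonal] at h
    obtain ⟨h1, ⟨h2, h3⟩, h4, h5⟩ := h
    rw [mem_PQ]
    dsimp only
    subst h2 h4
    have ha := Nat.pos_of_ne_zero (left_ne_zero_of_mul h3)
    have hd := Nat.pos_of_ne_zero (right_ne_zero_of_mul h3)
    have hb := Nat.pos_of_ne_zero (left_ne_zero_of_mul h5)
    have hc := Nat.pos_of_ne_zero (right_ne_zero_of_mul h5)
    refine ⟨by exact_mod_cast ha, by exact_mod_cast hb, by exact_mod_cast hc, by exact_mod_cast hd, ?_⟩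
    exact_mod_cast h1
  · rintro ⟨a, b, c, d⟩ h
    rw [mem_PQ] at h
    dsimp only at *
    obtain ⟨ha, hb, hc, hd, e⟩ := h
    lift a to ℕ using ha.le
    lift b to ℕ using hb.le
    lift c to ℕ using hc.le
    lift d to ℕ using hd.le
    simp only [mem_sigma, Finset.HasAntidiagonal.mem_antidiagonal, mem_product, Nat.mem_divisorsAntidiagonal, Int.toNat_natCast]
    have ha' : 0 < a := by omega
    have hb' : 0 < b := by omega
    have hc' : 0 < c := by omega
    have hd' : 0 < d := by omega
    refine ⟨by exact_mod_cast e, ⟨trivial, by positivity⟩, ⟨trivial, by positivity⟩⟩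
  · rintro ⟨⟨u, v⟩, ⟨⟨a, d⟩, ⟨b, c⟩⟩⟩ h
    simp only [mem_sigma, Finset.HasAntidiagonal.mem_antidiagonal, mem_product, Nat.mem_divisorsAntidiagonal] at h
    obtain ⟨h1, ⟨h2, h3⟩, h4, h5⟩ := h
    simp only [Int.toNat_natCast, h2, h4]
  · rintro ⟨a, b, c, d⟩ h
    rw [mem_PQ] at h
    dsimp only at *
    simp only [Prod.mk.injEq]
    omega
  · rintro ⟨⟨u, v⟩, ⟨⟨a, d⟩, ⟨b, c⟩⟩⟩ h
    rfl

theorem third (n : ℕ) (f : ℕ → ℕ → ℤ) :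
    ∑ u ∈ Finset.HasAntidiagonal.antidiagonal n with u.1 % 3 = 0, f u.1 u.2 =
      ∑ w ∈ range (n / 3 + 1), f (3 * w) (n - 3 * w) := by
  symm
  refine sum_nbij' (fun w => (3 * w, n - 3 * w)) (fun u => u.1 / 3) ?_ ?_ ?_ ?_ ?_
  · intro w hw
    simp only [mem_range, mem_filter, Finset.HasAntidiagonal.mem_antidiagonal] at *
    omega
  · rintro ⟨u, v⟩ hw
    simp only [mem_range, mem_filter, Finset.HasAntidiagonal.mem_antidiagonal] at *
    omega
  · intro w hw
    dsimp only; omega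
  · rintro ⟨u, v⟩ hw
    simp only [mem_range, mem_filter, Finset.HasAntidiagonal.mem_antidiagonal, Prod.mk.injEq] at *
    omega
  · intro w hw; rfl

def Y0 (n : ℕ) : ℤ := ∑ w ∈ range (n / 3 + 1), rh w * rh (n - 3 * w)
def Y1 (n : ℕ) : ℤ := ∑ w ∈ range (n / 3 + 1), w * (rh w * rh (n - 3 * w))

theorem convrr {n : ℕ} (hn : n % 3 = 1) : ∑ u ∈ Finset.HasAntidiagonal.antidiagonal n, rh u.1 * rh u.2 = 2 * Y0 n := by
  have e : ∀ u ∈ Finset.HasAntidiagonal.antidiagonal n, rh u.1 * rh u.2 = (if u.1 % 3 = 0 then rh u.1 * rh u.2 else 0) +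
     (if u.2 % 3 = 0 then rh u.1 * rh u.2 else 0) := by
    rintro ⟨u, v⟩ hu
    rw [Finset.HasAntidiagonal.mem_antidiagonal] at hu
    dsimp only at *
    have : u % 3 = 0 ∨ u % 3 = 1 ∨ u % 3 = 2 := by omega
    rcases this with h | h | h
    · rw [if_pos h, if_neg (by omega)]; ring
    · rw [if_neg (by omega), if_pos (by omega)]; ring
    · rw [if_neg (by omega), if_neg (by omega), rh_two h]; ring
  rw [sum_congr rfl e, sum_add_distrib]
  have s : ∑ u ∈ Finset.HasAntidiagonal.antidiagonal n, (if u.2 % 3 = 0 then rh u.1 * rh u.2 else 0) =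
    ∑ u ∈ Finset.HasAntidiagonal.antidiagonal n, (if u.1 % 3 = 0 then rh u.1 * rh u.2 else 0) := by
    rw [← Finset.Nat.sum_antidiagonal_swap]
    refine sum_congr rfl fun u _ => ?_
    simp only [Prod.fst_swap, Prod.snd_swap, mul_comm]
  have t := third n (fun x y => rh x * rh y)
  rw [sum_filter] at t
  rw [s, t, Y0]
  simp only [rh_three]; ring

theorem diag1 (e : ℕ) : 3 * ∑ d ∈ range e, (1 - 2 * F3 (d : ℤ)) =
    e - ps e - 3 + (if (e : ℤ) % 3 = 0 then 3 else 0) := by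
  induction e with
  | zero => simp [ps]
  | succ e ih =>
    rw [sum_range_succ, mul_add, ih]
    push_cast
    unfold ps F3
    have : (e : ℤ) % 3 = 0 ∨ (e : ℤ) % 3 = 1 ∨ (e : ℤ) % 3 = 2 := by omega
    rcases this with h | h | h <;> simp [h, Int.add_emod] <;> ring

theorem diag {n : ℕ} (hn : n % 3 = 1) : 3 * ∑ q ∈ PQ (n : ℤ) with q.1 = q.2.1, (1 - 2 * F3 q.2.2.2) =
    (∑ d ∈ n.divisors, (d : ℤ)) - rh n := by
  have h1 : ∑ q ∈ PQ (n : ℤ) with q.1 = q.2.1, (1 - 2 * F3 q.2.2.2) =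
     ∑ x ∈ n.divisorsAntidiagonal, ∑ d ∈ Ico 1 x.2, (1 - 2 * F3 (d : ℤ)) := by
    rw [Finset.sum_sigma']
    symm
    refine Finset.sum_bij' (fun z _ => ((z.1.1 : ℤ), (z.1.1 : ℤ), (z.1.2 : ℤ) - (z.2 : ℤ), (z.2 : ℤ)))
      (fun q _ => ⟨(q.1.toNat, (q.2.2.1 + q.2.2.2).toNat), q.2.2.2.toNat⟩) ?_ ?_ ?_ ?_ ?_
    · rintro ⟨⟨a, e⟩, d⟩ h
      simp only [mem_sigma, Nat.mem_divisorsAntidiagonal, mem_Ico] at h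
      obtain ⟨⟨h1, h2⟩, h3, h4⟩ := h
      rw [mem_filter, mem_PQ]
      dsimp only
      have ha : a ≠ 0 := by rintro rfl; simp at h1; omega
      have : (a : ℤ) * e = n := by exact_mod_cast h1
      refine ⟨⟨by omega, by omega, by omega, by omega, ?_⟩, rfl⟩
      rw [← this]; ring
    · rintro ⟨a, b, c, d⟩ h
      rw [mem_filter, mem_PQ] at h
      dsimp only at *
      obtain ⟨⟨ha, hb, hc, hd, e⟩, rfl⟩ := h
      lift a to ℕ using ha.le
      lift c to ℕ using hc.le
      lift d to ℕ using hd.le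
      simp only [mem_sigma, Nat.mem_divisorsAntidiagonal, mem_Ico, ← Nat.cast_add, Int.toNat_natCast]
      refine ⟨⟨?_, by omega⟩, by omega, by omega⟩
      have : a * d + a * c = n := by exact_mod_cast e
      rw [← this]; ring
    · rintro ⟨⟨a, e⟩, d⟩ h
      simp
    · rintro ⟨a, b, c, d⟩ h
      rw [mem_filter, mem_PQ] at h
      dsimp only at *
      simp only [Prod.mk.injEq]
      omega
    · rintro ⟨⟨a, e⟩, d⟩ h
      rfl
  rw [h1, mul_sum, rh, ← Nat.sum_divisorsAntidiagonal' (f := fun _ y => (y : ℤ)), ← sum_sub_distrib]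
  refine sum_congr rfl fun x hx => ?_
  rw [Nat.mem_divisorsAntidiagonal] at hx
  have h2 := diag1 x.2
  have hx3 : ¬ (x.2 : ℤ) % 3 = 0 := by
    intro h
    have h3 : 3 ∣ x.2 := by omega
    have : 3 ∣ n := by rw [← hx.1]; exact Dvd.dvd.mul_left h3 _
    omega
  rw [if_neg hx3] at h2
  have h0 : x.2 ≠ 0 := by intro h; rw [h] at hx3; simp at hx3
  rw [Finset.range_eq_Ico, Finset.sum_eq_sum_Ico_succ_bot (by omega)] at h2
  simp [F3] at h2 ⊢
  linarith

theorem liou {n : ℕ} (hn : n % 3 = 1) : (∑ d ∈ n.divisors, (d : ℤ)) = rh n + 6 * Y0 n := by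
  have h1 := liou1 (n := n) (by omega)
  have h2 := conv n (fun _ y => ps y) (fun _ y => ps y)
  have h3 := diag hn
  have h4 := convrr hn
  simp only [← rh_def] at h2
  rw [h1, h4] at h2
  rw [h2] at h3
  linarith

theorem level3Y {n : ℕ} (hn : n % 3 = 1) :
    ∑ q ∈ SQ (n : ℤ), (if q.1 % 3 = 0 then 18 * ps q.2.2.2 * ps q.2.2.1 else 0) * (q.1 * q.2.2.2) = 54 * Y1 n := by
  have h1 : ∑ q ∈ SQ (n : ℤ), (if q.1 % 3 = 0 then 18 * ps q.2.2.2 * ps q.2.2.1 else 0) * (q.1 * q.2.2.2) =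
    ∑ q ∈ PQ (n : ℤ), (if q.1 % 3 = 0 then 18 * ps q.2.2.2 * (q.1 * q.2.2.2) else 0) * ps q.2.2.1 := by
    unfold PQ
    rw [sum_filter]
    refine sum_congr rfl ?_
    rintro ⟨a, b, c, d⟩ hq
    rw [mem_SQ] at hq
    dsimp only at *
    split_ifs with i1 i2 i3
    · ring
    · have : a = 0 ∨ c = 0 ∨ d = 0 ∨ b = 0 := by omega
      rcases this with h | h | h | h
      · rw [h]; ring
      · rw [h, ps_zero (x := 0) rfl]; ring
      · rw [h]; ring
      · exfalso
        have := hq.2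
        rw [h] at this
        have h5 : (a * d) % 3 = 0 := by rw [Int.mul_emod, i1]; simp
        simp at this
        omega
    · ring
    · ring
  rw [h1, conv n (fun x y => if x % 3 = 0 then 18 * ps y * (x * y) else 0) (fun _ y => ps y)]
  simp only [← rh_def]
  have h2 : ∀ u : ℕ, ∑ x ∈ u.divisorsAntidiagonal, (if (x.1 : ℤ) % 3 = 0 then 18 * ps (x.2 : ℤ) * (x.1 * x.2) else 0) =
      if u % 3 = 0 then 18 * (u * rh u) else 0 := by
    intro u
    split_ifs with hu
    · rw [rh, mul_sum, mul_sum]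
      refine sum_congr rfl fun x hx => ?_
      have hx' := (Nat.mem_divisorsAntidiagonal.1 hx).1
      have : (x.1 : ℤ) * x.2 = u := by exact_mod_cast hx'
      rw [this]
      split_ifs with h3
      · ring
      · rw [ps_zero]; · ring
        have h4 : 3 ∣ x.1 * x.2 := by omega
        rcases (Nat.prime_three.dvd_mul).1 h4 with h | h <;> omega
    · refine sum_eq_zero fun x hx => ?_
      have hx' := (Nat.mem_divisorsAntidiagonal.1 hx).1
      rw [if_neg]
      intro h
      apply hu
      have : 3 ∣ x.1 := by omega
      have : 3 ∣ u := by rw [← hx']; exact Dvd.dvd.mul_right this _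
      omega
  simp only [h2]
  have t := third n (fun x y => 18 * (x * rh x) * rh y)
  rw [sum_filter] at t
  rw [Y1, mul_sum]
  rw [sum_congr rfl (g := fun u => if u.1 % 3 = 0 then 18 * (u.1 * rh u.1) * rh u.2 else 0) (fun u _ => by split_ifs <;> simp), t]
  refine sum_congr rfl fun w _ => ?_
  rw [rh_three]; push_cast; ring

noncomputable def RS (m : ℕ) : Finset (ℤ × ℤ) :=
  (Icc (-(m + 1 : ℤ)) (m + 1) ×ˢ Icc (-(m + 1 : ℤ)) (m + 1)).filter
    fun v => v.1 ^ 2 + v.1 * v.2 + v.2 ^ 2 = m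

theorem mem_RS {m : ℕ} {v : ℤ × ℤ} : v ∈ RS m ↔ v.1 ^ 2 + v.1 * v.2 + v.2 ^ 2 = m := by
  unfold RS
  rw [mem_filter, mem_product, mem_Icc, mem_Icc]
  refine ⟨fun h => h.2, fun h => ⟨?_, h⟩⟩
  obtain ⟨x, y⟩ := v
  dsimp only at *
  have hm : (0 : ℤ) ≤ m := by positivity
  have h1 : x ^ 2 ≤ ((m : ℤ) + 1) ^ 2 := by nlinarith [sq_nonneg (x + 2 * y)]
  have h2 : y ^ 2 ≤ ((m : ℤ) + 1) ^ 2 := by nlinarith [sq_nonneg (2 * x + y)]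
  have h3 := abs_le_of_sq_le_sq h1 (by positivity)
  have h4 := abs_le_of_sq_le_sq h2 (by positivity)
  exact ⟨abs_le.1 h3, abs_le.1 h4⟩

noncomputable def RR (m : ℕ) : ℤ := (RS m).card

theorem RR_zero : RR 0 = 1 := by
  have : RS 0 = {(0, 0)} := by
    ext ⟨x, y⟩
    rw [mem_RS, mem_singleton, Prod.mk.injEq]
    constructor
    · intro h
      push_cast at h
      have h1 : x ^ 2 ≤ 0 := by nlinarith [sq_nonneg (x + 2 * y)]
      have h2 : y ^ 2 ≤ 0 := by nlinarith [sq_nonneg (2 * x + y)]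
      exact ⟨pow_eq_zero_iff (two_ne_zero) |>.1 (le_antisymm h1 (sq_nonneg _)), pow_eq_zero_iff (two_ne_zero) |>.1 (le_antisymm h2 (sq_nonneg _))⟩
    · rintro ⟨rfl, rfl⟩; simp
  unfold RR; rw [this]; simp

theorem RR_one : RR 1 = 6 := by
  have : RS 1 = {(1, 0), (-1, 0), (0, 1), (0, -1), (1, -1), (-1, 1)} := by
    unfold RS; decide
  unfold RR; rw [this]; rfl

theorem RR_three (m : ℕ) : RR (3 * m) = RR m := by
  unfold RR
  congr 1
  symm
  refine Finset.card_nbij' (fun v => (v.1 - v.2, v.1 + 2 * v.2)) (fun v => ((2 * v.1 + v.2) / 3, (v.2 - v.1) / 3)) ?_ ?_ ?_ ?_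
  · rintro ⟨x, y⟩ h
    simp only [mem_coe, mem_RS] at *
    push_cast; rw [← h]; ring
  · rintro ⟨x, y⟩ h
    simp only [mem_coe, mem_RS] at *
    push_cast at h
    have h1 : (3 : ℤ) ∣ y - x := by
      have : (3 : ℤ) ∣ (y - x) ^ 2 := ⟨m - x * y, by linarith [h, (by ring : (y - x) ^ 2 = (x ^ 2 + x * y + y ^ 2) - 3 * (x * y))]⟩
      exact Int.prime_three.dvd_of_dvd_pow this
    obtain ⟨k, hk⟩ := h1
    have hy : y = x + 3 * k := by omega
    subst hy
    have e1 : (2 * x + (x + 3 * k)) / 3 = x + k := by omega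
    have e2 : (x + 3 * k - x) / 3 = k := by omega
    rw [e1, e2]
    have : 3 * ((x + k) ^ 2 + (x + k) * k + k ^ 2) = 3 * (m : ℤ) := by rw [← h]; ring
    linarith
  · rintro ⟨x, y⟩ h
    simp only [Prod.mk.injEq]; omega
  · rintro ⟨x, y⟩ h
    simp only [mem_coe, mem_RS] at *
    push_cast at h
    have h1 : (3 : ℤ) ∣ y - x := by
      have : (3 : ℤ) ∣ (y - x) ^ 2 := ⟨m - x * y, by linarith [h, (by ring : (y - x) ^ 2 = (x ^ 2 + x * y + y ^ 2) - 3 * (x * y))]⟩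
      exact Int.prime_three.dvd_of_dvd_pow this
    simp only [Prod.mk.injEq]; omega

/-- multiples of p -/
theorem RR_mult {p : ℕ} (hp : p.Prime) (m : ℕ) :
    (((RS (p * m)).filter fun v => (p : ℤ) ∣ v.1 ∧ (p : ℤ) ∣ v.2).card : ℤ) = if p ∣ m then RR (m / p) else 0 := by
  have hp0 : (p : ℤ) ≠ 0 := by exact_mod_cast hp.ne_zero
  split_ifs with h
  · obtain ⟨k, rfl⟩ := h
    rw [Nat.mul_div_cancel_left _ hp.pos]
    unfold RR
    congr 1
    symm
    refine Finset.card_nbij' (fun v => (p * v.1, p * v.2)) (fun v => (v.1 / p, v.2 / p)) ?_ ?_ ?_ ?_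
    · rintro ⟨x, y⟩ h
      simp only [coe_filter, Set.mem_ofPred_eq, mem_coe, mem_RS] at *
      refine ⟨?_, Dvd.intro _ rfl, Dvd.intro _ rfl⟩
      push_cast; rw [← h]; ring
    · rintro ⟨x, y⟩ h
      simp only [coe_filter, Set.mem_ofPred_eq, mem_coe, mem_RS] at *
      obtain ⟨h, ⟨a, rfl⟩, b, rfl⟩ := h
      rw [Int.mul_ediv_cancel_left _ hp0, Int.mul_ediv_cancel_left _ hp0]
      push_cast at h
      have : (p : ℤ) * (p : ℤ) * (a ^ 2 + a * b + b ^ 2) = p * p * k := by linarith [h]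
      exact mul_left_cancel₀ (mul_ne_zero hp0 hp0) this
    · rintro ⟨x, y⟩ h
      simp only [Int.mul_ediv_cancel_left _ hp0]
    · rintro ⟨x, y⟩ h
      simp only [coe_filter, Set.mem_ofPred_eq] at *
      rw [Int.mul_ediv_cancel' h.2.1, Int.mul_ediv_cancel' h.2.2]
  · norm_cast
    rw [Finset.card_eq_zero, Finset.filter_eq_empty_iff]
    rintro ⟨x, y⟩ hv ⟨h1, h2⟩
    rw [mem_RS] at hv
    dsimp only at *
    obtain ⟨a, rfl⟩ := h1
    obtain ⟨b, rfl⟩ := h2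
    apply h
    push_cast at hv
    have : (p : ℤ) * (p * (a ^ 2 + a * b + b ^ 2)) = p * m := by linarith [hv]
    have := mul_left_cancel₀ hp0 this
    exact_mod_cast Dvd.intro _ this

theorem inert {p : ℕ} (hp : p.Prime) (h2 : p % 3 = 2) {x y : ℤ} (h : (p : ℤ) ∣ x ^ 2 + x * y + y ^ 2) :
    (p : ℤ) ∣ x ∧ (p : ℤ) ∣ y := by
  haveI := Fact.mk hp
  have h' : ((x : ZMod p)) ^ 2 + x * y + y ^ 2 = 0 := by
    have := (ZMod.intCast_zmod_eq_zero_iff_dvd _ p).2 h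
    push_cast at this; exact this
  rw [← ZMod.intCast_zmod_eq_zero_iff_dvd, ← ZMod.intCast_zmod_eq_zero_iff_dvd]
  generalize (x : ZMod p) = u at *
  generalize (y : ZMod p) = v at *
  have hc : u ^ 3 = v ^ 3 := by
    have : (u - v) * (u ^ 2 + u * v + v ^ 2) = 0 := by rw [h']; ring
    linear_combination this
  have hk : p = 3 * (p / 3) + 2 := by omega
  have hu : u = v := by
    by_cases hv : v = 0
    · subst hv; simpa using hc
    have hu0 : u ≠ 0 := by
      rintro rfl
      apply hv; simpa using h'
    have a1 : u ^ p = u := ZMod.pow_card u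
    have a2 : v ^ p = v := ZMod.pow_card v
    have a3 : u ^ (p + 1) = v ^ (p + 1) := by
      have : p + 1 = 3 * (p / 3 + 1) := by omega
      rw [this, pow_mul, pow_mul, hc]
    rw [pow_succ, pow_succ, a1, a2] at a3
    have a4 : u * u * (u - v) = 0 := by linear_combination hc - v * a3
    rcases mul_eq_zero.1 a4 with a5 | a5
    · exact absurd (by simpa using a5) hu0
    · exact sub_eq_zero.1 a5
  subst hu
  have h3 : (3 : ZMod p) ≠ 0 := by
    intro h
    have : ((3 : ℕ) : ZMod p) = 0 := by exact_mod_cast h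
    rw [ZMod.natCast_eq_zero_iff] at this
    have := (Nat.prime_dvd_prime_iff_eq hp Nat.prime_three).1 this
    omega
  have : (3 : ZMod p) * u ^ 2 = 0 := by linear_combination h'
  have := (mul_eq_zero.1 this).resolve_left h3
  have := pow_eq_zero_iff two_ne_zero |>.1 this
  exact ⟨this, this⟩

theorem RR_inert {p : ℕ} (hp : p.Prime) (h2 : p % 3 = 2) (m : ℕ) :
    RR (p * m) = if p ∣ m then RR (m / p) else 0 := by
  rw [← RR_mult hp, RR]
  congr 2
  symm
  rw [Finset.filter_eq_self]
  intro v hv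
  rw [mem_RS] at hv
  apply inert hp h2
  rw [hv]; push_cast; exact Dvd.intro _ rfl

theorem redu (N : ℕ) : ∀ k k' z : ℤ, 0 < k → 0 < k' → k * k' = z ^ 2 + z + 1 → (2 * z + 1).natAbs ≤ N →
    ∃ a b c d : ℤ, k = a ^ 2 + a * b + b ^ 2 ∧ k' = c ^ 2 + c * d + d ^ 2 ∧ 2 * z + 1 = 2 * a * c + a * d + b * c + 2 * b * d := by
  induction N with
  | zero => intro k k' z _ _ _ h; omega
  | succ N ih =>
    have key : ∀ k k' z : ℤ, 0 < k → 0 < k' → k ≤ k' → k * k' = z ^ 2 + z + 1 → (2 * z + 1).natAbs ≤ N + 1 →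
      ∃ a b c d : ℤ, k = a ^ 2 + a * b + b ^ 2 ∧ k' = c ^ 2 + c * d + d ^ 2 ∧ 2 * z + 1 = 2 * a * c + a * d + b * c + 2 * b * d := by
      intro k k' z hk hk' hkk e hN
      by_cases h1 : k < 2 * z + 1
      · have e' : k * (k' - 2 * z - 1 + k) = (z - k) ^ 2 + (z - k) + 1 := by linear_combination e
        have hp : 0 < k' - 2 * z - 1 + k := by
          by_contra hc
          nlinarith [sq_nonneg (2 * (z - k) + 1)]
        obtain ⟨a, b, c, d, h3, h4, h5⟩ := ih k (k' - 2 * z - 1 + k) (z - k) hk hp e' (by omega)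
        refine ⟨a, b, c + a, d + b, h3, ?_, ?_⟩
        · linear_combination h4 + h5 + h3
        · linear_combination h5 + 2 * h3
      by_cases h2 : k < -(2 * z + 1)
      · have e' : k * (k' + 2 * z + 1 + k) = (z + k) ^ 2 + (z + k) + 1 := by linear_combination e
        have hp : 0 < k' + 2 * z + 1 + k := by
          by_contra hc
          nlinarith [sq_nonneg (2 * (z + k) + 1)]
        obtain ⟨a, b, c, d, h3, h4, h5⟩ := ih k (k' + 2 * z + 1 + k) (z + k) hk hp e' (by omega)
        refine ⟨a, b, c - a, d - b, h3, ?_, ?_⟩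
        · linear_combination h4 - h5 + h3
        · linear_combination h5 - 2 * h3
      have h3 : (2 * z + 1) ^ 2 ≤ k ^ 2 := by
        apply sq_le_sq'
        · omega
        · omega
      have hk1 : k = 1 := by nlinarith
      subst hk1
      have hz : z = 0 ∨ z = -1 := by omega
      rcases hz with rfl | rfl
      · exact ⟨1, 0, 0, 1, by norm_num, by linarith, by norm_num⟩
      · exact ⟨1, 0, 0, -1, by norm_num, by linarith, by norm_num⟩
    intro k k' z hk hk' e hN
    rcases le_total k k' with h | h
    · exact key k k' z hk hk' h e hN
    · obtain ⟨a, b, c, d, h3, h4, h5⟩ := key k' k z hk' hk h (by rw [← e]; ring) hN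
      exact ⟨c, d, a, b, h4, h3, by rw [h5]; ring⟩

theorem split_rep {p : ℕ} (hp : p.Prime) (h1 : p % 3 = 1) : ∃ r s : ℤ, r ^ 2 + r * s + s ^ 2 = p := by
  haveI := Fact.mk hp
  have hc : 3 ∣ Nat.card (ZMod p)ˣ := by
    rw [Nat.card_eq_fintype_card, ZMod.card_units]; omega
  haveI := Fact.mk Nat.prime_three
  obtain ⟨g, hg⟩ := exists_prime_orderOf_dvd_card' (G := (ZMod p)ˣ) 3 hc
  have g3 : (g : ZMod p) ^ 3 = 1 := by
    have := pow_orderOf_eq_one g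
    rw [hg] at this
    have h := congrArg Units.val this
    rwa [Units.val_pow_eq_pow_val, Units.val_one] at h
  have g1 : (g : ZMod p) ≠ 1 := by
    intro h
    have : g = 1 := Units.ext h
    rw [this, orderOf_one] at hg
    omega
  have g2 : (g : ZMod p) ^ 2 + g + 1 = 0 := by
    have : ((g : ZMod p) - 1) * ((g : ZMod p) ^ 2 + g + 1) = 0 := by linear_combination g3
    exact (mul_eq_zero.1 this).resolve_left (sub_ne_zero.2 g1)
  obtain ⟨z, hz⟩ := ZMod.intCast_surjective (g : ZMod p)
  rw [← hz] at g2
  have : ((z ^ 2 + z + 1 : ℤ) : ZMod p) = 0 := by push_cast; exact g2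
  rw [ZMod.intCast_zmod_eq_zero_iff_dvd] at this
  obtain ⟨k, hk⟩ := this
  have hp0 : (0 : ℤ) < p := by exact_mod_cast hp.pos
  have hk0 : 0 < k := by
    by_contra hc
    nlinarith [sq_nonneg (2 * z + 1)]
  obtain ⟨a, b, c, d, h, _⟩ := redu _ p k z hp0 hk0 hk.symm le_rfl
  exact ⟨a, b, h.symm⟩

theorem half {p : ℕ} (hp : p.Prime) {r s : ℤ} (hrs : r ^ 2 + r * s + s ^ 2 = p) (m : ℕ) :
    (((RS (p * m)).filter fun v => (p : ℤ) ∣ v.2 * r - v.1 * s).card : ℤ) = RR m := by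
  have hp0 : (p : ℤ) ≠ 0 := by exact_mod_cast hp.ne_zero
  have hpp : Prime (p : ℤ) := Nat.prime_iff_prime_int.1 hp
  have key : ∀ x y : ℤ, x ^ 2 + x * y + y ^ 2 = p * m → (p : ℤ) ∣ y * r - x * s → (p : ℤ) ∣ x * (r + s) + y * s := by
    intro x y h1 ⟨k, h2⟩
    refine hpp.dvd_of_dvd_pow (n := 2) ⟨p * m - (x * (r + s) + y * s) * k - p * k ^ 2, ?_⟩
    have : (x * (r + s) + y * s) ^ 2 + (x * (r + s) + y * s) * (y * r - x * s) + (y * r - x * s) ^ 2 = p * (p * m) := by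
      rw [← h1, ← hrs]; ring
    rw [h2] at this
    linear_combination this
  unfold RR
  congr 1
  symm
  refine Finset.card_nbij' (fun v => (v.1 * r - v.2 * s, v.1 * s + v.2 * r + v.2 * s))
    (fun v => ((v.1 * (r + s) + v.2 * s) / p, (v.2 * r - v.1 * s) / p)) ?_ ?_ ?_ ?_
  · rintro ⟨x, y⟩ h
    simp only [coe_filter, Set.mem_ofPred_eq, mem_coe, mem_RS] at *
    refine ⟨?_, y, ?_⟩
    · push_cast; rw [← h, ← hrs]; ring
    · rw [← hrs]; ring
  · rintro ⟨x, y⟩ h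
    simp only [coe_filter, Set.mem_ofPred_eq, mem_coe, mem_RS] at *
    push_cast at h
    obtain ⟨a, ha⟩ := key x y h.1 h.2
    obtain ⟨h1, b, hb⟩ := h
    rw [ha, hb, Int.mul_ediv_cancel_left _ hp0, Int.mul_ediv_cancel_left _ hp0]
    have : (p : ℤ) * p * (a ^ 2 + a * b + b ^ 2) = p * p * m := by
      have : (x * (r + s) + y * s) ^ 2 + (x * (r + s) + y * s) * (y * r - x * s) + (y * r - x * s) ^ 2 = p * (p * m) := by
        rw [← h1, ← hrs]; ring
      rw [ha, hb] at this
      linear_combination this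
    exact mul_left_cancel₀ (mul_ne_zero hp0 hp0) this
  · rintro ⟨x, y⟩ h
    simp only [Prod.mk.injEq]
    constructor
    · apply Int.ediv_eq_of_eq_mul_right hp0; rw [← hrs]; ring
    · apply Int.ediv_eq_of_eq_mul_right hp0; rw [← hrs]; ring
  · rintro ⟨x, y⟩ h
    simp only [coe_filter, Set.mem_ofPred_eq, mem_coe, mem_RS] at *
    push_cast at h
    obtain ⟨a, ha⟩ := key x y h.1 h.2
    obtain ⟨h1, b, hb⟩ := h
    rw [ha, hb, Int.mul_ediv_cancel_left _ hp0, Int.mul_ediv_cancel_left _ hp0]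
    simp only [Prod.mk.injEq]
    constructor
    · apply mul_left_cancel₀ hp0
      linear_combination (-r) * ha + s * hb + x * hrs
    · apply mul_left_cancel₀ hp0
      linear_combination (-s) * ha - (r + s) * hb + y * hrs

theorem RR_split {p : ℕ} (hp : p.Prime) (h1 : p % 3 = 1) (m : ℕ) :
    RR (p * m) = 2 * RR m - if p ∣ m then RR (m / p) else 0 := by
  have hp0 : (p : ℤ) ≠ 0 := by exact_mod_cast hp.ne_zero
  have hpp : Prime (p : ℤ) := Nat.prime_iff_prime_int.1 hp
  obtain ⟨r, s, hrs⟩ := split_rep hp h1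
  have hA := half hp hrs m
  have hB := half hp (r := r + s) (s := -s) (by rw [← hrs]; ring) m
  rw [← RR_mult hp]
  have hp2 : p ≠ 2 := by rintro rfl; omega
  have n2 : ¬ (p : ℤ) ∣ 2 := by
    intro h
    have : p ∣ 2 := by exact_mod_cast h
    exact hp2 ((Nat.prime_dvd_prime_iff_eq hp Nat.prime_two).1 this)
  have n3 : ¬ (p : ℤ) ∣ 3 := by
    intro h
    have : p ∣ 3 := by exact_mod_cast h
    have := (Nat.prime_dvd_prime_iff_eq hp Nat.prime_three).1 this
    omega
  have ns : ¬ (p : ℤ) ∣ s := by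
    rintro ⟨k, hk⟩
    have hr : (p : ℤ) ∣ r := by
      refine hpp.dvd_of_dvd_pow (n := 2) ⟨1 - r * k - s * k, ?_⟩
      linear_combination hrs - (r + s) * hk
    obtain ⟨l, hl⟩ := hr
    rw [hk, hl] at hrs
    have : (p : ℤ) * (p * (l ^ 2 + l * k + k ^ 2)) = p * 1 := by linear_combination hrs
    have := mul_left_cancel₀ hp0 this
    exact hpp.not_unit (IsUnit.of_mul_eq_one _ this)
  have nr : ¬ (p : ℤ) ∣ 2 * r + s := by
    rintro ⟨k, hk⟩
    have h3 : (p : ℤ) ∣ 3 * s ^ 2 := ⟨4 - (2 * r + s) * k, by linear_combination 4 * hrs - (2 * r + s) * hk⟩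
    rcases hpp.dvd_or_dvd h3 with h | h
    · exact n3 h
    · exact ns (hpp.dvd_of_dvd_pow h)
  have hU : (RS (p * m)).filter (fun v => (p : ℤ) ∣ v.2 * r - v.1 * s) ∪
      (RS (p * m)).filter (fun v => (p : ℤ) ∣ v.2 * (r + s) - v.1 * (-s)) = RS (p * m) := by
    rw [← Finset.filter_or, Finset.filter_eq_self]
    rintro ⟨x, y⟩ hv
    rw [mem_RS] at hv
    dsimp only at *
    push_cast at hv
    apply hpp.dvd_or_dvd
    refine ⟨y ^ 2 - s ^ 2 * m, ?_⟩
    linear_combination y ^ 2 * hrs - s ^ 2 * hv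
  have hI : (RS (p * m)).filter (fun v => (p : ℤ) ∣ v.2 * r - v.1 * s) ∩
      (RS (p * m)).filter (fun v => (p : ℤ) ∣ v.2 * (r + s) - v.1 * (-s)) =
      (RS (p * m)).filter fun v => (p : ℤ) ∣ v.1 ∧ (p : ℤ) ∣ v.2 := by
    rw [← Finset.filter_and]
    apply Finset.filter_congr
    rintro ⟨x, y⟩ hv
    dsimp only
    constructor
    · rintro ⟨h1, h2⟩
      have hy : (p : ℤ) ∣ y := by
        have := dvd_add h1 h2
        have e : y * r - x * s + (y * (r + s) - x * -s) = y * (2 * r + s) := by ring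
        rw [e] at this
        exact (hpp.dvd_or_dvd this).resolve_right nr
      have hx : (p : ℤ) ∣ x := by
        have : (p : ℤ) ∣ y * r - (y * r - x * s) := dvd_sub (Dvd.dvd.mul_right hy r) h1
        have e : y * r - (y * r - x * s) = x * s := by ring
        rw [e] at this
        exact (hpp.dvd_or_dvd this).resolve_right ns
      exact ⟨hx, hy⟩
    · rintro ⟨h1, h2⟩
      exact ⟨dvd_sub (Dvd.dvd.mul_right h2 _) (Dvd.dvd.mul_right h1 _), dvd_sub (Dvd.dvd.mul_right h2 _) (Dvd.dvd.mul_right h1 _)⟩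
  have hc := Finset.card_union_add_card_inter ((RS (p * m)).filter (fun v => (p : ℤ) ∣ v.2 * r - v.1 * s))
      ((RS (p * m)).filter (fun v => (p : ℤ) ∣ v.2 * (r + s) - v.1 * (-s)))
  rw [hU, hI] at hc
  zify at hc
  rw [hA, hB] at hc
  rw [RR]; linarith

theorem RR_eq (m : ℕ) (hm : 0 < m) : RR m = 6 * rh m := by
  induction m using Nat.strong_induction_on with
  | _ m ih =>
    rcases Nat.lt_or_ge 1 m with h | h
    · obtain ⟨p, hp, k, rfl⟩ := Nat.exists_prime_and_dvd h.ne'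
      have hk : 0 < k := Nat.pos_of_mul_pos_left hm
      have hkl : k < p * k := by nlinarith [hp.two_le]
      have i1 := ih k hkl hk
      have i2 : p ∣ k → RR (k / p) = 6 * rh (k / p) := by
        intro hd
        refine ih _ ((Nat.div_le_self _ _).trans_lt hkl) (Nat.div_pos (Nat.le_of_dvd hk hd) hp.pos)
      rw [rh_rec hp]
      have : p % 3 = 0 ∨ p % 3 = 1 ∨ p % 3 = 2 := by omega
      rcases this with h3 | h3 | h3
      · have : p = 3 := ((Nat.prime_dvd_prime_iff_eq Nat.prime_three hp).1 (by omega)).symm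
        subst this
        rw [RR_three, i1]; simp [ps]
      · have hps : ps p = 1 := by unfold ps; rw [if_pos (by omega)]
        rw [RR_split hp h3, hps, i1]
        split_ifs with hd
        · rw [i2 hd]; ring
        · ring
      · have hps : ps p = -1 := by unfold ps; rw [if_neg (by omega), if_pos (by omega)]
        rw [RR_inert hp h3, hps]
        split_ifs with hd
        · rw [i2 hd]; ring
        · ring
    · have : m = 1 := by omega
      subst this
      rw [RR_one, rh_one]; rfl

open PowerSeries in
noncomputable def Aj : ℕ → ℕ → PowerSeries ℤ
  | 0, 0 => 1
  | 0, _ + 1 => 0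
  | n + 1, 0 => (1 + X ^ (2 * n + 2)) * Aj n 0 + X ^ (n + 1) * Aj n 0 - X ^ (n + 1) * Aj n 1
  | n + 1, j + 1 => (1 + X ^ (2 * n + 2)) * Aj n (j + 1) - X ^ (n + 1) * Aj n j - X ^ (n + 1) * Aj n (j + 2)

open PowerSeries in
noncomputable def Qp (k : ℕ) : PowerSeries ℤ := ∏ i ∈ range k, (1 - X ^ (i + 1))

def tj : ℕ → ℕ
  | 0 => 0
  | j + 1 => tj j + (j + 1)

theorem two_tj (j : ℕ) : 2 * tj j = j * (j + 1) := by
  induction j with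
  | zero => rfl
  | succ j ih => rw [tj, mul_add, ih]; ring

theorem Qp_zero : Qp 0 = 1 := by simp [Qp]
theorem Qp_succ (k : ℕ) : Qp (k + 1) = Qp k * (1 - PowerSeries.X ^ (k + 1)) := by
  unfold Qp; rw [Finset.prod_range_succ]

theorem Aj_zero (n : ℕ) : ∀ j, n < j → Aj n j = 0 := by
  induction n with
  | zero => intro j hj; cases j with
    | zero => omega
    | succ j => rfl
  | succ n ih => intro j hj; cases j with
    | zero => omega
    | succ j => rw [Aj, ih _ (by omega), ih _ (by omega), ih _ (by omega)]; ring

open PowerSeries in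
theorem Aj_sum1 (n N : ℕ) : ∑ j ∈ range (N + 1), (2 * (j : PowerSeries ℤ) + 1) * Aj (n + 1) j =
    (1 - X ^ (n + 1)) ^ 2 * ∑ j ∈ range (N + 1), (2 * (j : PowerSeries ℤ) + 1) * Aj n j -
      X ^ (n + 1) * ((2 * (N : PowerSeries ℤ) + 1) * Aj n (N + 1) - (2 * (N : PowerSeries ℤ) + 3) * Aj n N) := by
  induction N with
  | zero => simp [Aj]; ring
  | succ N ih =>
    rw [sum_range_succ, ih, sum_range_succ _ (N + 1), Aj]
    push_cast
    ring

theorem Aj_sum (n : ℕ) : ∑ j ∈ range (n + 1), (2 * (j : PowerSeries ℤ) + 1) * Aj n j = Qp n ^ 2 := by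
  induction n with
  | zero => simp [Aj, Qp_zero]
  | succ n ih =>
    rw [Aj_sum1, Aj_zero n _ (by omega), Aj_zero n _ (by omega), sum_range_succ, Aj_zero n _ (by omega),
      mul_zero, add_zero, ih, Qp_succ]
    ring

open PowerSeries in
theorem Aj_closed (n : ℕ) : ∀ j d, n = j + d →
    Aj n j * Qp (n + 1 + j) * Qp d = (-1) ^ j * X ^ tj j * Qp (2 * n + 1) := by
  induction n with
  | zero =>
    intro j d h
    obtain rfl : j = 0 := by omega
    obtain rfl : d = 0 := by omega
    simp [Aj, tj, Qp_zero]
  | succ n ih =>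
    intro j d h
    have q2 : Qp (2 * (n + 1) + 1) = Qp (2 * n + 1) * (1 - X ^ (2 * n + 2)) * (1 - X ^ (2 * n + 3)) := by
      rw [show 2 * (n + 1) + 1 = 2 * n + 1 + 1 + 1 by ring, Qp_succ, Qp_succ]
    rw [q2]
    rcases j with _ | j
    · obtain rfl : d = n + 1 := by omega
      have e0 := ih 0 n (by omega)
      simp only [tj, pow_zero, add_zero, mul_one, one_mul] at e0 ⊢
      rcases n with _ | n
      · simp [Aj, Qp, Finset.prod_range_succ]; ring
      · have e1 := ih 1 n (by omega)
        simp only [tj, pow_one, zero_add] at e1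
        rw [Aj]
        have k1 : Qp (n + 1 + 1 + 1) = Qp (n + 1 + 1) * (1 - X ^ (n + 1 + 1 + 1)) := Qp_succ _
        have k2 : Qp (n + 1 + 1) = Qp (n + 1) * (1 - X ^ (n + 1 + 1)) := Qp_succ _
        have k3 : Qp (n + 1) = Qp n * (1 - X ^ (n + 1)) := Qp_succ _
        have l0 : Aj (n + 1) 0 * Qp (n + 1 + 1 + 1) * Qp (n + 1 + 1) =
            (1 - X ^ (n + 3)) * (1 - X ^ (n + 2)) * Qp (2 * (n + 1) + 1) := by rw [k1, k2, ← e0, k2]; ring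
        have l1 : Aj (n + 1) 1 * Qp (n + 1 + 1 + 1) * Qp (n + 1 + 1) =
            (1 - X ^ (n + 2)) * (1 - X ^ (n + 1)) * (-1 * X * Qp (2 * (n + 1) + 1)) := by rw [← e1, k2, k3]; ring
        linear_combination (1 + X ^ (2 * (n + 1) + 2) + X ^ (n + 2)) * l0 - X ^ (n + 2) * l1
    · have e1 := ih j (d + 1 - 1 + 0) (by omega)
      simp only [add_zero, Nat.add_sub_cancel] at e1
      have nd : n = j + d := by omega
      have k1 : Qp (n + 1 + 1 + (j + 1)) = Qp (n + 1 + j) * (1 - X ^ (n + 2 + j)) * (1 - X ^ (n + 3 + j)) := by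
        rw [show n + 1 + 1 + (j + 1) = n + 1 + j + 1 + 1 by ring, Qp_succ, Qp_succ]; ring
      have l1 : Aj n j * Qp (n + 1 + 1 + (j + 1)) * Qp d = (1 - X ^ (n + 2 + j)) * (1 - X ^ (n + 3 + j)) *
          ((-1) ^ j * X ^ tj j * Qp (2 * n + 1)) := by rw [k1, ← e1]; ring
      rw [Aj, tj]
      rcases d with _ | d
      · rw [Aj_zero n (j + 1) (by omega), Aj_zero n (j + 2) (by omega)]
        obtain rfl : n = j := by omega
        linear_combination (-X ^ (n + 1)) * l1
      · have e2 := ih (j + 1) d (by omega)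
        have k2 : Qp (d + 1) = Qp d * (1 - X ^ (d + 1)) := Qp_succ _
        have k3 : Qp (n + 1 + 1 + (j + 1)) = Qp (n + 1 + (j + 1)) * (1 - X ^ (n + 3 + j)) := by
          rw [show n + 1 + 1 + (j + 1) = n + 1 + (j + 1) + 1 by ring, Qp_succ]; ring
        have l2 : Aj n (j + 1) * Qp (n + 1 + 1 + (j + 1)) * Qp (d + 1) = (1 - X ^ (d + 1)) * (1 - X ^ (n + 3 + j)) *
          ((-1) ^ (j + 1) * X ^ (tj j + (j + 1)) * Qp (2 * n + 1)) := by
          rw [tj] at e2; rw [k3, k2, ← e2]; ring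
        rcases d with _ | d
        · rw [Aj_zero n (j + 2) (by omega)]
          obtain rfl : n = j + 1 := by omega
          linear_combination (-X ^ (j + 1 + 1)) * l1 + (1 + X ^ (2 * (j + 1) + 2)) * l2
        · have e3 := ih (j + 2) d (by omega)
          have k4 : Qp (d + 1 + 1) = Qp d * (1 - X ^ (d + 1)) * (1 - X ^ (d + 2)) := by rw [Qp_succ, Qp_succ]
          have l3 : Aj n (j + 2) * Qp (n + 1 + 1 + (j + 1)) * Qp (d + 1 + 1) = (1 - X ^ (d + 1)) * (1 - X ^ (d + 2)) *
            ((-1) ^ (j + 2) * X ^ (tj j + (j + 1) + (j + 2)) * Qp (2 * n + 1)) := by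
            rw [tj, tj] at e3
            rw [k4, show n + 1 + 1 + (j + 1) = n + 1 + (j + 2) by ring]
            linear_combination (1 - X ^ (d + 1)) * (1 - X ^ (d + 2)) * e3
          subst nd
          linear_combination (-X ^ (j + (d + 1 + 1) + 1)) * l1 + (1 + X ^ (2 * (j + (d + 1 + 1)) + 2)) * l2 - X ^ (j + (d + 1 + 1) + 1) * l3

open PowerSeries in
theorem Qp_unit (k : ℕ) : IsUnit (Qp k) := by
  rw [isUnit_iff_constantCoeff]
  unfold Qp
  rw [map_prod]
  simp

open PowerSeries in
theorem Qp_cong (k e : ℕ) : X ^ (k + 1) ∣ Qp (k + e) - Qp k := by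
  induction e with
  | zero => simp
  | succ e ih =>
    rw [← add_assoc, Qp_succ]
    have : Qp (k + e) * (1 - X ^ (k + e + 1)) - Qp k = (Qp (k + e) - Qp k) - X ^ (k + 1) * (X ^ e * Qp (k + e)) := by ring
    rw [this]
    exact dvd_sub ih (Dvd.intro _ rfl)

open PowerSeries in
theorem Aj_cong (j d : ℕ) : X ^ (j + d + 1) ∣ Aj (j + d) j * Qp (j + d) - (-1) ^ j * X ^ tj j := by
  set n := j + d with hn
  have h := Aj_closed n j d hn
  obtain ⟨a, ha⟩ := Qp_cong n (1 + j)
  obtain ⟨b, hb⟩ := Qp_cong n (n + 1)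
  obtain ⟨c, hc⟩ := Qp_cong d j
  rw [show n + (1 + j) = n + 1 + j by ring] at ha
  rw [show n + (n + 1) = 2 * n + 1 by ring] at hb
  rw [show d + j = n by rw [hn]; ring] at hc
  have h1 : X ^ (n + 1) ∣ Aj n j * Qp d - (-1) ^ j * X ^ tj j := by
    rw [← (Qp_unit n).dvd_mul_right]
    refine ⟨(-1) ^ j * X ^ tj j * b - Aj n j * Qp d * a, ?_⟩
    linear_combination h - Aj n j * Qp d * ha + (-1) ^ j * X ^ tj j * hb
  have h2 : X ^ tj j ∣ Aj n j := by
    have : X ^ tj j ∣ Aj n j * (Qp (n + 1 + j) * Qp d) := ⟨(-1) ^ j * Qp (2 * n + 1), by linear_combination h⟩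
    rwa [((Qp_unit _).mul (Qp_unit _)).dvd_mul_right] at this
  obtain ⟨e, he⟩ := h2
  have h3 : X ^ (n + 1) ∣ Aj n j * (Qp n - Qp d) := by
    rw [hc, he]
    have : n + 1 ≤ tj j + (d + 1) := by
      have := two_tj j
      nlinarith [sq_nonneg ((j : ℤ) - 1), Nat.zero_le j, (show j ≤ j * j by exact Nat.le_mul_self j)]
    have : X ^ (n + 1) ∣ (X : PowerSeries ℤ) ^ (tj j + (d + 1)) := pow_dvd_pow _ this
    have e2 : X ^ tj j * e * (X ^ (d + 1) * c) = X ^ (tj j + (d + 1)) * (e * c) := by ring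
    rw [e2]
    exact Dvd.dvd.mul_right this _
  have e3 : Aj n j * Qp n - (-1) ^ j * X ^ tj j = (Aj n j * Qp d - (-1) ^ j * X ^ tj j) + Aj n j * (Qp n - Qp d) := by ring
  rw [e3]
  exact dvd_add h1 h3

open PowerSeries in
theorem jacobi (n : ℕ) : X ^ (n + 1) ∣ Qp n ^ 3 -
    ∑ j ∈ range (n + 1), (2 * (j : PowerSeries ℤ) + 1) * ((-1) ^ j * X ^ tj j) := by
  have : Qp n ^ 3 - ∑ j ∈ range (n + 1), (2 * (j : PowerSeries ℤ) + 1) * ((-1) ^ j * X ^ tj j) =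
    ∑ j ∈ range (n + 1), (2 * (j : PowerSeries ℤ) + 1) * (Aj n j * Qp n - (-1) ^ j * X ^ tj j) := by
    rw [pow_succ, ← Aj_sum, Finset.sum_mul, ← sum_sub_distrib]
    refine sum_congr rfl fun j _ => by ring
  rw [this]
  refine Finset.dvd_sum fun j hj => ?_
  rw [mem_range] at hj
  obtain ⟨d, rfl⟩ := Nat.exists_eq_add_of_le (show j ≤ n by omega)
  exact Dvd.dvd.mul_left (Aj_cong j d) _

theorem Qp_subset (n : ℕ) (s : Finset ℕ) (h : range n ⊆ s) :
    (PowerSeries.X ^ (n + 1) : PowerSeries ℤ) ∣ ∏ i ∈ s, (1 - PowerSeries.X ^ (i + 1)) - Qp n := by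
  have key : ∀ t : Finset ℕ, (∀ i ∈ t, n ≤ i) →
      (PowerSeries.X ^ (n + 1) : PowerSeries ℤ) ∣ ∏ i ∈ t, (1 - PowerSeries.X ^ (i + 1)) - 1 := by
    intro t
    induction t using Finset.induction_on with
    | empty => simp
    | insert a t ha ih =>
      intro ht
      rw [Finset.prod_insert ha]
      have h1 := ih fun i hi => ht i (Finset.mem_insert_of_mem hi)
      have h2 : (PowerSeries.X ^ (n + 1) : PowerSeries ℤ) ∣ PowerSeries.X ^ (a + 1) :=
        pow_dvd_pow _ (by have := ht a (Finset.mem_insert_self _ _); omega)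
      have e : (1 - PowerSeries.X ^ (a + 1)) * ∏ i ∈ t, (1 - PowerSeries.X ^ (i + 1)) - 1 =
        (∏ i ∈ t, (1 - PowerSeries.X ^ (i + 1)) - 1) - PowerSeries.X ^ (a + 1) * ∏ i ∈ t, (1 - PowerSeries.X ^ (i + 1) : PowerSeries ℤ) := by ring
      rw [e]
      exact dvd_sub h1 (Dvd.dvd.mul_right h2 _)
  rw [← Finset.prod_sdiff h]
  have e : (∏ i ∈ s \ range n, (1 - PowerSeries.X ^ (i + 1) : PowerSeries ℤ)) *
      ∏ i ∈ range n, (1 - PowerSeries.X ^ (i + 1)) - Qp n =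
      (∏ i ∈ s \ range n, (1 - PowerSeries.X ^ (i + 1) : PowerSeries ℤ) - 1) * Qp n := by
    unfold Qp; ring
  rw [e]
  refine Dvd.dvd.mul_right (key _ fun i hi => ?_) _
  rw [Finset.mem_sdiff, mem_range] at hi
  omega

theorem le_pent (k : ℤ) : |k| ≤ (pentagonal k : ℤ) := by
  have h := two_mul_natCast_pentagonal k
  rcases abs_cases k with ⟨h1, h2⟩ | ⟨h1, h2⟩
  · rw [h1]
    rcases eq_or_lt_of_le h2 with h3 | h3
    · rw [← h3]; positivity
    · nlinarith
  · rw [h1]; nlinarith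

def ng (k : ℤ) : ℤ := ((Int.negOnePow k : ℤˣ) : ℤ)

theorem euler (n : ℕ) : (PowerSeries.X ^ (n + 1) : PowerSeries ℤ) ∣ Qp n -
    ∑ k ∈ Icc (-(n : ℤ)) n, PowerSeries.C (ng k) * PowerSeries.X ^ (pentagonal k) := by
  rw [PowerSeries.X_pow_dvd_iff]
  intro i hi
  have h1 : PowerSeries.coeff i (Qp n) = (PowerSeries.pentagonalSeries ℤ).coeff i := by
    obtain ⟨s, hs⟩ := Filter.eventually_atTop.1 (PowerSeries.coeff_prod_one_sub_X_pow_eventually_eq ℤ i)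
    rw [← hs (s ∪ range n) Finset.subset_union_left]
    have := Qp_subset n (s ∪ range n) Finset.subset_union_right
    rw [PowerSeries.X_pow_dvd_iff] at this
    have := this i hi
    rw [map_sub] at this
    linarith
  rw [map_sub, h1, map_sum, sub_eq_zero]
  simp only [PowerSeries.coeff_C_mul, PowerSeries.coeff_X_pow]
  by_cases h : i ∈ Set.range pentagonal
  · obtain ⟨k, rfl⟩ := h
    rw [PowerSeries.coeff_pentagonalSeries_pentagonal]
    rw [Finset.sum_eq_single k]
    · rw [if_pos rfl, mul_one, ng]; simp only [Int.cast_id]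
    · intro b _ hb
      rw [if_neg, mul_zero]
      intro h
      exact hb (pentagonal_injective h).symm
    · intro hk
      exfalso
      apply hk
      rw [mem_Icc]
      have := le_pent k
      have := abs_le.1 this
      omega
  · rw [PowerSeries.coeff_pentagonalSeries_eq_zero ℤ h]
    symm
    refine sum_eq_zero fun k _ => ?_
    rw [if_neg, mul_zero]
    rintro rfl
    exact h ⟨k, rfl⟩

theorem eta_Q (m : ℕ) : etaCoeff (3 * m + 1) = PowerSeries.coeff m (Qp (3 * m + 1) ^ 8) := by
  unfold etaCoeff
  rw [Polynomial.coeff_X_mul]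
  have e : (∏ k ∈ Icc 1 (3 * m + 1), (1 - Polynomial.X ^ (3 * k)) ^ 8 : Polynomial ℤ) =
     Polynomial.expand ℤ 3 ((∏ i ∈ range (3 * m + 1), (1 - Polynomial.X ^ (i + 1))) ^ 8) := by
    rw [map_pow, map_prod, Finset.prod_pow, show Icc 1 (3 * m + 1) = Ico 1 (3 * m + 1 + 1) from rfl, Finset.prod_Ico_eq_prod_range]
    congr 1
    simp only [Nat.add_sub_cancel]
    refine Finset.prod_congr rfl fun i _ => ?_
    rw [map_sub, map_one, map_pow, Polynomial.expand_X, ← pow_mul, add_comm 1 i]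
  rw [e, Polynomial.coeff_expand_mul' (by norm_num), ← Polynomial.coeff_coe]
  congr 2
  rw [Polynomial.coe_pow]
  congr 1
  unfold Qp
  rw [← Polynomial.coeToPowerSeries.ringHom_apply, map_prod]
  refine Finset.prod_congr rfl fun i _ => ?_
  simp

/-- index set -/
noncomputable def ES (m : ℕ) : Finset (ℕ × ℕ × ℤ × ℤ) :=
  (range (3 * m + 2) ×ˢ range (3 * m + 2) ×ˢ
    Icc (-((3 * m + 1 : ℕ) : ℤ)) ((3 * m + 1 : ℕ) : ℤ) ×ˢ Icc (-((3 * m + 1 : ℕ) : ℤ)) ((3 * m + 1 : ℕ) : ℤ)).filter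
    fun x => tj x.1 + tj x.2.1 + pentagonal x.2.2.1 + pentagonal x.2.2.2 = m

theorem mem_ES {m : ℕ} {x : ℕ × ℕ × ℤ × ℤ} : x ∈ ES m ↔
    tj x.1 + tj x.2.1 + pentagonal x.2.2.1 + pentagonal x.2.2.2 = m := by
  unfold ES
  rw [mem_filter]
  refine ⟨fun h => h.2, fun h => ⟨?_, h⟩⟩
  obtain ⟨a, b, c, d⟩ := x
  simp only [mem_product, mem_range, mem_Icc] at *
  have h1 := two_tj a
  have h2 := two_tj b
  have h3 := abs_le.1 (le_pent c)
  have h4 := abs_le.1 (le_pent d)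
  have h5 : a ≤ a * a := Nat.le_mul_self a
  have h6 : b ≤ b * b := Nat.le_mul_self b
  rw [mul_add] at h1 h2
  refine ⟨by omega, by omega, by omega, by omega⟩

theorem eta_sum (m : ℕ) : etaCoeff (3 * m + 1) =
    ∑ x ∈ ES m, (2 * (x.1 : ℤ) + 1) * (-1) ^ x.1 * ((2 * (x.2.1 : ℤ) + 1) * (-1) ^ x.2.1) * (ng x.2.2.1 * ng x.2.2.2) := by
  rw [eta_Q]
  set N := 3 * m + 1 with hN
  set J : PowerSeries ℤ := ∑ j ∈ range (N + 1), PowerSeries.C ((2 * (j : ℤ) + 1) * (-1) ^ j) * PowerSeries.X ^ tj j with hJ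
  set E : PowerSeries ℤ := ∑ k ∈ Icc (-(N : ℤ)) N, PowerSeries.C (ng k) * PowerSeries.X ^ (pentagonal k) with hE
  have h1 : (PowerSeries.X ^ (N + 1) : PowerSeries ℤ) ∣ Qp N ^ 3 - J := by
    convert jacobi N using 2
    rw [hJ]
    refine sum_congr rfl fun j _ => ?_
    simp [mul_assoc]
  have h2 := euler N
  have h3 : (PowerSeries.X ^ (N + 1) : PowerSeries ℤ) ∣ Qp N ^ 8 - J * J * (E * E) := by
    obtain ⟨a, ha⟩ := h1
    obtain ⟨b, hb⟩ := h2
    refine ⟨a * (Qp N ^ 3 + J) * Qp N ^ 2 + J * J * b * (Qp N + E), ?_⟩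
    linear_combination (Qp N ^ 3 + J) * Qp N ^ 2 * ha + J * J * (Qp N + E) * hb
  rw [PowerSeries.X_pow_dvd_iff] at h3
  have h4 := h3 m (by omega)
  rw [map_sub, sub_eq_zero] at h4
  rw [h4, hJ, hE, Finset.sum_mul_sum, Finset.sum_mul_sum, ← Finset.sum_product', ← Finset.sum_product', Finset.sum_mul_sum,
    ← Finset.sum_product', map_sum]
  unfold ES
  rw [sum_filter]
  refine sum_nbij' (fun y => (y.1.1, y.1.2, y.2.1, y.2.2)) (fun x => ((x.1, x.2.1), (x.2.2.1, x.2.2.2))) ?_ ?_ ?_ ?_ ?_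
  · rintro ⟨⟨a, b⟩, c, d⟩ h
    simp only [mem_product] at *
    tauto
  · rintro ⟨a, b, c, d⟩ h
    simp only [mem_product] at *
    tauto
  · intro y _; rfl
  · intro y _; rfl
  · rintro ⟨⟨a, b⟩, c, d⟩ h
    dsimp only
    have : (PowerSeries.C ((2 * (a : ℤ) + 1) * (-1) ^ a) * PowerSeries.X ^ tj a * (PowerSeries.C ((2 * (b : ℤ) + 1) * (-1) ^ b) * PowerSeries.X ^ tj b) *
      (PowerSeries.C (ng c) * PowerSeries.X ^ pentagonal c * (PowerSeries.C (ng d) * PowerSeries.X ^ pentagonal d))) =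
      PowerSeries.C ((2 * (a : ℤ) + 1) * (-1) ^ a * ((2 * (b : ℤ) + 1) * (-1) ^ b) * (ng c * ng d)) *
        PowerSeries.X ^ (tj a + tj b + pentagonal c + pentagonal d) := by
      simp only [map_mul, pow_add]; ring
    rw [this, PowerSeries.coeff_C_mul, PowerSeries.coeff_X_pow]
    by_cases hm : m = tj a + tj b + pentagonal c + pentagonal d
    · rw [if_pos hm, if_pos hm.symm, mul_one]
    · rw [if_neg hm, if_neg (fun h => hm h.symm), mul_zero]

noncomputable def VV (n : ℕ) : Finset V4 :=
  (Icc (-(2 * n : ℤ)) (2 * n) ×ˢ Icc (-(2 * n : ℤ)) (2 * n) ×ˢ Icc (-(2 * n : ℤ)) (2 * n) ×ˢ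
    Icc (-(2 * n : ℤ)) (2 * n)).filter
    fun q => q.1 ^ 2 + 3 * q.2.1 ^ 2 + q.2.2.1 ^ 2 + 3 * q.2.2.2 ^ 2 = 4 * n

theorem mem_VV {n : ℕ} {q : V4} : q ∈ VV n ↔ q.1 ^ 2 + 3 * q.2.1 ^ 2 + q.2.2.1 ^ 2 + 3 * q.2.2.2 ^ 2 = 4 * n := by
  unfold VV
  rw [mem_filter]
  refine ⟨fun h => h.2, fun h => ⟨?_, h⟩⟩
  obtain ⟨a, b, c, d⟩ := q
  simp only [mem_product, mem_Icc] at *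
  have key : ∀ x : ℤ, x ^ 2 ≤ 4 * n → -(2 * n : ℤ) ≤ x ∧ x ≤ 2 * n := by
    intro x hx
    have h1 : (n : ℤ) ≤ n * n := by exact_mod_cast Nat.le_mul_self n
    exact abs_le.1 (abs_le_of_sq_le_sq (show x ^ 2 ≤ (2 * (n : ℤ)) ^ 2 by nlinarith) (by positivity))
  refine ⟨key a ?_, key b ?_, key c ?_, key d ?_⟩ <;> nlinarith [sq_nonneg a, sq_nonneg b, sq_nonneg c, sq_nonneg d]

def sj (j : ℕ) : ℤ := if j % 2 = 0 then 2 * j + 1 else -(2 * j + 1)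

theorem sj_eq (j : ℕ) : (2 * (j : ℤ) + 1) * (-1) ^ j = sj j := by
  unfold sj
  rcases Nat.even_or_odd j with h | h
  · rw [h.neg_one_pow, if_pos (Nat.even_iff.1 h)]; ring
  · rw [h.neg_one_pow, if_neg (by rw [Nat.odd_iff.1 h]; decide)]; ring

theorem sj_mod (j : ℕ) : sj j % 4 = 1 := by unfold sj; split_ifs <;> omega
theorem sj_sq (j : ℕ) : sj j ^ 2 = 8 * tj j + 1 := by
  have h : (2 : ℤ) * tj j = j * (j + 1) := by exact_mod_cast two_tj j
  unfold sj; split_ifs <;> linear_combination (-4) * h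
theorem sj_abs (j : ℕ) : ((sj j).natAbs - 1) / 2 = j := by unfold sj; split_ifs <;> omega
theorem sj_inv {x : ℤ} (h : x % 4 = 1) : sj ((x.natAbs - 1) / 2) = x := by unfold sj; split_ifs <;> omega

def se (x : ℤ) : ℤ := if x % 2 = 0 then 1 else -1

theorem ng_eq (k : ℤ) : ng k = se k := by
  unfold ng se
  rcases Int.even_or_odd k with h | h
  · rw [Int.negOnePow_even k h, if_pos (Int.even_iff.1 h)]; rfl
  · rw [Int.negOnePow_odd k h, if_neg (by rw [Int.odd_iff.1 h]; decide)]; rfl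

theorem se_mul (c d : ℤ) : se c * se d = se (3 * (c - d)) := by
  unfold se; split_ifs <;> first | rfl | (exfalso; omega)

abbrev PP (q : V4) : Prop := q.2.1 % 2 = 1 ∧ (q.2.1 + q.2.2.2) % 4 = 1 ∧ q.1 % 3 = 2 ∧ q.2.2.1 % 3 = 0 ∧ (q.1 + q.2.2.1) % 2 = 1

theorem stepA (m : ℕ) : etaCoeff (3 * m + 1) =
    ∑ q ∈ VV (3 * m + 1) with PP q, (q.2.1 ^ 2 - q.2.2.2 ^ 2) * se q.2.2.1 := by
  rw [eta_sum]
  simp only [sj_eq, ng_eq]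
  refine sum_nbij' (fun x => (3 * (x.2.2.1 + x.2.2.2) - 1, (sj x.1 + sj x.2.1) / 2, 3 * (x.2.2.1 - x.2.2.2), (sj x.1 - sj x.2.1) / 2))
    (fun q => (((q.2.1 + q.2.2.2).natAbs - 1) / 2, ((q.2.1 - q.2.2.2).natAbs - 1) / 2, (q.1 + q.2.2.1 + 1) / 6, (q.1 - q.2.2.1 + 1) / 6))
    ?_ ?_ ?_ ?_ ?_
  · rintro ⟨a, b, c, d⟩ h
    rw [mem_ES] at h
    rw [mem_filter, mem_VV, PP]
    dsimp only at *
    have h1 := sj_mod a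
    have h2 := sj_mod b
    have h3 := sj_sq a
    have h4 := sj_sq b
    have h5 := two_mul_natCast_pentagonal c
    have h6 := two_mul_natCast_pentagonal d
    have h' : (tj a + tj b + pentagonal c + pentagonal d : ℤ) = m := by exact_mod_cast h
    obtain ⟨u, hu⟩ : ∃ u, sj a + sj b = 2 * u := ⟨(sj a + sj b) / 2, by omega⟩
    obtain ⟨v, hv⟩ : ∃ v, sj a - sj b = 2 * v := ⟨(sj a - sj b) / 2, by omega⟩
    have e1 : sj a = u + v := by omega
    have e2 : sj b = u - v := by omega
    have e3 : (sj a + sj b) / 2 = u := by omega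
    have e4 : (sj a - sj b) / 2 = v := by omega
    rw [e3, e4]
    rw [e1] at h1 h3
    rw [e2] at h2 h4
    refine ⟨?_, by omega, by omega, by omega, by omega, by omega⟩
    push_cast
    have g : 2 * ((3 * (c + d) - 1) ^ 2 + 3 * u ^ 2 + (3 * (c - d)) ^ 2 + 3 * v ^ 2) = 2 * (4 * (3 * (m : ℤ) + 1)) := by
      linear_combination 3 * h3 + 3 * h4 - 12 * h5 - 12 * h6 + 24 * h'
    linarith
  · rintro ⟨A, B, C, D⟩ h
    rw [mem_filter, mem_VV, PP] at h
    rw [mem_ES]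
    dsimp only at *
    obtain ⟨h, h1, h2, h3, h4, h5⟩ := h
    obtain ⟨c, hc⟩ : ∃ c, A + C + 1 = 6 * c := ⟨(A + C + 1) / 6, by omega⟩
    obtain ⟨d, hd⟩ : ∃ d, A - C + 1 = 6 * d := ⟨(A - C + 1) / 6, by omega⟩
    have e1 : (A + C + 1) / 6 = c := by omega
    have e2 : (A - C + 1) / 6 = d := by omega
    rw [e1, e2]
    have g3 := sj_sq (((B + D).natAbs - 1) / 2)
    have g4 := sj_sq (((B - D).natAbs - 1) / 2)
    rw [sj_inv (by omega)] at g3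
    rw [sj_inv (by omega)] at g4
    have g5 := two_mul_natCast_pentagonal c
    have g6 := two_mul_natCast_pentagonal d
    obtain rfl : A = 3 * (c + d) - 1 := by omega
    obtain rfl : C = 3 * (c - d) := by omega
    zify
    push_cast at h
    generalize (tj (((B + D).natAbs - 1) / 2) : ℤ) = t1 at *
    generalize (tj (((B - D).natAbs - 1) / 2) : ℤ) = t2 at *
    have : 24 * (t1 + t2 + (pentagonal c : ℤ) + pentagonal d) = 24 * m := by
      linear_combination (-3) * g3 + (-3) * g4 + 12 * g5 + 12 * g6 + 2 * h
    linarith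
  · rintro ⟨a, b, c, d⟩ h
    dsimp only
    have h1 := sj_mod a
    have h2 := sj_mod b
    have e3 : (sj a + sj b) / 2 + (sj a - sj b) / 2 = sj a := by omega
    have e4 : (sj a + sj b) / 2 - (sj a - sj b) / 2 = sj b := by omega
    rw [e3, e4, sj_abs, sj_abs]
    simp only [Prod.mk.injEq, true_and]
    omega
  · rintro ⟨A, B, C, D⟩ h
    rw [mem_filter, mem_VV, PP] at h
    dsimp only at *
    obtain ⟨h, h1, h2, h3, h4, h5⟩ := h
    rw [sj_inv (by omega), sj_inv (by omega)]
    simp only [Prod.mk.injEq]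
    omega
  · rintro ⟨a, b, c, d⟩ h
    dsimp only
    rw [se_mul]
    have h1 := sj_mod a
    have h2 := sj_mod b
    obtain ⟨u, hu⟩ : ∃ u, sj a + sj b = 2 * u := ⟨(sj a + sj b) / 2, by omega⟩
    obtain ⟨v, hv⟩ : ∃ v, sj a - sj b = 2 * v := ⟨(sj a - sj b) / 2, by omega⟩
    have e1 : sj a = u + v := by omega
    have e2 : sj b = u - v := by omega
    have e3 : (sj a + sj b) / 2 = u := by omega
    have e4 : (sj a - sj b) / 2 = v := by omega
    rw [e3, e4, e1, e2]; ring

theorem symV {n : ℕ} (φ : V4 → V4) (h1 : ∀ q, φ (φ q) = q) (h2 : ∀ q, q ∈ VV n → φ q ∈ VV n) (f : V4 → ℤ) :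
    ∑ q ∈ VV n, f (φ q) = ∑ q ∈ VV n, f q :=
  sum_nbij' φ φ h2 h2 (fun q _ => h1 q) (fun q _ => h1 q) (fun _ _ => rfl)

theorem symV1 {n : ℕ} (f : V4 → ℤ) : ∑ q ∈ VV n, f (-q.1, q.2.1, q.2.2.1, q.2.2.2) = ∑ q ∈ VV n, f q := by
  refine symV (fun q => (-q.1, q.2.1, q.2.2.1, q.2.2.2)) ?_ ?_ f
  · rintro ⟨a, b, c, d⟩; simp
  · rintro ⟨a, b, c, d⟩ h; rw [mem_VV] at *; rw [← h]; dsimp only; ring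

theorem symV2 {n : ℕ} (f : V4 → ℤ) : ∑ q ∈ VV n, f (q.1, -q.2.1, q.2.2.1, -q.2.2.2) = ∑ q ∈ VV n, f q := by
  refine symV (fun q => (q.1, -q.2.1, q.2.2.1, -q.2.2.2)) ?_ ?_ f
  · rintro ⟨a, b, c, d⟩; simp
  · rintro ⟨a, b, c, d⟩ h; rw [mem_VV] at *; rw [← h]; dsimp only; ring

theorem symV3 {n : ℕ} (f : V4 → ℤ) : ∑ q ∈ VV n, f (q.1, q.2.2.2, q.2.2.1, q.2.1) = ∑ q ∈ VV n, f q := by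
  refine symV (fun q => (q.1, q.2.2.2, q.2.2.1, q.2.1)) ?_ ?_ f
  · rintro ⟨a, b, c, d⟩; simp
  · rintro ⟨a, b, c, d⟩ h; rw [mem_VV] at *; rw [← h]; dsimp only; ring

abbrev LL (q : V4) : Prop := (q.1 - q.2.1) % 2 = 0 ∧ (q.2.2.1 - q.2.2.2) % 2 = 0 ∧ q.2.2.1 % 3 = 0

def ff (q : V4) : ℤ := q.2.1 ^ 2 - q.2.2.2 ^ 2

theorem stepB {m : ℕ} (hm : m % 2 = 0) : 4 * etaCoeff (3 * m + 1) = ∑ q ∈ VV (3 * m + 1) with LL q, ff q := by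
  rw [stepA, sum_filter, sum_filter]
  set n := 3 * m + 1 with hn
  set w : V4 → ℤ := fun q => if PP q then (q.2.1 ^ 2 - q.2.2.2 ^ 2) * se q.2.2.1 else 0 with hw
  have a1 := symV1 (n := n) w
  have a2 := symV2 (n := n) w
  have a3 := symV2 (n := n) (fun q => w (-q.1, q.2.1, q.2.2.1, q.2.2.2))
  dsimp only at a3
  set w2 : V4 → ℤ := fun q => if q.2.1 % 2 = 1 ∧ q.2.2.2 % 2 = 0 ∧ q.2.2.1 % 3 = 0 ∧ (q.1 + q.2.2.1) % 2 = 1 then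
     ff q * se q.2.2.1 else 0 with hw2
  have b1 : ∑ q ∈ VV n, w2 q = ∑ q ∈ VV n, (w q + w (-q.1, q.2.1, q.2.2.1, q.2.2.2) + w (q.1, -q.2.1, q.2.2.1, -q.2.2.2)
      + w (-q.1, -q.2.1, q.2.2.1, -q.2.2.2)) := by
    refine sum_congr rfl ?_
    rintro ⟨A, B, C, D⟩ h
    rw [mem_VV] at h
    dsimp only at h
    simp only [hw, hw2, PP, ff]
    have h0 : C % 3 = 0 → A % 3 ≠ 0 := by
      intro hC hA
      obtain ⟨a, rfl⟩ : ∃ a, A = 3 * a := ⟨A / 3, by omega⟩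
      obtain ⟨c, rfl⟩ : ∃ c, C = 3 * c := ⟨C / 3, by omega⟩
      push_cast [hn] at h
      have : 3 * (3 * a ^ 2 + B ^ 2 + 3 * c ^ 2 + D ^ 2) = 4 * (3 * m + 1) := by linarith
      omega
    by_cases g : B % 2 = 1 ∧ D % 2 = 0 ∧ C % 3 = 0 ∧ (A + C) % 2 = 1
    · have h00 := h0 g.2.2.1
      rw [if_pos g]
      have i1 : (B + D) % 4 = 1 ∨ (B + D) % 4 = 3 := by omega
      have i2 : A % 3 = 1 ∨ A % 3 = 2 := by omega
      rcases i1 with i1 | i1 <;> rcases i2 with i2 | i2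
      · rw [if_neg (by omega), if_pos (by omega), if_neg (by omega), if_neg (by omega)]; ring
      · rw [if_pos (by omega), if_neg (by omega), if_neg (by omega), if_neg (by omega)]; ring
      · rw [if_neg (by omega), if_neg (by omega), if_neg (by omega), if_pos (by omega)]; ring
      · rw [if_neg (by omega), if_neg (by omega), if_pos (by omega), if_neg (by omega)]; ring
    · rw [if_neg g, if_neg (by omega), if_neg (by omega), if_neg (by omega), if_neg (by omega)]; ring
  rw [sum_add_distrib, sum_add_distrib, sum_add_distrib] at b1
  set w3 : V4 → ℤ := fun q => if q.2.1 % 2 = 1 ∧ q.2.2.2 % 2 = 0 ∧ q.2.2.1 % 3 = 0 ∧ q.1 % 2 = 1 ∧ q.2.2.1 % 2 = 0 then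
     ff q else 0 with hw3
  set w4 : V4 → ℤ := fun q => if q.2.1 % 2 = 0 ∧ q.2.2.2 % 2 = 1 ∧ q.2.2.1 % 3 = 0 ∧ q.1 % 2 = 0 ∧ q.2.2.1 % 2 = 1 then
     ff q else 0 with hw4
  set w5 : V4 → ℤ := fun q => if q.2.1 % 2 = 0 ∧ q.2.2.2 % 2 = 0 ∧ q.2.2.1 % 3 = 0 ∧ q.1 % 2 = 0 ∧ q.2.2.1 % 2 = 0 then
     ff q else 0 with hw5
  have b2 : ∑ q ∈ VV n, w2 q = ∑ q ∈ VV n, (w3 q + w4 (q.1, q.2.2.2, q.2.2.1, q.2.1)) := by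
    refine sum_congr rfl ?_
    rintro ⟨A, B, C, D⟩ h
    simp only [hw2, hw3, hw4, ff, se]
    by_cases g : B % 2 = 1 ∧ D % 2 = 0 ∧ C % 3 = 0 ∧ (A + C) % 2 = 1
    · rw [if_pos g]
      have i1 : C % 2 = 0 ∨ C % 2 = 1 := by omega
      rcases i1 with i1 | i1
      · rw [if_pos i1, if_pos (by omega), if_neg (by omega)]; ring
      · rw [if_neg (by omega), if_neg (by omega), if_pos (by omega)]; ring
    · rw [if_neg g, if_neg (by omega), if_neg (by omega)]; ring
  rw [sum_add_distrib, symV3 w4] at b2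
  have b3 : ∑ q ∈ VV n, w5 q = 0 := by
    have c1 := symV3 (n := n) w5
    have c2 : ∑ q ∈ VV n, w5 (q.1, q.2.2.2, q.2.2.1, q.2.1) = - ∑ q ∈ VV n, w5 q := by
      rw [← Finset.sum_neg_distrib]
      refine sum_congr rfl ?_
      rintro ⟨A, B, C, D⟩ h
      simp only [hw5, ff]
      by_cases g : B % 2 = 0 ∧ D % 2 = 0 ∧ C % 3 = 0 ∧ A % 2 = 0 ∧ C % 2 = 0
      · rw [if_pos g, if_pos (by omega)]; ring
      · rw [if_neg g, if_neg (by omega)]; ring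
    omega
  have b4 : ∑ q ∈ VV n, (if LL q then ff q else 0) = ∑ q ∈ VV n, (w3 q + w4 q + w5 q) := by
    refine sum_congr rfl ?_
    rintro ⟨A, B, C, D⟩ h
    rw [mem_VV] at h
    dsimp only at h
    simp only [LL, hw3, hw4, hw5, ff]
    have h0 : ¬ (A % 2 = 1 ∧ B % 2 = 1 ∧ C % 2 = 1 ∧ D % 2 = 1) := by
      rintro ⟨h1, h2, h3, h4⟩
      have sq : ∀ x : ℤ, x % 2 = 1 → x ^ 2 % 8 = 1 := by
        intro x hx
        have : x % 8 = 1 ∨ x % 8 = 3 ∨ x % 8 = 5 ∨ x % 8 = 7 := by omega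
        rcases this with h | h | h | h <;> simp [pow_two, Int.mul_emod, h]
      have := sq _ h1
      have := sq _ h2
      have := sq _ h3
      have := sq _ h4
      push_cast [hn] at h
      omega
    by_cases g : (A - B) % 2 = 0 ∧ (C - D) % 2 = 0 ∧ C % 3 = 0
    · rw [if_pos g]
      have i1 : B % 2 = 0 ∨ B % 2 = 1 := by omega
      have i2 : D % 2 = 0 ∨ D % 2 = 1 := by omega
      rcases i1 with i1 | i1 <;> rcases i2 with i2 | i2
      · rw [if_neg (by omega), if_neg (by omega), if_pos (by omega)]; ring
      · rw [if_neg (by omega), if_pos (by omega), if_neg (by omega)]; ring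
      · rw [if_pos (by omega), if_neg (by omega), if_neg (by omega)]; ring
      · exfalso; omega
    · rw [if_neg g, if_neg (by omega), if_neg (by omega), if_neg (by omega)]; ring
  rw [sum_add_distrib, sum_add_distrib] at b4
  rw [b4]
  linarith

theorem rotR {m : ℕ} (f : ℤ × ℤ → ℤ) : ∑ v ∈ RS m, f (-v.1 - v.2, v.1) = ∑ v ∈ RS m, f v := by
  refine sum_nbij' (fun v => (-v.1 - v.2, v.1)) (fun v => (v.2, -v.1 - v.2)) ?_ ?_ ?_ ?_ ?_
  · rintro ⟨x, y⟩ h; rw [mem_RS] at *; rw [← h]; dsimp only; ring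
  · rintro ⟨x, y⟩ h; rw [mem_RS] at *; rw [← h]; dsimp only; ring
  · rintro ⟨x, y⟩ h; simp
  · rintro ⟨x, y⟩ h; simp only [Prod.mk.injEq, true_and, and_true]; omega
  · intro _ _; rfl

theorem sumy (m : ℕ) : 3 * ∑ v ∈ RS m, v.2 ^ 2 = 2 * m * RR m := by
  have h1 := rotR (m := m) (fun v => v.2 ^ 2)
  have h2 := rotR (m := m) (fun v => v.1 ^ 2)
  dsimp only at h1 h2
  have h3 : ∑ v ∈ RS m, (v.2 ^ 2 + v.1 ^ 2 + (-v.1 - v.2) ^ 2) = 2 * m * RR m := by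
    rw [RR, sum_congr rfl (g := fun _ => 2 * (m : ℤ))]
    · rw [Finset.sum_const, nsmul_eq_mul]; ring
    · rintro ⟨x, y⟩ h; rw [mem_RS] at h; rw [← h]; dsimp only; ring
  rw [sum_add_distrib, sum_add_distrib] at h3
  linarith

theorem sumz (m : ℕ) : 3 * ∑ v ∈ RS m, (2 * v.1 + v.2) ^ 2 = 6 * m * RR m := by
  have h1 := rotR (m := m) (fun v => (2 * v.1 + v.2) ^ 2)
  have h2 := rotR (m := m) (fun v => (2 * (-v.1 - v.2) + v.1) ^ 2)
  dsimp only at h1 h2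
  have h3 : ∑ v ∈ RS m, ((2 * v.1 + v.2) ^ 2 + (2 * (-v.1 - v.2) + v.1) ^ 2 + (2 * (-(-v.1 - v.2) - v.1) + (-v.1 - v.2)) ^ 2) = 6 * m * RR m := by
    rw [RR, sum_congr rfl (g := fun _ => 6 * (m : ℤ))]
    · rw [Finset.sum_const, nsmul_eq_mul]; ring
    · rintro ⟨x, y⟩ h; rw [mem_RS] at h; rw [← h]; dsimp only; ring
  rw [sum_add_distrib, sum_add_distrib] at h3
  linarith

theorem stepC (n : ℕ) : ∑ q ∈ VV n with LL q, ff q =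
    ∑ w ∈ range (n / 3 + 1), ∑ v ∈ RS (n - 3 * w), ∑ v' ∈ RS w, (v.2 ^ 2 - (2 * v'.1 + v'.2) ^ 2) := by
  simp_rw [← Finset.sum_product']
  rw [Finset.sum_sigma']
  symm
  refine Finset.sum_bij' (fun z _ => (2 * z.2.1.1 + z.2.1.2, z.2.1.2, 3 * z.2.2.2, 2 * z.2.2.1 + z.2.2.2))
    (fun q _ => ⟨((((q.2.2.2 - q.2.2.1 / 3) / 2) ^ 2 + ((q.2.2.2 - q.2.2.1 / 3) / 2) * (q.2.2.1 / 3) + (q.2.2.1 / 3) ^ 2)).toNat,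
      (((q.1 - q.2.1) / 2, q.2.1), ((q.2.2.2 - q.2.2.1 / 3) / 2, q.2.2.1 / 3))⟩) ?_ ?_ ?_ ?_ ?_
  · rintro ⟨w, ⟨x, y⟩, ⟨x', y'⟩⟩ h
    simp only [mem_sigma, mem_product, mem_RS, mem_range] at h
    rw [mem_filter, mem_VV, LL]
    dsimp only
    obtain ⟨h1, h2, h3⟩ := h
    rw [Nat.cast_sub (by omega)] at h2
    push_cast at h2
    refine ⟨by linear_combination 4 * h2 + 12 * h3, by omega, by omega, by omega⟩
  · rintro ⟨A, B, C, D⟩ h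
    rw [mem_filter, mem_VV, LL] at h
    simp only [mem_sigma, mem_product, mem_RS, mem_range] at *
    obtain ⟨h, h1, h2, h3⟩ := h
    obtain ⟨c, rfl⟩ : ∃ c, C = 3 * c := ⟨C / 3, by omega⟩
    obtain ⟨x, rfl⟩ : ∃ x, A = 2 * x + B := ⟨(A - B) / 2, by omega⟩
    obtain ⟨z, rfl⟩ : ∃ z, D = 2 * z + c := ⟨(D - c) / 2, by omega⟩
    have e1 : 3 * c / 3 = c := by omega
    have e2 : (2 * z + c - c) / 2 = z := by omega
    have e3 : (2 * x + B - B) / 2 = x := by omega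
    rw [e1, e2, e3]
    have p1 : 0 ≤ z ^ 2 + z * c + c ^ 2 := by nlinarith [sq_nonneg (z + c), sq_nonneg z, sq_nonneg c]
    have p2 : 0 ≤ x ^ 2 + x * B + B ^ 2 := by nlinarith [sq_nonneg (x + B), sq_nonneg x, sq_nonneg B]
    have e : (x ^ 2 + x * B + B ^ 2) + 3 * (z ^ 2 + z * c + c ^ 2) = n := by linarith
    generalize hZ : z ^ 2 + z * c + c ^ 2 = Z at *
    generalize x ^ 2 + x * B + B ^ 2 = W at *
    omega
  · rintro ⟨w, ⟨x, y⟩, ⟨x', y'⟩⟩ h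
    simp only [mem_sigma, mem_product, mem_RS, mem_range] at h
    obtain ⟨h1, h2, h3⟩ := h
    have e1 : 3 * y' / 3 = y' := by omega
    have e2 : (2 * x' + y' - y') / 2 = x' := by omega
    have e3 : (2 * x + y - y) / 2 = x := by omega
    dsimp only
    rw [e1, e2, e3, h3, Int.toNat_natCast]
  · rintro ⟨A, B, C, D⟩ h
    rw [mem_filter, mem_VV, LL] at h
    obtain ⟨h, h1, h2, h3⟩ := h
    dsimp only at h h1 h2 h3
    simp only [Prod.mk.injEq]
    refine ⟨by omega, trivial, by omega, by omega⟩
  · rintro ⟨w, ⟨x, y⟩, ⟨x', y'⟩⟩ h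
    rfl

theorem eta_RR {m : ℕ} (hm : m % 2 = 0) : 6 * etaCoeff (3 * m + 1) =
    ∑ w ∈ range ((3 * m + 1) / 3 + 1), ((3 * m + 1 : ℕ) - 6 * w : ℤ) * (RR (3 * m + 1 - 3 * w) * RR w) := by
  have h := stepB hm
  rw [stepC] at h
  have : 3 * (4 * etaCoeff (3 * m + 1)) = 2 * ∑ w ∈ range ((3 * m + 1) / 3 + 1), ((3 * m + 1 : ℕ) - 6 * w : ℤ) * (RR (3 * m + 1 - 3 * w) * RR w) := by
    rw [h, mul_sum, mul_sum]
    refine sum_congr rfl fun w hw => ?_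
    rw [mem_range] at hw
    simp only [sum_sub_distrib, Finset.sum_const, ← mul_sum, nsmul_eq_mul]
    have h1 := sumy (3 * m + 1 - 3 * w)
    have h2 := sumz w
    have e1 : ((RS w).card : ℤ) = RR w := rfl
    have e2 : ((RS (3 * m + 1 - 3 * w)).card : ℤ) = RR (3 * m + 1 - 3 * w) := rfl
    rw [e1, e2]
    rw [Nat.cast_sub (by omega)] at h1
    push_cast at h1 ⊢
    linear_combination RR w * h1 - RR (3 * m + 1 - 3 * w) * h2
  linarith

theorem eta_Y {n : ℕ} (hn : n % 6 = 1) : etaCoeff n = n * rh n + 6 * n * Y0 n - 36 * Y1 n := by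
  obtain ⟨m, rfl⟩ : ∃ m, n = 3 * m + 1 := ⟨n / 3, by omega⟩
  have h := eta_RR (m := m) (by omega)
  rw [sum_range_succ'] at h
  have e : ∑ w ∈ range ((3 * m + 1) / 3), ((3 * m + 1 : ℕ) - 6 * (w + 1 : ℕ) : ℤ) * (RR (3 * m + 1 - 3 * (w + 1)) * RR (w + 1)) =
      ∑ w ∈ range ((3 * m + 1) / 3), (36 * ((3 * m + 1 : ℕ) : ℤ) * (rh (w + 1) * rh (3 * m + 1 - 3 * (w + 1))) -
        216 * ((w + 1 : ℕ) * (rh (w + 1) * rh (3 * m + 1 - 3 * (w + 1))))) := by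
    refine sum_congr rfl fun w hw => ?_
    rw [mem_range] at hw
    rw [RR_eq _ (by omega), RR_eq _ (by omega)]; ring
  rw [e, sum_sub_distrib, ← mul_sum, ← mul_sum] at h
  have h0 : Y0 (3 * m + 1) = ∑ w ∈ range ((3 * m + 1) / 3), rh (w + 1) * rh (3 * m + 1 - 3 * (w + 1)) := by
    rw [Y0, sum_range_succ', rh_zero, zero_mul, add_zero]
  have h1 : Y1 (3 * m + 1) = ∑ w ∈ range ((3 * m + 1) / 3), (w + 1 : ℕ) * (rh (w + 1) * rh (3 * m + 1 - 3 * (w + 1))) := by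
    rw [Y1, sum_range_succ', rh_zero, zero_mul, mul_zero, add_zero]
  rw [← h0, ← h1, RR_zero, mul_zero, Nat.sub_zero, RR_eq _ (by omega)] at h
  push_cast at h ⊢
  linarith

theorem H_neg {N : ℤ} (hN : N < 0) : hurwitzClassNumber N = 0 := by
  unfold hurwitzClassNumber
  rw [if_neg (by omega)]
  have : IsEmpty (FormClasses N) := by
    constructor
    intro c
    obtain ⟨Q, hQ, h1, h2⟩ := c.out
    omega
  exact finsum_of_isEmpty _

theorem sumIcc_symm (N : ℕ) (f : ℤ → ℝ) : ∑ t ∈ Icc (-(N : ℤ)) N, f t = f 0 + ∑ t ∈ Icc (1 : ℤ) N, (f t + f (-t)) := by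
  have e : Icc (-(N : ℤ)) N = (Icc (-(N : ℤ)) (-1) ∪ {0}) ∪ Icc (1 : ℤ) N := by
    ext t; simp only [Finset.mem_union, mem_Icc, mem_singleton]; omega
  rw [e, Finset.sum_union, Finset.sum_union, Finset.sum_singleton, sum_add_distrib]
  · have : ∑ t ∈ Icc (-(N : ℤ)) (-1), f t = ∑ t ∈ Icc (1 : ℤ) N, f (-t) := by
      refine sum_nbij' (fun t => -t) (fun t => -t) ?_ ?_ ?_ ?_ ?_
      · intro t h; simp only [mem_Icc] at *; omega
      · intro t h; simp only [mem_Icc] at *; omega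
      · intro t h; simp
      · intro t h; simp
      · intro t h; simp
    rw [this]; ring
  · rw [Finset.disjoint_left]; intro t; simp only [mem_Icc, mem_singleton]; omega
  · rw [Finset.disjoint_left]; intro t; simp only [Finset.mem_union, mem_Icc, mem_singleton]; omega

noncomputable def gg (n : ℕ) (t : ℤ) : ℝ := (t : ℝ) ^ 2 * hurwitzClassNumber (4 * n - t ^ 2)

theorem gg_neg (n : ℕ) (t : ℤ) : gg n (-t) = gg n t := by
  unfold gg; rw [neg_sq, Int.cast_neg, neg_sq]

theorem gg_big {n : ℕ} {t : ℤ} (h : 4 * (n : ℤ) < t ^ 2) : gg n t = 0 := by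
  unfold gg; rw [H_neg (by omega), mul_zero]

theorem gg_eq {n : ℕ} {t : ℤ} (h : t ^ 2 = 4 * (n : ℤ)) : gg n t = - (n / 3) := by
  unfold gg hurwitzClassNumber
  have h' : (t : ℝ) ^ 2 = 4 * (n : ℝ) := by exact_mod_cast h
  rw [if_pos (by omega), h']; ring

theorem HH_fin (n : ℕ) (m : ℤ) : HH 2 m 3 n = ∑ t ∈ Icc (1 : ℤ) (2 * n),
    ((if t % 3 = m % 3 then gg n t else 0) + (if (-t) % 3 = m % 3 then gg n t else 0)) := by
  have h1 : HH 2 m 3 n = ∑ t ∈ Icc (-((2 * n : ℕ) : ℤ)) ((2 * n : ℕ) : ℤ), if t % 3 = m % 3 then gg n t else 0 := by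
    unfold HH
    rw [finsum_eq_sum_of_support_subset]
    · rfl
    · intro t ht
      rw [Function.mem_support] at ht
      by_contra hc
      apply ht
      split_ifs with h
      · apply gg_big
        by_contra hh
        push Not at hh
        apply hc
        have h1 : (n : ℤ) ≤ n * n := by exact_mod_cast Nat.le_mul_self n
        have := abs_le.1 (abs_le_of_sq_le_sq (show t ^ 2 ≤ (2 * (n : ℤ)) ^ 2 by nlinarith) (by positivity))
        rw [mem_coe, mem_Icc]
        push_cast
        exact this
      · rfl
  rw [h1, sumIcc_symm]
  have h0 : gg n 0 = 0 := by unfold gg; simp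
  rw [h0, ite_self, zero_add]
  push_cast
  simp only [gg_neg]

noncomputable def AA (n : ℕ) : ℝ := ∑ t ∈ Icc (1 : ℤ) (2 * n), gg n t
noncomputable def BB (n : ℕ) : ℝ := ∑ t ∈ Icc (1 : ℤ) (2 * n), if t % 3 = 0 then gg n t else 0

theorem HH_zero (n : ℕ) : HH 2 0 3 n = 2 * BB n := by
  rw [HH_fin, BB, mul_sum]
  refine sum_congr rfl fun t _ => ?_
  by_cases h : t % 3 = 0
  · rw [if_pos h, if_pos (by omega), if_pos (by omega)]; ring
  · rw [if_neg h, if_neg (by omega), if_neg (by omega)]; ring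

theorem HH_m (n : ℕ) {m : ℤ} (hm : m = 1 ∨ m = 2) : HH 2 m 3 n = AA n - BB n := by
  rw [HH_fin, BB, AA, ← sum_sub_distrib]
  refine sum_congr rfl fun t _ => ?_
  by_cases h : t % 3 = 0
  · rw [if_pos h, if_neg (by omega), if_neg (by omega)]; ring
  · rw [if_neg h]
    by_cases h' : t % 3 = m % 3
    · rw [if_pos h', if_neg (by omega)]; ring
    · rw [if_neg h', if_pos (by omega)]; ring

theorem BB_eq {n : ℕ} (hn : n % 3 = 1) : BB n = 9 * (Y1 n : ℝ) := by
  have h := P12 (n := (n : ℤ)) (by omega) (fun t => if t % 3 = 0 then t * t else 0)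
  have h3 := level3 (n := (n : ℤ)) (by omega) (by omega)
  rw [level3Y hn] at h3
  have e : ∑ q ∈ SQ (n : ℤ), (cf (fb q) * (fun t : ℤ => if t % 3 = 0 then t * t else 0) (q.1 + q.2.2.2) +
      2 * (ib q : ℤ) * (fun t : ℤ => if t % 3 = 0 then t * t else 0) (q.2.1 + q.2.2.1 - q.2.2.2)) = 54 * Y1 n := by
    rw [← h3]
    refine sum_congr rfl fun q _ => ?_
    dsimp only
    unfold s1 s2
    split_ifs <;> push_cast <;> ring
  rw [e] at h
  have e2 : BB n = ∑ t ∈ Icc (1 : ℤ) (2 * n), (if t ^ 2 < 4 * (n : ℤ) then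
      (((fun t : ℤ => if t % 3 = 0 then t * t else 0) t : ℤ) : ℝ) * hurwitzClassNumber (4 * n - t ^ 2) else 0) := by
    unfold BB
    refine sum_congr rfl fun t _ => ?_
    dsimp only
    by_cases h1 : t % 3 = 0
    · rw [if_pos h1, if_pos h1]
      rcases lt_trichotomy (t ^ 2) (4 * (n : ℤ)) with h2 | h2 | h2
      · rw [if_pos h2]; unfold gg; push_cast; ring
      · exfalso
        obtain ⟨k, rfl⟩ : ∃ k, t = 3 * k := ⟨t / 3, by omega⟩
        have : 3 * (3 * k ^ 2) = 4 * (n : ℤ) := by rw [← h2]; ring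
        omega
      · rw [if_neg (by omega), gg_big h2]
    · rw [if_neg h1, if_neg h1]; simp
  rw [← e2] at h
  push_cast at h
  linarith

theorem sq_count {n : ℕ} (hn : 0 < n) : (∑ t ∈ Icc (1 : ℤ) (2 * n), if t ^ 2 = 4 * (n : ℤ) then (1 : ℝ) else 0) =
    ∑ x ∈ n.divisorsAntidiagonal, if x.1 = x.2 then (1 : ℝ) else 0 := by
  rw [← sum_filter, ← sum_filter]
  refine sum_nbij' (fun t => ((t / 2).toNat, (t / 2).toNat)) (fun x => 2 * (x.1 : ℤ)) ?_ ?_ ?_ ?_ ?_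
  · intro t h
    simp only [mem_filter, mem_Icc, Nat.mem_divisorsAntidiagonal] at *
    have h1 : t % 2 = 0 := by
      have : (2 : ℤ) ∣ t ^ 2 := ⟨2 * n, by rw [h.2]; ring⟩
      have := Int.prime_two.dvd_of_dvd_pow this
      omega
    obtain ⟨k, rfl⟩ : ∃ k, t = 2 * k := ⟨t / 2, by omega⟩
    lift k to ℕ using (by omega)
    have e : (2 * (k : ℤ) / 2).toNat = k := by omega
    rw [e]
    refine ⟨⟨?_, by omega⟩, trivial⟩
    zify; linarith [h.2]
  · rintro ⟨a, b⟩ h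
    simp only [mem_filter, mem_Icc, Nat.mem_divisorsAntidiagonal] at *
    obtain ⟨⟨h1, h2⟩, rfl⟩ := h
    have h3 : 0 < a := Nat.pos_of_ne_zero (by rintro rfl; simp at h1; omega)
    have h4 : a ≤ a * a := Nat.le_mul_self a
    refine ⟨⟨by omega, by omega⟩, ?_⟩
    rw [← h1]; push_cast; ring
  · intro t h
    simp only [mem_filter, mem_Icc] at *
    have h1 : t % 2 = 0 := by
      have : (2 : ℤ) ∣ t ^ 2 := ⟨2 * n, by rw [h.2]; ring⟩
      have := Int.prime_two.dvd_of_dvd_pow this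
      omega
    omega
  · rintro ⟨a, b⟩ h
    simp only [mem_filter] at *
    obtain ⟨_, rfl⟩ := h
    simp
  · intro _ _; rfl

theorem AA_eq {n : ℕ} (hn : 0 < n) : 2 * AA n = ∑ x ∈ n.divisorsAntidiagonal, ((n : ℝ) * (max x.1 x.2 : ℕ) - ((min x.1 x.2 : ℕ) : ℝ) ^ 3) := by
  have h := P12 (n := (n : ℤ)) (by omega) (fun t => t * t)
  have h1 := level1 (n := (n : ℤ)) (by omega)
  rw [sum_hv n hn] at h1
  have e : ∑ q ∈ SQ (n : ℤ), (cf (fb q) * (fun t : ℤ => t * t) (q.1 + q.2.2.2) +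
      2 * (ib q : ℤ) * (fun t : ℤ => t * t) (q.2.1 + q.2.2.1 - q.2.2.2)) = ∑ q ∈ SQ (n : ℤ), (cf (fb q) * s1 q + 2 * ib q * s2 q) := rfl
  rw [e, h1] at h
  have e2 : AA n = ∑ t ∈ Icc (1 : ℤ) (2 * n), ((if t ^ 2 < 4 * (n : ℤ) then
      (((fun t : ℤ => t * t) t : ℤ) : ℝ) * hurwitzClassNumber (4 * n - t ^ 2) else 0) - (n : ℝ) / 3 * (if t ^ 2 = 4 * (n : ℤ) then (1 : ℝ) else 0)) := by
    unfold AA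
    refine sum_congr rfl fun t _ => ?_
    dsimp only
    rcases lt_trichotomy (t ^ 2) (4 * (n : ℤ)) with h2 | h2 | h2
    · rw [if_pos h2, if_neg (by omega)]; unfold gg; push_cast; ring
    · rw [if_neg (by omega), if_pos h2, gg_eq h2]; ring
    · rw [if_neg (by omega), if_neg (by omega), gg_big h2]; ring
  rw [sum_sub_distrib, ← mul_sum, sq_count hn] at e2
  have e3 : ((∑ x ∈ n.divisorsAntidiagonal, (3 * n * max x.1 x.2 - 3 * (min x.1 x.2 : ℤ) ^ 3 + if x.1 = x.2 then 2 * (n : ℤ) else 0) : ℤ) : ℝ) =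
     3 * ∑ x ∈ n.divisorsAntidiagonal, ((n : ℝ) * (max x.1 x.2 : ℕ) - ((min x.1 x.2 : ℕ) : ℝ) ^ 3) + 2 * n * ∑ x ∈ n.divisorsAntidiagonal, (if x.1 = x.2 then (1 : ℝ) else 0) := by
    rw [mul_sum, mul_sum, ← sum_add_distrib, Int.cast_sum]
    refine sum_congr rfl fun x _ => ?_
    split_ifs <;> push_cast <;> ring
  rw [e3] at h
  linarith

theorem sum_min (r : ℕ) : ∀ f : ℕ → ℝ, ∑ i ∈ range (r + 1), f (min i (r - i)) =
    ∑ i ∈ range ((r + 1) / 2), f i + ∑ i ∈ range (r / 2 + 1), f i := by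
  induction r using Nat.twoStepInduction with
  | zero => intro f; simp
  | one => intro f; simp [sum_range_succ]
  | more r ih _ =>
    intro f
    have e1 : (r + 2 + 1) / 2 = (r + 1) / 2 + 1 := by omega
    have e2 : (r + 2) / 2 = r / 2 + 1 := by omega
    rw [e1, e2, sum_range_succ' f, sum_range_succ' f (r / 2 + 1), sum_range_succ, sum_range_succ']
    have h := ih (fun i => f (i + 1))
    have e3 : ∑ i ∈ range (r + 1), f (min (i + 1) (r + 2 - (i + 1))) = ∑ i ∈ range (r + 1), f (min i (r - i) + 1) := by
      refine sum_congr rfl fun i hi => ?_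
      rw [mem_range] at hi
      congr 1; omega
    have e4 : min 0 (r + 2 - 0) = 0 := by omega
    have e5 : min (r + 2) (r + 2 - (r + 2)) = 0 := by omega
    rw [e3, h, e4, e5]; ring

theorem AA_pow {p : ℕ} (hp : p.Prime) (r : ℕ) : 2 * AA (p ^ r) =
    (p : ℝ) ^ r * (2 * ∑ i ∈ range (r + 1), (p : ℝ) ^ i - (∑ i ∈ range ((r + 1) / 2), (p : ℝ) ^ i + ∑ i ∈ range (r / 2 + 1), (p : ℝ) ^ i))
     - (∑ i ∈ range ((r + 1) / 2), ((p : ℝ) ^ 3) ^ i + ∑ i ∈ range (r / 2 + 1), ((p : ℝ) ^ 3) ^ i) := by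
  rw [AA_eq (pow_pos hp.pos r), Nat.sum_divisorsAntidiagonal (f := fun a b : ℕ => (((p ^ r : ℕ) : ℝ) * (max a b : ℕ) - ((min a b : ℕ) : ℝ) ^ 3)),
    Nat.sum_divisors_prime_pow hp, ← sum_min r (fun i => (p : ℝ) ^ i), ← sum_min r (fun i => ((p : ℝ) ^ 3) ^ i)]
  have e1 : 2 * ∑ i ∈ range (r + 1), (p : ℝ) ^ i = ∑ i ∈ range (r + 1), ((p : ℝ) ^ i + (p : ℝ) ^ (r - i)) := by
    rw [sum_add_distrib]
    have := Finset.sum_range_reflect (fun i => (p : ℝ) ^ i) (r + 1)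
    simp only [Nat.add_sub_cancel] at this
    rw [this]; ring
  rw [e1, ← sum_sub_distrib, mul_sum, ← sum_sub_distrib]
  refine sum_congr rfl fun i hi => ?_
  rw [mem_range] at hi
  rw [Nat.pow_div (by omega) hp.pos]
  have m1 := hp.one_lt.le
  rcases le_total i (r - i) with h | h
  · have := Nat.pow_le_pow_right hp.pos h
    rw [max_eq_right this, min_eq_left this, min_eq_left h]; push_cast; ring
  · have := Nat.pow_le_pow_right hp.pos h
    rw [max_eq_left this, min_eq_right this, min_eq_right h]; push_cast; ring

theorem second_moment_aux (p : ℕ) (hp : p.Prime)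
    (hp1 : p % 3 = 1) (r : ℕ) :
    HH 2 0 3 (p ^ r) =
        (p : ℝ) ^ r / 2 * (((p : ℝ) ^ (r + 1) - 1) / ((p : ℝ) - 1))
          - (etaCoeff (p ^ r) : ℝ) / 2
    ∧ ∀ m : ℤ, m = 1 ∨ m = 2 →
        HH 2 m 3 (p ^ r) =
          -(((p : ℝ) ^ (3 * (r / 2) + 3) - 1) / ((p : ℝ) ^ 3 - 1))
          + 3 * (p : ℝ) ^ r / 4 * (((p : ℝ) ^ (r + 1) - 1) / ((p : ℝ) - 1))
          - (p : ℝ) ^ r * (((p : ℝ) ^ ((r + 1) / 2) - 1) / ((p : ℝ) - 1))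
          + (etaCoeff (p ^ r) : ℝ) / 4 := by
  have hodd : p % 2 = 1 := by
    rcases hp.eq_two_or_odd with h | h
    · omega
    · exact h
  have hp6 : p % 6 = 1 := by omega
  have hn6 : p ^ r % 6 = 1 := by rw [Nat.pow_mod, hp6]; simp
  have hn3 : p ^ r % 3 = 1 := by omega
  have hY := eta_Y hn6
  have hL := liou hn3
  rw [Nat.sum_divisors_prime_pow hp] at hL
  have hp2 : (1 : ℝ) < p := by exact_mod_cast hp.one_lt
  have hp3' : (1 : ℝ) < (p : ℝ) ^ 3 := one_lt_pow₀ hp2 (by norm_num)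
  have hB : BB (p ^ r) = (p : ℝ) ^ r / 4 * ∑ i ∈ range (r + 1), (p : ℝ) ^ i - (etaCoeff (p ^ r) : ℝ) / 4 := by
    rw [BB_eq hn3]
    have h1 : (∑ i ∈ range (r + 1), (p : ℝ) ^ i) = (rh (p ^ r) : ℝ) + 6 * Y0 (p ^ r) := by exact_mod_cast hL
    rw [h1, hY]
    push_cast
    ring
  have hA := AA_pow hp r
  have k1 : (((p : ℝ) ^ (r + 1) - 1) / ((p : ℝ) - 1)) = ∑ i ∈ range (r + 1), (p : ℝ) ^ i := (geom_sum_eq hp2.ne' _).symm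
  have k2 : (((p : ℝ) ^ ((r + 1) / 2) - 1) / ((p : ℝ) - 1)) = ∑ i ∈ range ((r + 1) / 2), (p : ℝ) ^ i := (geom_sum_eq hp2.ne' _).symm
  have k3 : (((p : ℝ) ^ (3 * (r / 2) + 3) - 1) / ((p : ℝ) ^ 3 - 1)) = ∑ i ∈ range (r / 2 + 1), ((p : ℝ) ^ 3) ^ i := by
    rw [geom_sum_eq hp3'.ne', ← pow_mul]; rfl
  rw [k1, k2, k3]
  refine ⟨by rw [HH_zero, hB]; ring, fun m hm => ?_⟩
  rw [HH_m _ hm, hB]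
  rcases Nat.even_or_odd' r with ⟨k, h | h⟩
  · have q1 : (r + 1) / 2 = k := by omega
    have q2 : r / 2 = k := by omega
    rw [q1, q2, sum_range_succ (fun i => (p : ℝ) ^ i) k, sum_range_succ (fun i => ((p : ℝ) ^ 3) ^ i) k] at hA
    rw [q1, q2, sum_range_succ (fun i => ((p : ℝ) ^ 3) ^ i) k]
    have q3 : (p : ℝ) ^ r * (p : ℝ) ^ k = ((p : ℝ) ^ 3) ^ k := by rw [h, ← pow_add, ← pow_mul]; congr 1; ring
    linear_combination hA / 2 - q3 / 2
  · have q1 : (r + 1) / 2 = k + 1 := by omega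
    have q2 : r / 2 = k := by omega
    rw [q1, q2] at hA
    rw [q1, q2]
    linear_combination hA / 2

end

/-- Corollary 1.3 (1), case `p ≡ 1 (mod 3)`:
for a prime `p ≠ 3` with `p ≡ 1 (mod 3)` and `r ≥ 1`,
`H_{2,0,3}(p^r) = (p^r/2)(p^{r+1}-1)/(p-1) - a(p^r)/2`, and for `m ∈ {1,2}`,
`H_{2,m,3}(p^r) = -(p^{3⌊r/2⌋+3}-1)/(p³-1) + (3p^r/4)(p^{r+1}-1)/(p-1)`
`- p^r (p^{⌊(r+1)/2⌋}-1)/(p-1) + a(p^r)/4`. -/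
theorem second_moment_prime_power_one_mod_three (p : ℕ) (hp : p.Prime) (hp3 : p ≠ 3)
    (hp1 : p % 3 = 1) (r : ℕ) (hr : 0 < r) :
    HH 2 0 3 (p ^ r) =
        (p : ℝ) ^ r / 2 * (((p : ℝ) ^ (r + 1) - 1) / ((p : ℝ) - 1))
          - (etaCoeff (p ^ r) : ℝ) / 2
    ∧ ∀ m : ℤ, m = 1 ∨ m = 2 →
        HH 2 m 3 (p ^ r) =
          -(((p : ℝ) ^ (3 * (r / 2) + 3) - 1) / ((p : ℝ) ^ 3 - 1))
          + 3 * (p : ℝ) ^ r / 4 * (((p : ℝ) ^ (r + 1) - 1) / ((p : ℝ) - 1))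
          - (p : ℝ) ^ r * (((p : ℝ) ^ ((r + 1) / 2) - 1) / ((p : ℝ) - 1))
          + (etaCoeff (p ^ r) : ℝ) / 4 := by
  exact second_moment_aux p hp hp1 r

end HurwitzPaper
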